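/- Theorem 2: Assume conditions (A1), (A2), (A3). If τ_n² ⪯ n^{−3/2} q_n and ∫₀^∞ λ⁴ π(λ²) dλ² < ∞, then E₀ [tr V(K_n β_n | Y_n)] ⪯ q_n as n → ∞, where tr V(K_n β_n | Y_n) denotes the trace of the posterior covariance matrix of K_n β_n given Y_n. -/

import Mathlib

open MeasureTheory Matrix Filter

noncomputable section

namespace RVM

/-- Squared Euclidean norm of a vector in `ℝⁿ`. -/
def sqnorm {n : ℕ} (v : Fin n → ℝ) : ℝ := v ⬝ᵥ v

/-- The hierarchical Bayesian relevance vector machine model (Model 1) of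
Fang–Ghosh.  For each `n`, `K n` is a symmetric positive definite `n × n` kernel matrix,
`β0 n` is the true coefficient vector, `σ0sq` the true error variance, `τsq n` the global
shrinkage parameter, `pr` the common prior density of the local parameters `λᵢ²` on `(0, ∞)`,
and `a, b` the hyperparameters of the inverse-gamma prior on `σ²`. -/
structure Model where
  K : (n : ℕ) → Matrix (Fin n) (Fin n) ℝ
  β0 : (n : ℕ) → Fin n → ℝ
  σ0sq : ℝ
  τsq : ℕ → ℝ
  pr : ℝ → ℝ
  a : ℝ
  b : ℝ
  hK : ∀ n, (K n).PosDef
  hσ0 : 0 < σ0sq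
  ha : 0 < a
  hb : 0 < b
  hpr_nonneg : ∀ x, 0 ≤ pr x
  hpr_supp : ∀ x ≤ 0, pr x = 0
  hpr_int : ∫ x in Set.Ioi (0 : ℝ), pr x = 1

namespace Model

variable (M : Model)

/-- `q n`: the number of nonzero entries of the true coefficient vector `β0 n`. -/
def q (n : ℕ) : ℕ := {i : Fin n | M.β0 n i ≠ 0}.ncard

/-- The unnormalized joint posterior density of `(β, σ², λ²)` given data `Y`:
`(σ²)^{−n−a/2−1} ∏ᵢ π(λᵢ²) · |Λ²|^{−1/2} ·
  exp[(−b − βᵀ τ⁻² Λ⁻² β − (Y − Kβ)ᵀ(Y − Kβ)) / (2σ²)]`. -/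
def jd (n : ℕ) (Y : Fin n → ℝ) (β : Fin n → ℝ) (s : ℝ) (l : Fin n → ℝ) : ℝ :=
  s ^ (-(n : ℝ) - M.a / 2 - 1) * (∏ i, M.pr (l i)) * (∏ i, l i) ^ (-(1 : ℝ) / 2) *
    Real.exp ((-M.b - (M.τsq n)⁻¹ * ∑ i, (β i) ^ 2 / l i
        - sqnorm (Y - M.K n *ᵥ β)) / (2 * s))

/-- The region `{(β, σ², λ²) : σ² > 0, λᵢ² > 0 ∀ i}` over which the posterior lives. -/
def posSet (n : ℕ) : Set ((Fin n → ℝ) × ℝ × (Fin n → ℝ)) :=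
  {p | 0 < p.2.1 ∧ ∀ i, 0 < p.2.2 i}

/-- Normalizing constant of the posterior given `Y`. -/
def Z (n : ℕ) (Y : Fin n → ℝ) : ℝ :=
  ∫ p in posSet n, M.jd n Y p.1 p.2.1 p.2.2

/-- Posterior mean `E(βₙ | Yₙ)` of the coefficient vector. -/
def postMean (n : ℕ) (Y : Fin n → ℝ) : Fin n → ℝ :=
  (M.Z n Y)⁻¹ • ∫ p in posSet n, M.jd n Y p.1 p.2.1 p.2.2 • p.1

/-- Posterior probability `P(βₙ ∈ E | Yₙ)`. -/
def postProb (n : ℕ) (Y : Fin n → ℝ) (E : Set (Fin n → ℝ)) : ℝ :=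
  (∫ p in posSet n ∩ {p | p.1 ∈ E}, M.jd n Y p.1 p.2.1 p.2.2) / M.Z n Y

/-- Trace of the posterior covariance matrix `V(βₙ | Yₙ)`,
i.e. `E(‖βₙ − E(βₙ|Yₙ)‖² | Yₙ)`. -/
def trPostVar (n : ℕ) (Y : Fin n → ℝ) : ℝ :=
  (M.Z n Y)⁻¹ * ∫ p in posSet n, M.jd n Y p.1 p.2.1 p.2.2 * sqnorm (p.1 - M.postMean n Y)

/-- Trace of the posterior covariance matrix `V(Kₙ βₙ | Yₙ)`,
i.e. `E(‖Kₙβₙ − Kₙ E(βₙ|Yₙ)‖² | Yₙ)`. -/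
def trPostVarK (n : ℕ) (Y : Fin n → ℝ) : ℝ :=
  (M.Z n Y)⁻¹ * ∫ p in posSet n,
    M.jd n Y p.1 p.2.1 p.2.2 * sqnorm (M.K n *ᵥ p.1 - M.K n *ᵥ M.postMean n Y)

/-- Density of the true data-generating distribution `N(Kₙ β₀ₙ, σ₀² Iₙ)`. -/
def trueDens (n : ℕ) (Y : Fin n → ℝ) : ℝ :=
  (2 * Real.pi * M.σ0sq) ^ (-(n : ℝ) / 2) *
    Real.exp (-sqnorm (Y - M.K n *ᵥ M.β0 n) / (2 * M.σ0sq))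

/-- Expectation `E₀` under the true data-generating distribution `Yₙ ~ N(Kₙ β₀ₙ, σ₀² Iₙ)`. -/
def E0 (n : ℕ) (f : (Fin n → ℝ) → ℝ) : ℝ :=
  ∫ Y, f Y * M.trueDens n Y

/-- Condition (A1): `c₁ Iₙ ≤ Kₙ ≤ c₂ Iₙ` for sufficiently large `n`, with constants
`0 < c₁ ≤ c₂` not depending on `n`. -/
def CondA1 : Prop :=
  ∃ c₁ c₂ : ℝ, 0 < c₁ ∧ c₁ ≤ c₂ ∧ ∃ N : ℕ, ∀ n ≥ N,
    (M.K n - c₁ • (1 : Matrix (Fin n) (Fin n) ℝ)).PosSemidef ∧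
      (c₂ • (1 : Matrix (Fin n) (Fin n) ℝ) - M.K n).PosSemidef

/-- Condition (A2): the true coefficients are uniformly bounded, `|β₀ₙ,ᵢ| < M₀` with `M₀`
independent of `n`. -/
def CondA2 : Prop := ∃ M₀ : ℝ, ∀ n, ∀ i : Fin n, |M.β0 n i| < M₀

/-- Condition (A3): `qₙ = o(n)`. -/
def CondA3 : Prop := Tendsto (fun n => (M.q n : ℝ) / n) atTop (nhds 0)

/-- Finite fourth moment of the prior: `∫ λ⁴ π(λ²) dλ² < ∞`. -/
def Moment4 : Prop := IntegrableOn (fun x => x ^ 2 * M.pr x) (Set.Ioi (0 : ℝ))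

/-- Finite inverse second moment of the prior: `∫ λ⁻² π(λ²) dλ² < ∞`. -/
def MomentNeg2 : Prop := IntegrableOn (fun x => x⁻¹ * M.pr x) (Set.Ioi (0 : ℝ))

end Model

end RVM

open RVM Filter

namespace RVMProof

open scoped ENNReal

section

/-! ### Product measures -/

lemma aemeasurable_pi_prod {n : ℕ} {μ : Fin n → Measure ℝ} [∀ i, SigmaFinite (μ i)]
    {f : Fin n → ℝ → ℝ≥0∞} (hf : ∀ i, AEMeasurable (f i) (μ i)) :
    AEMeasurable (fun x : Fin n → ℝ => ∏ i, f i (x i)) (Measure.pi μ) :=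
  Finset.aemeasurable_fun_prod _ fun i _ =>
    (hf i).comp_quasiMeasurePreserving (Measure.quasiMeasurePreserving_eval μ i)

lemma lintegral_pi_prod {n : ℕ} {μ : Fin n → Measure ℝ} [∀ i, SigmaFinite (μ i)]
    {f : Fin n → ℝ → ℝ≥0∞} (hf : ∀ i, AEMeasurable (f i) (μ i)) :
    ∫⁻ x : Fin n → ℝ, ∏ i, f i (x i) ∂(Measure.pi μ) = ∏ i, ∫⁻ x, f i x ∂(μ i) := by
  induction n with
  | zero => simp
  | succ n ih =>
    rw [← ((measurePreserving_piFinSuccAbove μ 0).symm).lintegral_comp_emb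
      (MeasurableEquiv.measurableEmbedding _)]
    simp_rw [MeasurableEquiv.piFinSuccAbove_symm_apply, Fin.insertNthEquiv, Fin.prod_univ_succ,
      Equiv.coe_fn_mk, Fin.insertNth_zero, Fin.cons_succ, Fin.zero_succAbove, cast_eq,
      Fin.cons_zero]
    rw [lintegral_prod_mul (hf 0) (aemeasurable_pi_prod fun i => hf i.succ),
      ih fun i => hf i.succ]

lemma pi_withDensity {n : ℕ} {μ : Measure ℝ} [SigmaFinite μ] {f : ℝ → ℝ≥0∞}
    (hf : AEMeasurable f μ) [SigmaFinite (μ.withDensity f)] :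
    Measure.pi (fun _ : Fin n => μ.withDensity f) =
      (Measure.pi fun _ : Fin n => μ).withDensity (fun x => ∏ i, f (x i)) := by
  refine Measure.pi_eq fun s hs => ?_
  rw [withDensity_apply _ (MeasurableSet.univ_pi hs), Measure.restrict_pi_pi,
    lintegral_pi_prod (fun i => hf.restrict)]
  exact Finset.prod_congr rfl fun i _ => (withDensity_apply _ (hs i)).symm

lemma lintegral_pi_eval {n : ℕ} {μ : Measure ℝ} [IsProbabilityMeasure μ] (i : Fin n)
    {f : ℝ → ℝ≥0∞} (hf : Measurable f) :
    ∫⁻ x : Fin n → ℝ, f (x i) ∂(Measure.pi fun _ => μ) = ∫⁻ x, f x ∂μ :=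
  (measurePreserving_eval (fun _ : Fin n => μ) i).lintegral_comp hf

/-! ### Gaussian integrals -/

lemma lintegral_exp_neg_diag {n : ℕ} {p : Fin n → ℝ} (hp : ∀ i, 0 < p i) :
    ∫⁻ x : Fin n → ℝ, ENNReal.ofReal (Real.exp (-∑ i, p i * x i ^ 2)) =
      ENNReal.ofReal (∏ i, √(Real.pi / p i)) := by
  have h1 : ∀ x : Fin n → ℝ, ENNReal.ofReal (Real.exp (-∑ i, p i * x i ^ 2)) =
      ∏ i, ENNReal.ofReal (Real.exp (-p i * x i ^ 2)) := fun x => by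
    rw [← ENNReal.ofReal_prod_of_nonneg fun i _ => (Real.exp_pos _).le, ← Real.exp_sum,
      ← Finset.sum_neg_distrib]
    simp
  simp_rw [h1]
  rw [volume_pi, lintegral_pi_prod (f := fun i y => ENNReal.ofReal (Real.exp (-p i * y ^ 2)))
    fun i => by fun_prop, ENNReal.ofReal_prod_of_nonneg fun i _ => Real.sqrt_nonneg _]
  refine Finset.prod_congr rfl fun i _ => ?_
  rw [← integral_gaussian, ofReal_integral_eq_lintegral_ofReal (integrable_exp_neg_mul_sq (hp i))
    (ae_of_all _ fun _ => (Real.exp_pos _).le)]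

/-- Quadratic form of a matrix. -/
def quad {n : ℕ} (A : Matrix (Fin n) (Fin n) ℝ) (x : Fin n → ℝ) : ℝ := x ⬝ᵥ A *ᵥ x

lemma continuous_quad {n : ℕ} (A : Matrix (Fin n) (Fin n) ℝ) : Continuous (quad A) := by
  unfold quad; fun_prop

lemma quad_add {n : ℕ} {A : Matrix (Fin n) (Fin n) ℝ} (hA : Aᵀ = A) (x y : Fin n → ℝ) :
    quad A (x + y) = quad A x + 2 * (A *ᵥ y ⬝ᵥ x) + A *ᵥ y ⬝ᵥ y := by
  have h : y ⬝ᵥ A *ᵥ x = A *ᵥ y ⬝ᵥ x := by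
    rw [dotProduct_mulVec, ← mulVec_transpose, hA]
  simp only [quad, mulVec_add, dotProduct_add, add_dotProduct]
  rw [h, dotProduct_comm x (A *ᵥ y), dotProduct_comm y (A *ᵥ y)]
  ring

lemma quad_smul {n : ℕ} (A : Matrix (Fin n) (Fin n) ℝ) (c : ℝ) (x : Fin n → ℝ) :
    quad A (c • x) = c ^ 2 * quad A x := by
  simp only [quad, mulVec_smul, dotProduct_smul, smul_dotProduct, smul_eq_mul]; ring

lemma lintegral_gaussian_tilt {n : ℕ} {A : Matrix (Fin n) (Fin n) ℝ} (hA : Aᵀ = A) {s : ℝ}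
    (hs : 0 < s) (y : Fin n → ℝ) :
    ∫⁻ x : Fin n → ℝ, ENNReal.ofReal (Real.exp (-quad A x / (2 * s) + (A *ᵥ y ⬝ᵥ x) / s)) =
      ENNReal.ofReal (Real.exp ((A *ᵥ y ⬝ᵥ y) / (2 * s))) *
        ∫⁻ x : Fin n → ℝ, ENNReal.ofReal (Real.exp (-quad A x / (2 * s))) := by
  rw [← lintegral_add_right_eq_self _ y, ← lintegral_const_mul' _ _ ENNReal.ofReal_ne_top]
  refine lintegral_congr fun x => ?_
  rw [← ENNReal.ofReal_mul (Real.exp_pos _).le, ← Real.exp_add, quad_add hA, dotProduct_add]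
  congr 2
  field_simp
  ring

lemma sq_le_exp {y : ℝ} (hy : 0 ≤ y) : y ^ 2 ≤ Real.exp y := by
  have h := Real.sum_le_exp_of_nonneg hy 4
  simp only [Finset.sum_range_succ, Finset.sum_range_zero, Nat.factorial] at h
  norm_num at h
  nlinarith [mul_nonneg hy (sq_nonneg (y - 2))]

lemma exp_abs_le (x : ℝ) : Real.exp |x| ≤ Real.exp x + Real.exp (-x) := by
  rcases abs_cases x with ⟨h, _⟩ | ⟨h, _⟩ <;> rw [h] <;>
    linarith [Real.exp_pos x, Real.exp_pos (-x)]

/-- Exponential moment of a linear functional under a centred Gaussian weight. -/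
lemma lintegral_gaussian_exp_abs {n : ℕ} {A : Matrix (Fin n) (Fin n) ℝ} (hA : Aᵀ = A) {s : ℝ}
    (hs : 0 < s) (y : Fin n → ℝ) :
    ∫⁻ x : Fin n → ℝ, ENNReal.ofReal
        (Real.exp |(A *ᵥ y ⬝ᵥ x) / s| * Real.exp (-quad A x / (2 * s))) ≤
      ENNReal.ofReal (2 * Real.exp ((A *ᵥ y ⬝ᵥ y) / (2 * s))) *
        ∫⁻ x : Fin n → ℝ, ENNReal.ofReal (Real.exp (-quad A x / (2 * s))) := by
  have hq := continuous_quad A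
  calc _ ≤ ∫⁻ x : Fin n → ℝ, (ENNReal.ofReal
          (Real.exp (-quad A x / (2 * s) + (A *ᵥ y ⬝ᵥ x) / s)) + ENNReal.ofReal
          (Real.exp (-quad A x / (2 * s) + (A *ᵥ (-y) ⬝ᵥ x) / s))) := by
        refine lintegral_mono fun x => ?_
        rw [← ENNReal.ofReal_add (Real.exp_pos _).le (Real.exp_pos _).le]
        refine ENNReal.ofReal_le_ofReal ?_
        rw [mulVec_neg, neg_dotProduct, Real.exp_add, Real.exp_add, neg_div _ (A *ᵥ y ⬝ᵥ x)]
        have := exp_abs_le ((A *ᵥ y ⬝ᵥ x) / s)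
        have h2 := Real.exp_pos (-quad A x / (2 * s))
        nlinarith
    _ = _ := by
        rw [lintegral_add_left (by fun_prop), lintegral_gaussian_tilt hA hs,
          lintegral_gaussian_tilt hA hs, mulVec_neg, neg_dotProduct_neg, ← add_mul,
          ← ENNReal.ofReal_add (Real.exp_pos _).le (Real.exp_pos _).le, ← two_mul]

/-- Second moment of a linear functional under a centred Gaussian weight. -/
lemma lintegral_gaussian_sq {n : ℕ} {A : Matrix (Fin n) (Fin n) ℝ} (hA : Aᵀ = A) {s : ℝ}
    (hs : 0 < s) (y : Fin n → ℝ) {v : ℝ} (hv : 0 < v) (hy : A *ᵥ y ⬝ᵥ y ≤ v) :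
    ∫⁻ x : Fin n → ℝ, ENNReal.ofReal
        ((A *ᵥ y ⬝ᵥ x) ^ 2 * Real.exp (-quad A x / (2 * s))) ≤
      ENNReal.ofReal (4 * (s * v)) *
        ∫⁻ x : Fin n → ℝ, ENNReal.ofReal (Real.exp (-quad A x / (2 * s))) := by
  set θ := √(s / v)
  have hθ : 0 < θ := Real.sqrt_pos.2 (by positivity)
  have hθ2 : θ ^ 2 = s / v := Real.sq_sqrt (by positivity)
  calc _ ≤ ∫⁻ x : Fin n → ℝ, ENNReal.ofReal (s * v) * ENNReal.ofReal
        (Real.exp |(A *ᵥ (θ • y) ⬝ᵥ x) / s| * Real.exp (-quad A x / (2 * s))) := by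
        refine lintegral_mono fun x => ?_
        rw [← ENNReal.ofReal_mul (by positivity), ← mul_assoc]
        refine ENNReal.ofReal_le_ofReal
          (mul_le_mul_of_nonneg_right ?_ (Real.exp_pos _).le)
        have h := sq_le_exp (abs_nonneg ((A *ᵥ (θ • y) ⬝ᵥ x) / s))
        rw [sq_abs] at h
        have h2 : (A *ᵥ y ⬝ᵥ x) ^ 2 = s * v * ((A *ᵥ (θ • y) ⬝ᵥ x) / s) ^ 2 := by
          rw [mulVec_smul, smul_dotProduct, smul_eq_mul, div_pow, mul_pow, hθ2]
          field_simp
        rw [h2]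
        exact mul_le_mul_of_nonneg_left h (by positivity)
    _ ≤ ENNReal.ofReal (s * v) * (ENNReal.ofReal
        (2 * Real.exp ((A *ᵥ (θ • y) ⬝ᵥ (θ • y)) / (2 * s))) *
        ∫⁻ x : Fin n → ℝ, ENNReal.ofReal (Real.exp (-quad A x / (2 * s)))) := by
        rw [lintegral_const_mul' _ _ ENNReal.ofReal_ne_top]
        exact mul_le_mul_right (lintegral_gaussian_exp_abs hA hs _) _
    _ ≤ _ := by
        rw [← mul_assoc, ← ENNReal.ofReal_mul (by positivity)]
        refine mul_le_mul_left (ENNReal.ofReal_le_ofReal ?_) _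
        have h1 : (A *ᵥ (θ • y) ⬝ᵥ (θ • y)) / (2 * s) ≤ 1 / 2 := by
          rw [mulVec_smul, smul_dotProduct, dotProduct_smul, smul_eq_mul, smul_eq_mul,
            ← mul_assoc, ← sq, hθ2, div_le_div_iff₀ (by positivity) two_pos]
          field_simp
          linarith
        have h2 : Real.exp ((A *ᵥ (θ • y) ⬝ᵥ (θ • y)) / (2 * s)) ≤ 2 := by
          refine (Real.exp_le_exp.2 h1).trans ?_
          have h3 : Real.exp (1 / 2) ^ 2 = Real.exp 1 := by
            rw [← Real.exp_nat_mul]; norm_num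
          have h4 := Real.exp_one_lt_d9
          nlinarith [Real.exp_pos (1 / 2)]
        have : 0 < s * v := by positivity
        nlinarith

/-- Rescaling a centred Gaussian weight. -/
lemma lintegral_gaussian_scale {n : ℕ} (A : Matrix (Fin n) (Fin n) ℝ) {s : ℝ} (hs : 0 < s) :
    ∫⁻ x : Fin n → ℝ, ENNReal.ofReal (Real.exp (-quad A x / (2 * s))) =
      ENNReal.ofReal (√s ^ n) *
        ∫⁻ x : Fin n → ℝ, ENNReal.ofReal (Real.exp (-quad A x / 2)) := by
  have hs' : 0 < √s := Real.sqrt_pos.2 hs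
  have hq := continuous_quad A
  have h := Measure.map_addHaar_smul (volume : Measure (Fin n → ℝ)) hs'.ne'
  have h2 : ∫⁻ x : Fin n → ℝ, ENNReal.ofReal (Real.exp (-quad A x / 2)) =
      ∫⁻ x : Fin n → ℝ, ENNReal.ofReal (Real.exp (-quad A ((√s)⁻¹ • (√s • x)) / 2)) := by
    simp_rw [smul_smul, inv_mul_cancel₀ hs'.ne', one_smul]
  rw [h2, ← lintegral_map (μ := volume) (g := fun x => √s • x)
    (f := fun x => ENNReal.ofReal (Real.exp (-quad A ((√s)⁻¹ • x) / 2)))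
    (by fun_prop) (by fun_prop), h, lintegral_smul_measure, smul_eq_mul, ← mul_assoc,
    ← ENNReal.ofReal_mul (by positivity)]
  simp only [Module.finrank_fintype_fun_eq_card, Fintype.card_fin]
  rw [abs_of_pos (by positivity), mul_inv_cancel₀ (by positivity), ENNReal.ofReal_one, one_mul]
  refine lintegral_congr fun x => ?_
  rw [quad_smul, inv_pow, Real.sq_sqrt hs.le]
  congr 2
  field_simp

end

section

/-! ### Inverse-gamma integrals -/

lemma lintegral_inverseGamma {k R : ℝ} (hk : 0 < k) (hR : 0 < R) :
    ∫⁻ s in Set.Ioi (0 : ℝ), ENNReal.ofReal (s ^ (-k - 1) * Real.exp (-R / s)) =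
      ENNReal.ofReal ((1 / R) ^ k * Real.Gamma k) := by
  have key : ∀ x ∈ Set.Ioi (0 : ℝ),
      (|(-1 : ℝ)| * x ^ ((-1 : ℝ) - 1)) • ((x ^ (-1 : ℝ)) ^ (-k - 1) *
        Real.exp (-R / x ^ (-1 : ℝ))) = x ^ (k - 1) * Real.exp (-(R * x)) := by
    intro x hx
    have hx : 0 < x := hx
    rw [← Real.rpow_mul hx.le, smul_eq_mul, abs_neg, abs_one, one_mul, ← mul_assoc,
      ← Real.rpow_add hx, Real.rpow_neg_one, div_inv_eq_mul]
    congr 2 <;> ring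
  have hintg : IntegrableOn (fun x : ℝ => x ^ (k - 1) * Real.exp (-(R * x))) (Set.Ioi 0) := by
    have := integrableOn_rpow_mul_exp_neg_mul_rpow (p := 1) (s := k - 1) (b := R)
      (by linarith) one_pos hR
    simpa [neg_mul] using this
  have hint2 : IntegrableOn (fun s : ℝ => s ^ (-k - 1) * Real.exp (-R / s)) (Set.Ioi 0) := by
    rw [← integrableOn_Ioi_comp_rpow_iff _ (p := -1) (by norm_num)]
    exact hintg.congr_fun (fun x hx => (key x hx).symm) measurableSet_Ioi
  rw [← ofReal_integral_eq_lintegral_ofReal hint2]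
  · congr 1
    rw [← integral_comp_rpow_Ioi _ (p := -1) (by norm_num),
      setIntegral_congr_fun measurableSet_Ioi key, Real.integral_rpow_mul_exp_neg_mul_Ioi hk hR]
  · filter_upwards [ae_restrict_mem measurableSet_Ioi] with s hs
    have hs : 0 < s := hs
    positivity

lemma lintegral_inverseGamma_mean {k R : ℝ} (hk : 1 < k) (hR : 0 < R) :
    ∫⁻ s in Set.Ioi (0 : ℝ), ENNReal.ofReal (s * (s ^ (-k - 1) * Real.exp (-R / s))) =
      ENNReal.ofReal (R / (k - 1)) *
        ∫⁻ s in Set.Ioi (0 : ℝ), ENNReal.ofReal (s ^ (-k - 1) * Real.exp (-R / s)) := by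
  have h1 : ∫⁻ s in Set.Ioi (0 : ℝ), ENNReal.ofReal (s * (s ^ (-k - 1) * Real.exp (-R / s))) =
      ∫⁻ s in Set.Ioi (0 : ℝ), ENNReal.ofReal (s ^ (-(k - 1) - 1) * Real.exp (-R / s)) := by
    refine setLIntegral_congr_fun measurableSet_Ioi fun s hs => ?_
    have hs : 0 < s := hs
    rw [← mul_assoc]
    congr 2
    nth_rewrite 1 [← Real.rpow_one s]
    rw [← Real.rpow_add hs]
    congr 1; ring
  have hk1 : 0 < k - 1 := by linarith
  rw [h1, lintegral_inverseGamma hk1 hR, lintegral_inverseGamma (by linarith) hR,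
    ← ENNReal.ofReal_mul (by positivity)]
  congr 1
  have h2 : Real.Gamma k = (k - 1) * Real.Gamma (k - 1) := by
    rw [← Real.Gamma_add_one hk1.ne', sub_add_cancel]
  have h3 : (1 / R) ^ k = (1 / R) ^ (k - 1) * (1 / R) := by
    rw [← Real.rpow_add_one (by positivity), sub_add_cancel]
  rw [h2, h3]
  field_simp

lemma rpow_mul_exp_window {v x ρ : ℝ} {n : ℕ} (hv : 0 < v) (hx : |x| ≤ 1 / 2)
    (hnx : n * x ^ 2 ≤ 1) (hρ : 0 ≤ (ρ - n * v) * x) :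
    Real.exp (-1) * (v ^ (-(n : ℝ) / 2) * Real.exp (-ρ / (2 * v))) ≤
      (v * (1 + x)) ^ (-(n : ℝ) / 2) * Real.exp (-ρ / (2 * (v * (1 + x)))) := by
  have hx1 : 1 / 2 ≤ 1 + x := by linarith [neg_abs_le x]
  have hx0 : 0 < 1 + x := by linarith
  rw [Real.mul_rpow hv.le hx0.le, Real.rpow_def_of_pos hx0, mul_left_comm, mul_assoc]
  refine mul_le_mul_of_nonneg_left ?_ (by positivity)
  rw [← Real.exp_add, ← Real.exp_add, Real.exp_le_exp]
  have hlog : Real.log (1 + x) ≤ x := by have := Real.log_le_sub_one_of_pos hx0; linarith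
  have h1 : -ρ / (2 * (v * (1 + x))) = -ρ / (2 * v) + ρ * x / (2 * v * (1 + x)) := by
    field_simp; ring
  have h2 : n * x / (2 * (1 + x)) ≤ ρ * x / (2 * v * (1 + x)) := by
    rw [div_le_div_iff₀ (by positivity) (by positivity)]
    nlinarith [mul_nonneg hρ hx0.le]
  have h3 : n * x / (2 * (1 + x)) = n * x / 2 - n * x ^ 2 / (2 * (1 + x)) := by
    field_simp; ring
  have h4 : n * x ^ 2 / (2 * (1 + x)) ≤ 1 := by
    rw [div_le_one (by positivity)]; linarith
  have h5 : (n : ℝ) * Real.log (1 + x) ≤ n * x :=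
    mul_le_mul_of_nonneg_left hlog n.cast_nonneg
  rw [h1]
  linarith

/-- Laplace-type lower bound: integrating the Gaussian likelihood over the variance costs only
a factor of order `√n`, uniformly in the sum of squares `ρ`. -/
lemma lintegral_variance_lower {v a b : ℝ} (hv : 0 < v) (ha : 0 < a) (hb : 0 < b) :
    ∃ c > 0, ∀ n : ℕ, 4 ≤ n → ∀ ρ : ℝ, ENNReal.ofReal
      (c / √n * (v ^ (-(n : ℝ) / 2) * Real.exp (-ρ / (2 * v)))) ≤
      ∫⁻ s in Set.Ioi (0 : ℝ), ENNReal.ofReal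
        (s ^ (-(n : ℝ) / 2 - a / 2 - 1) * Real.exp (-(b + ρ) / (2 * s))) := by
  set c₀ := (2 * v) ^ (-a / 2 - 1) * Real.exp (-b / v) * Real.exp (-1)
  have hc₀ : 0 < c₀ := by positivity
  refine ⟨v * c₀, by positivity, fun n hn ρ => ?_⟩
  have hn0 : (4 : ℝ) ≤ n := by exact_mod_cast hn
  have hsq : (2 : ℝ) ≤ √n := Real.le_sqrt_of_sq_le (by norm_num; exact hn)
  set η : ℝ := 1 / √n
  have hη0 : 0 < η := by positivity
  have hη : η ≤ 1 / 2 := one_div_le_one_div_of_le two_pos hsq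
  have hnη : n * η ^ 2 = 1 := by
    rw [div_pow, Real.sq_sqrt (by linarith)]; field_simp
  have hpt : ∀ x, |x| ≤ η → 0 ≤ (ρ - n * v) * x →
      c₀ * (v ^ (-(n : ℝ) / 2) * Real.exp (-ρ / (2 * v))) ≤
      (v * (1 + x)) ^ (-(n : ℝ) / 2 - a / 2 - 1) *
        Real.exp (-(b + ρ) / (2 * (v * (1 + x)))) := by
    intro x hx hρ
    have hx2 : |x| ≤ 1 / 2 := hx.trans hη
    have hx3 := abs_le.1 hx2
    have hs : 0 < v * (1 + x) := mul_pos hv (by linarith)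
    have h1 := rpow_mul_exp_window hv hx2 (ρ := ρ) (n := n)
      (by rw [← hnη, ← sq_abs x]; gcongr) hρ
    have h2 : (2 * v) ^ (-a / 2 - 1) ≤ (v * (1 + x)) ^ (-a / 2 - 1) :=
      Real.rpow_le_rpow_of_nonpos hs (by nlinarith) (by linarith)
    have h3 : Real.exp (-b / v) ≤ Real.exp (-b / (2 * (v * (1 + x)))) := by
      rw [Real.exp_le_exp, neg_div, neg_div, neg_le_neg_iff]
      exact div_le_div_of_nonneg_left hb.le hv (by nlinarith)
    calc _ = ((2 * v) ^ (-a / 2 - 1) * Real.exp (-b / v)) *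
          (Real.exp (-1) * (v ^ (-(n : ℝ) / 2) * Real.exp (-ρ / (2 * v)))) := by
          simp only [c₀]; ring
      _ ≤ ((v * (1 + x)) ^ (-a / 2 - 1) * Real.exp (-b / (2 * (v * (1 + x))))) *
          ((v * (1 + x)) ^ (-(n : ℝ) / 2) * Real.exp (-ρ / (2 * (v * (1 + x))))) := by
          gcongr
      _ = _ := by
          have : -(n : ℝ) / 2 - a / 2 - 1 = (-a / 2 - 1) + -(n : ℝ) / 2 := by ring
          rw [this, Real.rpow_add hs]
          have : -(b + ρ) / (2 * (v * (1 + x))) =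
            -b / (2 * (v * (1 + x))) + -ρ / (2 * (v * (1 + x))) := by ring
          rw [this, Real.exp_add]
          ring
  obtain ⟨l, hl, hwin⟩ : ∃ l, 0 < l ∧ ∀ s ∈ Set.Icc l (l + v * η),
      c₀ * (v ^ (-(n : ℝ) / 2) * Real.exp (-ρ / (2 * v))) ≤
        s ^ (-(n : ℝ) / 2 - a / 2 - 1) * Real.exp (-(b + ρ) / (2 * s)) := by
    have hrw : ∀ s, s = v * (1 + (s / v - 1)) := fun s => by field_simp; ring
    rcases le_total (n * v) ρ with h | h
    · refine ⟨v, hv, fun s hs => ?_⟩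
      have h1 : 0 ≤ s / v - 1 := by rw [sub_nonneg, le_div_iff₀ hv]; linarith [hs.1]
      have h2 : s / v - 1 ≤ η := by
        rw [sub_le_iff_le_add, div_le_iff₀ hv]; linarith [hs.2]
      rw [hrw s]
      exact hpt _ (abs_le.2 ⟨by linarith, h2⟩) (mul_nonneg (by linarith) h1)
    · refine ⟨v - v * η, by nlinarith, fun s hs => ?_⟩
      have h1 : s / v - 1 ≤ 0 := by rw [sub_nonpos, div_le_iff₀ hv]; linarith [hs.2]
      have h2 : -η ≤ s / v - 1 := by
        rw [le_sub_iff_add_le, le_div_iff₀ hv]; linarith [hs.1]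
      rw [hrw s]
      exact hpt _ (abs_le.2 ⟨h2, by linarith⟩) (mul_nonneg_of_nonpos_of_nonpos (by linarith) h1)
  calc _ = ∫⁻ _ in Set.Icc l (l + v * η), ENNReal.ofReal
        (c₀ * (v ^ (-(n : ℝ) / 2) * Real.exp (-ρ / (2 * v)))) := by
        rw [setLIntegral_const, Real.volume_Icc, ← ENNReal.ofReal_mul (by positivity)]
        congr 1
        simp only [η]
        ring
    _ ≤ ∫⁻ s in Set.Icc l (l + v * η), ENNReal.ofReal
        (s ^ (-(n : ℝ) / 2 - a / 2 - 1) * Real.exp (-(b + ρ) / (2 * s))) :=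
        setLIntegral_mono' measurableSet_Icc fun s hs => ENNReal.ofReal_le_ofReal (hwin s hs)
    _ ≤ _ := lintegral_mono_set fun s hs => hl.trans_le hs.1

end

section

/-! ### The posterior as a density against a product of prior measures -/

lemma sqnorm_nonneg {n : ℕ} (x : Fin n → ℝ) : 0 ≤ sqnorm x :=
  show 0 ≤ ∑ i, x i * x i from Finset.sum_nonneg fun i _ => mul_self_nonneg (x i)

lemma sqnorm_eq_sum {n : ℕ} (x : Fin n → ℝ) : sqnorm x = ∑ i, x i ^ 2 := by
  simp [sqnorm, dotProduct, sq]

lemma continuous_sqnorm {n : ℕ} : Continuous (sqnorm : (Fin n → ℝ) → ℝ) := by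
  unfold sqnorm; fun_prop

/-- A vector-valued random variable has at most the second moment it has about the origin when
centred at its mean, also after applying a bounded linear map. -/
lemma ofReal_centred_moment_le {Ω : Type*} [MeasurableSpace Ω] {μ : Measure Ω} {n : ℕ}
    {r : Ω → ℝ} {X : Ω → Fin n → ℝ} (hr : Measurable r) (hr0 : ∀ᵐ p ∂μ, 0 ≤ r p)
    (hX : Measurable X)
    {K : Matrix (Fin n) (Fin n) ℝ} {c : ℝ} (hc : 0 < c)
    (hK : ∀ x, sqnorm (K *ᵥ x) ≤ c * sqnorm x) {m : Fin n → ℝ}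
    (hm : m = (∫ p, r p ∂μ)⁻¹ • ∫ p, r p • X p ∂μ) :
    ENNReal.ofReal ((∫ p, r p ∂μ)⁻¹ * ∫ p, r p * sqnorm (K *ᵥ X p - K *ᵥ m) ∂μ) *
        ∫⁻ p, ENNReal.ofReal (r p) ∂μ ≤
      ENNReal.ofReal c * ∫⁻ p, ENNReal.ofReal (r p * sqnorm (X p)) ∂μ := by
  by_cases hri : Integrable r μ
  swap
  · rw [integral_undef hri]; simp
  have hsX : Measurable fun p => sqnorm (X p) := continuous_sqnorm.measurable.comp hX
  by_cases hW : ∫⁻ p, ENNReal.ofReal (r p * sqnorm (X p)) ∂μ = ∞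
  · rw [hW, ENNReal.mul_top (by simpa using hc)]; exact le_top
  have hWi : Integrable (fun p => r p * sqnorm (X p)) μ := by
    refine ⟨(hr.mul hsX).aestronglyMeasurable, ?_⟩
    rw [hasFiniteIntegral_iff_ofReal]
    · exact lt_top_iff_ne_top.2 hW
    · filter_upwards [hr0] with p hp using mul_nonneg hp (sqnorm_nonneg _)
  have hXi : ∀ i, Integrable (fun p => r p * X p i) μ := fun i => by
    refine (hri.add hWi).mono' (hr.mul (measurable_pi_iff.1 hX i)).aestronglyMeasurable ?_
    filter_upwards [hr0] with p hp
    have h1 : X p i ^ 2 ≤ sqnorm (X p) := by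
      rw [sqnorm_eq_sum]
      exact Finset.single_le_sum (f := fun i => X p i ^ 2) (fun j _ => sq_nonneg _)
        (Finset.mem_univ i)
    have h2 : |X p i| ≤ 1 + sqnorm (X p) := by
      nlinarith [sq_abs (X p i), sq_nonneg (|X p i| - 1), abs_nonneg (X p i)]
    rw [Real.norm_eq_abs, abs_mul, abs_of_nonneg hp]
    simpa [mul_add] using mul_le_mul_of_nonneg_left h2 hp
  have hZ0 : 0 ≤ ∫ p, r p ∂μ := integral_nonneg_of_ae hr0
  rcases hZ0.eq_or_lt with hZ | hZ
  · rw [← hZ]; simp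
  rw [← ofReal_integral_eq_lintegral_ofReal hri hr0,
    ← ofReal_integral_eq_lintegral_ofReal hWi
      (by filter_upwards [hr0] with p hp using mul_nonneg hp (sqnorm_nonneg _)),
    ← ENNReal.ofReal_mul' hZ0, ← ENNReal.ofReal_mul hc.le]
  refine ENNReal.ofReal_le_ofReal ?_
  set Z := ∫ p, r p ∂μ
  have hmi : ∀ i, ∫ p, r p * X p i ∂μ = Z * m i := fun i => by
    have h1 : (∫ p, r p • X p ∂μ) i = ∫ p, r p * X p i ∂μ := by
      have := eval_integral (μ := μ) (f := fun p => r p • X p) (fun j => by simpa using hXi j) i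
      simpa using this
    rw [hm, Pi.smul_apply, h1, smul_eq_mul, ← mul_assoc, mul_inv_cancel₀ hZ.ne', one_mul]
  have hexp : ∀ p, r p * sqnorm (X p - m) =
      r p * sqnorm (X p) - ∑ i, 2 * m i * (r p * X p i) + r p * sqnorm m := fun p => by
    simp only [sqnorm_eq_sum, Pi.sub_apply, Finset.mul_sum, ← Finset.sum_sub_distrib,
      ← Finset.sum_add_distrib]
    exact Finset.sum_congr rfl fun i _ => by ring
  have hsum : Integrable (fun p => ∑ i, 2 * m i * (r p * X p i)) μ :=
    integrable_finsetSum _ fun i _ => (hXi i).const_mul _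
  have hintg : Integrable (fun p => r p * sqnorm (X p - m)) μ := by
    simp_rw [hexp]
    exact (hWi.sub hsum).add (hri.mul_const _)
  have hval : ∫ p, r p * sqnorm (X p - m) ∂μ =
      ∫ p, r p * sqnorm (X p) ∂μ - Z * sqnorm m := by
    simp_rw [hexp]
    have hsub : Integrable (fun p => r p * sqnorm (X p) - ∑ i, 2 * m i * (r p * X p i)) μ :=
      hWi.sub hsum
    rw [integral_add hsub (hri.mul_const _), integral_sub hWi hsum,
      integral_finsetSum _ fun i _ => (hXi i).const_mul _, integral_mul_const]
    simp_rw [integral_const_mul, hmi]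
    have : ∑ i, 2 * m i * (Z * m i) = 2 * (Z * sqnorm m) := by
      rw [sqnorm_eq_sum, Finset.mul_sum, Finset.mul_sum]
      exact Finset.sum_congr rfl fun i _ => by ring
    rw [this]; ring
  have hle : ∫ p, r p * sqnorm (K *ᵥ X p - K *ᵥ m) ∂μ ≤
      ∫ p, c * (r p * sqnorm (X p - m)) ∂μ := by
    refine integral_mono_of_nonneg ?_ (hintg.const_mul c) ?_
    · filter_upwards [hr0] with p hp using mul_nonneg hp (sqnorm_nonneg _)
    · filter_upwards [hr0] with p hp
      rw [← mulVec_sub]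
      have := mul_le_mul_of_nonneg_left (hK (X p - m)) hp
      linarith
  rw [integral_const_mul, hval] at hle
  have h3 : Z⁻¹ * (∫ p, r p * sqnorm (K *ᵥ X p - K *ᵥ m) ∂μ) * Z =
      ∫ p, r p * sqnorm (K *ᵥ X p - K *ᵥ m) ∂μ := by field_simp
  rw [h3]
  have := mul_nonneg hc.le (mul_nonneg hZ0 (sqnorm_nonneg m))
  linarith

/-- The prior law of a single local parameter. -/
def lawL (M : RVM.Model) : Measure ℝ :=
  (volume.restrict (Set.Ioi 0)).withDensity fun x => ENNReal.ofReal (M.pr x)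

lemma integrable_pr (M : RVM.Model) : IntegrableOn M.pr (Set.Ioi 0) := by
  by_contra h
  have := M.hpr_int
  rw [integral_undef h] at this
  exact zero_ne_one this

lemma aemeasurable_pr (M : RVM.Model) :
    AEMeasurable (fun x => ENNReal.ofReal (M.pr x)) (volume.restrict (Set.Ioi 0)) :=
  (integrable_pr M).aemeasurable.ennreal_ofReal

instance (M : RVM.Model) : IsProbabilityMeasure (lawL M) := by
  refine ⟨?_⟩
  rw [lawL, withDensity_apply _ MeasurableSet.univ, Measure.restrict_univ,
    ← ofReal_integral_eq_lintegral_ofReal (integrable_pr M) (ae_of_all _ M.hpr_nonneg),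
    M.hpr_int, ENNReal.ofReal_one]

lemma lawL_ae_pos (M : RVM.Model) : ∀ᵐ x ∂lawL M, 0 < x :=
  (withDensity_absolutelyContinuous _ _).ae_le (ae_restrict_mem measurableSet_Ioi)

/-- The prior law of the vector of local parameters. -/
def prior (M : RVM.Model) (n : ℕ) : Measure (Fin n → ℝ) := Measure.pi fun _ => lawL M

instance (M : RVM.Model) (n : ℕ) : IsProbabilityMeasure (prior M n) := by
  unfold prior; infer_instance

lemma prior_ae_pos (M : RVM.Model) (n : ℕ) : ∀ᵐ l ∂prior M n, ∀ i, 0 < l i :=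
  ae_all_iff.2 fun i =>
    (Measure.quasiMeasurePreserving_eval (fun _ : Fin n => lawL M) i).ae (lawL_ae_pos M)

/-- The joint density without the prior densities of the local parameters. -/
def rdens (M : RVM.Model) (n : ℕ) (Y β : Fin n → ℝ) (s : ℝ) (l : Fin n → ℝ) : ℝ :=
  s ^ (-(n : ℝ) - M.a / 2 - 1) * (∏ i, l i) ^ (-(1 : ℝ) / 2) *
    Real.exp ((-M.b - (M.τsq n)⁻¹ * ∑ i, (β i) ^ 2 / l i
        - sqnorm (Y - M.K n *ᵥ β)) / (2 * s))

lemma measurable_rdens (M : RVM.Model) (n : ℕ) :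
    Measurable fun p : (Fin n → ℝ) × (Fin n → ℝ) × ℝ × (Fin n → ℝ) =>
      rdens M n p.1 p.2.1 p.2.2.1 p.2.2.2 := by
  have h : Measurable fun p : (Fin n → ℝ) × (Fin n → ℝ) × ℝ × (Fin n → ℝ) =>
      sqnorm (p.1 - M.K n *ᵥ p.2.1) :=
    (continuous_sqnorm.comp (by fun_prop)).measurable
  unfold rdens
  fun_prop

lemma measurable_rdens_comp {α : Type*} [MeasurableSpace α] (M : RVM.Model) (n : ℕ)
    {f g h : α → Fin n → ℝ} {s : α → ℝ} (hf : Measurable f) (hg : Measurable g)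
    (hs : Measurable s) (hh : Measurable h) :
    Measurable fun x => rdens M n (f x) (g x) (s x) (h x) :=
  (measurable_rdens M n).comp (hf.prodMk (hg.prodMk (hs.prodMk hh)))

/-- Base measure of the posterior: Lebesgue in the coefficients and the variance, prior law in
the local parameters. -/
def baseMeas (M : RVM.Model) (n : ℕ) : Measure ((Fin n → ℝ) × ℝ × (Fin n → ℝ)) :=
  volume.prod ((volume.restrict (Set.Ioi 0)).prod (prior M n))

instance (M : RVM.Model) (n : ℕ) : SFinite (baseMeas M n) := by
  unfold baseMeas; infer_instance

lemma baseMeas_ae_pos (M : RVM.Model) (n : ℕ) :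
    ∀ᵐ p ∂baseMeas M n, 0 < p.2.1 ∧ ∀ i, 0 < p.2.2 i := by
  have h1 : ∀ᵐ p ∂baseMeas M n, 0 < p.2.1 :=
    (Measure.quasiMeasurePreserving_fst.comp Measure.quasiMeasurePreserving_snd).ae
      (ae_restrict_mem measurableSet_Ioi)
  have h2 : ∀ᵐ p ∂baseMeas M n, ∀ i, 0 < p.2.2 i :=
    (Measure.quasiMeasurePreserving_snd.comp Measure.quasiMeasurePreserving_snd).ae
      (prior_ae_pos M n)
  exact h1.and h2

lemma posSet_eq (n : ℕ) :
    Model.posSet n = Set.univ ×ˢ (Set.Ioi 0 ×ˢ Set.univ.pi fun _ => Set.Ioi 0) := by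
  ext p; simp [Model.posSet, Set.mem_pi]

lemma baseMeas_eq_withDensity (M : RVM.Model) (n : ℕ) : baseMeas M n =
    (volume.restrict (Model.posSet n)).withDensity
      fun p => ∏ i, ENNReal.ofReal (M.pr (p.2.2 i)) := by
  have hprior : prior M n = (Measure.pi fun _ : Fin n => volume.restrict (Set.Ioi (0 : ℝ))).withDensity
      fun x => ∏ i, ENNReal.ofReal (M.pr (x i)) := by
    have : SigmaFinite ((volume.restrict (Set.Ioi (0 : ℝ))).withDensity
        fun x => ENNReal.ofReal (M.pr x)) := inferInstanceAs (SigmaFinite (lawL M))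
    exact pi_withDensity (aemeasurable_pr M)
  have hm := aemeasurable_pi_prod (n := n) (fun _ => aemeasurable_pr M)
  have : SFinite ((Measure.pi fun _ : Fin n => volume.restrict (Set.Ioi (0 : ℝ))).withDensity
      fun x => ∏ i, ENNReal.ofReal (M.pr (x i))) := by rw [← hprior]; infer_instance
  rw [baseMeas, hprior, prod_withDensity_right₀ hm, prod_withDensity_right₀, posSet_eq,
    Measure.volume_eq_prod, Measure.volume_eq_prod, ← Measure.prod_restrict,
    ← Measure.prod_restrict, Measure.restrict_univ, ← Measure.restrict_pi_pi, volume_pi]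
  exact hm.comp_quasiMeasurePreserving Measure.quasiMeasurePreserving_snd

lemma setIntegral_posSet_jd (M : RVM.Model) (n : ℕ) (Y : Fin n → ℝ) {E : Type*}
    [NormedAddCommGroup E] [NormedSpace ℝ E] (f : (Fin n → ℝ) × ℝ × (Fin n → ℝ) → E) :
    ∫ p in Model.posSet n, M.jd n Y p.1 p.2.1 p.2.2 • f p =
      ∫ p, rdens M n Y p.1 p.2.1 p.2.2 • f p ∂baseMeas M n := by
  rw [baseMeas_eq_withDensity, integral_withDensity_eq_integral_toReal_smul₀]
  · refine integral_congr_ae (ae_of_all _ fun p => ?_)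
    dsimp only
    rw [smul_smul]
    congr 1
    rw [ENNReal.toReal_prod]
    simp_rw [ENNReal.toReal_ofReal (M.hpr_nonneg _)]
    unfold Model.jd rdens
    ring
  · rw [posSet_eq, Measure.volume_eq_prod, Measure.volume_eq_prod, ← Measure.prod_restrict,
      ← Measure.prod_restrict, volume_pi, Measure.restrict_pi_pi]
    exact (aemeasurable_pi_prod fun _ => aemeasurable_pr M).comp_quasiMeasurePreserving
      (Measure.quasiMeasurePreserving_snd.comp Measure.quasiMeasurePreserving_snd)
  · exact ae_of_all _ fun p => ENNReal.prod_lt_top fun i _ => ENNReal.ofReal_lt_top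

lemma lintegral_baseMeas (M : RVM.Model) (n : ℕ)
    {f : (Fin n → ℝ) × ℝ × (Fin n → ℝ) → ℝ≥0∞} (hf : Measurable f) :
    ∫⁻ p, f p ∂baseMeas M n =
      ∫⁻ l, (∫⁻ s in Set.Ioi (0 : ℝ), ∫⁻ β, f (β, s, l)) ∂prior M n := by
  rw [baseMeas, lintegral_prod_symm _ hf.aemeasurable, lintegral_prod_symm]
  exact hf.lintegral_prod_left'.aemeasurable

/-- Marginal (unnormalized) posterior density of the local parameters. -/
def marg (M : RVM.Model) (n : ℕ) (Y l : Fin n → ℝ) : ℝ≥0∞ :=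
  ∫⁻ s in Set.Ioi (0 : ℝ), ∫⁻ β, ENNReal.ofReal (rdens M n Y β s l)

/-- Second moment of the coefficients at fixed local parameters, unnormalized. -/
def margSq (M : RVM.Model) (n : ℕ) (Y l : Fin n → ℝ) : ℝ≥0∞ :=
  ∫⁻ s in Set.Ioi (0 : ℝ), ∫⁻ β, ENNReal.ofReal (rdens M n Y β s l * sqnorm β)

lemma measurable_marg (M : RVM.Model) (n : ℕ) :
    Measurable fun p : (Fin n → ℝ) × (Fin n → ℝ) => marg M n p.1 p.2 := by
  have h0 : Measurable fun p : (((Fin n → ℝ) × (Fin n → ℝ)) × ℝ) × (Fin n → ℝ) =>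
      ENNReal.ofReal (rdens M n p.1.1.1 p.2 p.1.2 p.1.1.2) :=
    (measurable_rdens_comp M n (by fun_prop) (by fun_prop) (by fun_prop)
      (by fun_prop)).ennreal_ofReal
  have h : Measurable fun p : ((Fin n → ℝ) × (Fin n → ℝ)) × ℝ =>
      ∫⁻ β, ENNReal.ofReal (rdens M n p.1.1 β p.2 p.1.2) :=
    Measurable.lintegral_prod_right' (ν := volume) h0
  have h2 : Measurable fun p : (Fin n → ℝ) × (Fin n → ℝ) =>
      ∫⁻ s in Set.Ioi (0 : ℝ), ∫⁻ β, ENNReal.ofReal (rdens M n p.1 β s p.2) :=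
    Measurable.lintegral_prod_right' (ν := volume.restrict (Set.Ioi (0 : ℝ))) h
  exact h2

lemma measurable_marg_right (M : RVM.Model) (n : ℕ) (Y : Fin n → ℝ) :
    Measurable (marg M n Y) := by
  have h := (measurable_marg M n).comp (measurable_prodMk_left (x := Y))
  simpa only [Function.comp_def] using h

lemma trPostVarK_mul_le (M : RVM.Model) (n : ℕ) (Y : Fin n → ℝ) {c : ℝ} (hc : 0 < c)
    (hK : ∀ x, sqnorm (M.K n *ᵥ x) ≤ c * sqnorm x) :
    ENNReal.ofReal (M.trPostVarK n Y) * ∫⁻ l, marg M n Y l ∂prior M n ≤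
      ENNReal.ofReal c * ∫⁻ l, margSq M n Y l ∂prior M n := by
  have hr : Measurable fun p : (Fin n → ℝ) × ℝ × (Fin n → ℝ) =>
      rdens M n Y p.1 p.2.1 p.2.2 :=
    measurable_rdens_comp M n (by fun_prop) (by fun_prop) (by fun_prop) (by fun_prop)
  have hs : Measurable fun p : (Fin n → ℝ) × ℝ × (Fin n → ℝ) => sqnorm p.1 :=
    continuous_sqnorm.measurable.comp measurable_fst
  have hr0 : ∀ᵐ p ∂baseMeas M n, 0 ≤ rdens M n Y p.1 p.2.1 p.2.2 := by
    filter_upwards [baseMeas_ae_pos M n] with p hp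
    have h1 := hp.1
    have h2 : 0 ≤ ∏ i, p.2.2 i := Finset.prod_nonneg fun i _ => (hp.2 i).le
    unfold rdens
    positivity
  have hZ : M.Z n Y = ∫ p, rdens M n Y p.1 p.2.1 p.2.2 ∂baseMeas M n := by
    simpa [Model.Z] using setIntegral_posSet_jd M n Y (fun _ => (1 : ℝ))
  have hm : M.postMean n Y = (∫ p, rdens M n Y p.1 p.2.1 p.2.2 ∂baseMeas M n)⁻¹ •
      ∫ p, rdens M n Y p.1 p.2.1 p.2.2 • p.1 ∂baseMeas M n := by
    rw [Model.postMean, hZ, setIntegral_posSet_jd M n Y fun p => p.1]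
  have key := ofReal_centred_moment_le hr hr0 measurable_fst hc hK hm
  rw [lintegral_baseMeas M n hr.ennreal_ofReal,
    lintegral_baseMeas M n (f := fun p => ENNReal.ofReal
      (rdens M n Y p.1 p.2.1 p.2.2 * sqnorm p.1)) (hr.mul hs).ennreal_ofReal] at key
  refine le_trans (le_of_eq ?_) key
  rw [Model.trPostVarK, hZ]
  have := setIntegral_posSet_jd M n Y
    fun p => sqnorm (M.K n *ᵥ p.1 - M.K n *ᵥ M.postMean n Y)
  simp only [smul_eq_mul] at this
  rw [this]
  rfl

end

section

/-! ### Bounds on the kernel matrix -/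

lemma dotProduct_mulVec_symm {n : ℕ} {K : Matrix (Fin n) (Fin n) ℝ} (hK : Kᵀ = K)
    (x y : Fin n → ℝ) : x ⬝ᵥ K *ᵥ y = K *ᵥ x ⬝ᵥ y := by
  rw [dotProduct_mulVec, ← mulVec_transpose, hK]

lemma sqnorm_sub {n : ℕ} (x y : Fin n → ℝ) :
    sqnorm (x - y) = sqnorm x - 2 * (x ⬝ᵥ y) + sqnorm y := by
  simp only [sqnorm, sub_dotProduct, dotProduct_sub]
  rw [dotProduct_comm y x]; ring

lemma sqnorm_add_le {n : ℕ} (x y : Fin n → ℝ) :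
    sqnorm (x + y) ≤ 2 * sqnorm x + 2 * sqnorm y := by
  simp only [sqnorm_eq_sum, Finset.mul_sum, ← Finset.sum_add_distrib]
  exact Finset.sum_le_sum fun i _ => by
    rw [Pi.add_apply]; nlinarith [sq_nonneg (x i - y i)]

lemma sqnorm_smul {n : ℕ} (c : ℝ) (x : Fin n → ℝ) : sqnorm (c • x) = c ^ 2 * sqnorm x := by
  simp only [sqnorm, smul_dotProduct, dotProduct_smul, smul_eq_mul]; ring

lemma sq_le_sqnorm {n : ℕ} (x : Fin n → ℝ) (i : Fin n) : x i ^ 2 ≤ sqnorm x := by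
  rw [sqnorm_eq_sum]
  exact Finset.single_le_sum (f := fun i => x i ^ 2) (fun j _ => sq_nonneg _) (Finset.mem_univ i)

lemma sqnorm_mulVec_ge {n : ℕ} {K : Matrix (Fin n) (Fin n) ℝ} {c : ℝ} (hc : 0 < c)
    (h : (K - c • (1 : Matrix (Fin n) (Fin n) ℝ)).PosSemidef) (x : Fin n → ℝ) :
    c ^ 2 * sqnorm x ≤ sqnorm (K *ᵥ x) := by
  have h1 := h.dotProduct_mulVec_nonneg x
  simp only [star_trivial, sub_mulVec, smul_mulVec, one_mulVec, dotProduct_sub, dotProduct_smul,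
    smul_eq_mul] at h1
  have h2 := sqnorm_nonneg (K *ᵥ x - c • x)
  rw [sqnorm_sub, sqnorm_smul, dotProduct_smul, smul_eq_mul, dotProduct_comm (K *ᵥ x) x] at h2
  have h3 : x ⬝ᵥ x = sqnorm x := rfl
  rw [h3] at h1
  nlinarith

lemma sqnorm_mulVec_le {n : ℕ} {K : Matrix (Fin n) (Fin n) ℝ} (hK : K.PosDef) {c : ℝ}
    (hc : 0 < c) (h : (c • (1 : Matrix (Fin n) (Fin n) ℝ) - K).PosSemidef) (x : Fin n → ℝ) :
    sqnorm (K *ᵥ x) ≤ c ^ 2 * sqnorm x := by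
  have hKt : Kᵀ = K := by simpa [conjTranspose_eq_transpose_of_trivial] using hK.isHermitian.eq
  have hbd : ∀ y, y ⬝ᵥ K *ᵥ y ≤ c * sqnorm y := fun y => by
    have h1 := h.dotProduct_mulVec_nonneg y
    simp only [star_trivial, sub_mulVec, smul_mulVec, one_mulVec, dotProduct_sub,
      dotProduct_smul, smul_eq_mul] at h1
    have h3 : y ⬝ᵥ y = sqnorm y := rfl
    rw [h3] at h1
    linarith
  have h1 := hK.posSemidef.dotProduct_mulVec_nonneg (x + (-c⁻¹) • K *ᵥ x)
  have h2 : (x + (-c⁻¹) • K *ᵥ x) ⬝ᵥ K *ᵥ (x + (-c⁻¹) • K *ᵥ x) =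
      x ⬝ᵥ K *ᵥ x - 2 * c⁻¹ * sqnorm (K *ᵥ x) +
        c⁻¹ ^ 2 * (K *ᵥ x ⬝ᵥ K *ᵥ (K *ᵥ x)) := by
    have := quad_add hKt x ((-c⁻¹) • K *ᵥ x)
    simp only [quad] at this
    rw [this, mulVec_smul, smul_dotProduct, smul_dotProduct, dotProduct_smul,
      dotProduct_comm (K *ᵥ K *ᵥ x) x, dotProduct_mulVec_symm hKt x (K *ᵥ x),
      dotProduct_comm (K *ᵥ K *ᵥ x)]
    simp only [smul_eq_mul, sqnorm]
    ring
  rw [star_trivial, h2] at h1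
  have h3 := hbd x
  have h4 := mul_le_mul_of_nonneg_left (hbd (K *ᵥ x)) (sq_nonneg c⁻¹)
  have h5 : c⁻¹ ^ 2 * (c * sqnorm (K *ᵥ x)) = c⁻¹ * sqnorm (K *ᵥ x) := by field_simp
  have h6 : c⁻¹ * sqnorm (K *ᵥ x) ≤ c * sqnorm x := by linarith
  rw [inv_mul_le_iff₀ hc] at h6
  linarith

/-! ### Ridge regression at fixed local parameters -/

/-- The conditional posterior precision matrix `K² + diag(1/d)`, up to the variance factor. -/
def ridge {n : ℕ} (K : Matrix (Fin n) (Fin n) ℝ) (d : Fin n → ℝ) : Matrix (Fin n) (Fin n) ℝ :=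
  K * K + diagonal fun i => (d i)⁻¹

variable {n : ℕ} {K : Matrix (Fin n) (Fin n) ℝ} {d : Fin n → ℝ}

lemma ridge_transpose (hK : Kᵀ = K) : (ridge K d)ᵀ = ridge K d := by
  simp [ridge, hK]

lemma ridge_mulVec (x : Fin n → ℝ) (i : Fin n) :
    (ridge K d *ᵥ x) i = (K *ᵥ (K *ᵥ x)) i + x i / d i := by
  rw [ridge, add_mulVec, Pi.add_apply, ← mulVec_mulVec, mulVec_diagonal, div_eq_inv_mul]

lemma quad_ridge (hK : Kᵀ = K) (x : Fin n → ℝ) :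
    quad (ridge K d) x = sqnorm (K *ᵥ x) + ∑ i, x i ^ 2 / d i := by
  have h : ridge K d *ᵥ x = K *ᵥ (K *ᵥ x) + fun i => x i / d i :=
    funext fun i => ridge_mulVec x i
  rw [quad, h, dotProduct_add, dotProduct_mulVec_symm hK, sqnorm]
  congr 1
  exact Finset.sum_congr rfl fun i _ => by ring

variable {c₁ c₂ : ℝ}

lemma le_quad_ridge (hK : Kᵀ = K) (hlo : ∀ x, c₁ ^ 2 * sqnorm x ≤ sqnorm (K *ᵥ x))
    (x : Fin n → ℝ) : ∑ i, (c₁ ^ 2 + (d i)⁻¹) * x i ^ 2 ≤ quad (ridge K d) x := by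
  have h := hlo x
  rw [sqnorm_eq_sum, Finset.mul_sum] at h
  rw [quad_ridge hK]
  refine le_trans (le_of_eq ?_) (add_le_add_left h _)
  rw [← Finset.sum_add_distrib]
  exact Finset.sum_congr rfl fun i _ => by ring

lemma quad_ridge_le (hK : Kᵀ = K) (hup : ∀ x, sqnorm (K *ᵥ x) ≤ c₂ ^ 2 * sqnorm x)
    (x : Fin n → ℝ) : quad (ridge K d) x ≤ ∑ i, (c₂ ^ 2 + (d i)⁻¹) * x i ^ 2 := by
  have h := hup x
  rw [sqnorm_eq_sum x, Finset.mul_sum] at h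
  rw [quad_ridge hK]
  refine le_trans (add_le_add_left h _) (le_of_eq ?_)
  rw [← Finset.sum_add_distrib]
  exact Finset.sum_congr rfl fun i _ => by ring

lemma ridge_surjective (hK : Kᵀ = K) (hc₁ : 0 < c₁) (hd : ∀ i, 0 < d i)
    (hlo : ∀ x, c₁ ^ 2 * sqnorm x ≤ sqnorm (K *ᵥ x)) (z : Fin n → ℝ) :
    ∃ x, ridge K d *ᵥ x = z := by
  have hinj : Function.Injective (ridge K d).mulVecLin := by
    rw [← LinearMap.ker_eq_bot, LinearMap.ker_eq_bot']
    intro x hx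
    have h1 := le_quad_ridge (d := d) hK hlo x
    have h2 : quad (ridge K d) x = 0 := by
      rw [quad]; rw [mulVecLin_apply] at hx; rw [hx, dotProduct_zero]
    rw [h2] at h1
    have hp : ∀ i, 0 < c₁ ^ 2 + (d i)⁻¹ := fun i => by have := hd i; positivity
    have hnn : ∀ i ∈ Finset.univ, 0 ≤ (c₁ ^ 2 + (d i)⁻¹) * x i ^ 2 := fun i _ =>
      mul_nonneg (hp i).le (sq_nonneg _)
    have h3 := (Finset.sum_eq_zero_iff_of_nonneg hnn).1 (le_antisymm h1 (Finset.sum_nonneg hnn))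
    funext i
    have := (mul_eq_zero.1 (h3 i (Finset.mem_univ i))).resolve_left (hp i).ne'
    simpa using this
  obtain ⟨x, hx⟩ := (LinearMap.injective_iff_surjective.1 hinj) z
  exact ⟨x, hx⟩

/-- Minimum of the penalized least-squares criterion. -/
def ridgeMin (K : Matrix (Fin n) (Fin n) ℝ) (d Y β : Fin n → ℝ) : ℝ :=
  sqnorm (Y - K *ᵥ β) + ∑ i, β i ^ 2 / d i

lemma ridgeMin_eq_add (hK : Kᵀ = K) {Y b : Fin n → ℝ} (hb : ridge K d *ᵥ b = K *ᵥ Y)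
    (β : Fin n → ℝ) : ridgeMin K d Y β = ridgeMin K d Y b + quad (ridge K d) (β - b) := by
  have hexp : ∀ x, ridgeMin K d Y x = sqnorm Y - 2 * (K *ᵥ Y ⬝ᵥ x) + quad (ridge K d) x := by
    intro x
    rw [ridgeMin, sqnorm_sub, quad_ridge hK, dotProduct_mulVec_symm hK]; ring
  have h1 := quad_add (ridge_transpose (d := d) hK) (β - b) b
  rw [sub_add_cancel, hb, dotProduct_sub] at h1
  have h2 : quad (ridge K d) b = K *ᵥ Y ⬝ᵥ b := by rw [quad, hb, dotProduct_comm]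
  rw [hexp, hexp, h1, h2]
  ring

lemma ridgeMin_nonneg (hd : ∀ i, 0 < d i) (Y b : Fin n → ℝ) : 0 ≤ ridgeMin K d Y b :=
  add_nonneg (sqnorm_nonneg _) (Finset.sum_nonneg fun i _ => div_nonneg (sq_nonneg _) (hd i).le)

lemma ridgeMin_le (hK : Kᵀ = K) (hd : ∀ i, 0 < d i) {Y b : Fin n → ℝ}
    (hb : ridge K d *ᵥ b = K *ᵥ Y) : ridgeMin K d Y b ≤ sqnorm Y := by
  have h := ridgeMin_eq_add hK hb 0
  have h1 : 0 ≤ quad (ridge K d) (0 - b) := by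
    rw [quad_ridge hK]
    exact add_nonneg (sqnorm_nonneg _)
      (Finset.sum_nonneg fun i _ => div_nonneg (sq_nonneg _) (hd i).le)
  have h2 : ridgeMin K d Y 0 = sqnorm Y := by simp [ridgeMin]
  linarith

/-- Diagonal entries of the inverse of the ridge matrix. -/
lemma ridge_solve_single_le (hK : Kᵀ = K) (hc₁ : 0 < c₁) (hd : ∀ i, 0 < d i)
    (hlo : ∀ x, c₁ ^ 2 * sqnorm x ≤ sqnorm (K *ᵥ x)) {i : Fin n} {y : Fin n → ℝ}
    (hy : ridge K d *ᵥ y = Pi.single i 1) : y i ≤ (c₁ ^ 2 + (d i)⁻¹)⁻¹ := by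
  have hp : ∀ i, 0 < c₁ ^ 2 + (d i)⁻¹ := fun i => by have := hd i; positivity
  have h1 : (c₁ ^ 2 + (d i)⁻¹) * y i ^ 2 ≤ quad (ridge K d) y :=
    (Finset.single_le_sum (f := fun i => (c₁ ^ 2 + (d i)⁻¹) * y i ^ 2)
      (fun j _ => mul_nonneg (hp j).le (sq_nonneg _)) (Finset.mem_univ i)).trans
      (le_quad_ridge hK hlo y)
  rw [quad, hy, dotProduct_single, mul_one] at h1
  rw [← one_div, le_div_iff₀ (hp i)]
  by_contra! h
  have h2 : 0 < y i := by
    by_contra! h3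
    nlinarith [hp i]
  nlinarith

lemma sqnorm_ridge_solution_le (hK : Kᵀ = K) (hd : ∀ i, 0 < d i)
    (hc₁ : 0 < c₁) (hlo : ∀ x, c₁ ^ 2 * sqnorm x ≤ sqnorm (K *ᵥ x)) {Y b : Fin n → ℝ}
    (hb : ridge K d *ᵥ b = K *ᵥ Y) :
    c₁ ^ 2 * sqnorm b ≤ ∑ i, (c₁ ^ 2 + (d i)⁻¹)⁻¹ * (K *ᵥ Y) i ^ 2 := by
  have hp : ∀ i, 0 < c₁ ^ 2 + (d i)⁻¹ := fun i => by have := hd i; positivity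
  have h1 := le_quad_ridge (d := d) hK hlo b
  have h2 : quad (ridge K d) b = ∑ i, b i * (K *ᵥ Y) i := by rw [quad, hb]; rfl
  have h3 : ∑ i, b i * (K *ᵥ Y) i ≤ (∑ i, (c₁ ^ 2 + (d i)⁻¹)⁻¹ * (K *ᵥ Y) i ^ 2) / 2 +
      (∑ i, (c₁ ^ 2 + (d i)⁻¹) * b i ^ 2) / 2 := by
    rw [Finset.sum_div, Finset.sum_div, ← Finset.sum_add_distrib]
    refine Finset.sum_le_sum fun i _ => ?_
    have h4 : (c₁ ^ 2 + (d i)⁻¹)⁻¹ * (K *ᵥ Y) i ^ 2 / 2 + (c₁ ^ 2 + (d i)⁻¹) * b i ^ 2 / 2 -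
        b i * (K *ᵥ Y) i = (c₁ ^ 2 + (d i)⁻¹)⁻¹ *
          ((K *ᵥ Y) i - (c₁ ^ 2 + (d i)⁻¹) * b i) ^ 2 / 2 := by
      have := (hp i).ne'
      generalize c₁ ^ 2 + (d i)⁻¹ = p at *
      field_simp
      ring
    have h5 : 0 ≤ (c₁ ^ 2 + (d i)⁻¹)⁻¹ *
          ((K *ᵥ Y) i - (c₁ ^ 2 + (d i)⁻¹) * b i) ^ 2 / 2 := by
      have := hp i; positivity
    linarith
  have h6 : c₁ ^ 2 * sqnorm b ≤ ∑ i, (c₁ ^ 2 + (d i)⁻¹) * b i ^ 2 := by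
    rw [sqnorm_eq_sum, Finset.mul_sum]
    refine Finset.sum_le_sum fun i _ => mul_le_mul_of_nonneg_right ?_ (sq_nonneg _)
    have := hd i
    have : 0 < (d i)⁻¹ := by positivity
    linarith
  linarith

lemma inv_precision_le (hc₁ : 0 < c₁) {x : ℝ} (hx : 0 < x) :
    (c₁ ^ 2 + x⁻¹)⁻¹ ≤ (1 + (c₁ ^ 2)⁻¹) * min 1 x := by
  have h1 : (c₁ ^ 2 + x⁻¹)⁻¹ ≤ (c₁ ^ 2)⁻¹ :=
    inv_anti₀ (by positivity) (by have : 0 < x⁻¹ := by positivity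
                                  linarith)
  have h2 : (c₁ ^ 2 + x⁻¹)⁻¹ ≤ x := by
    rw [inv_le_comm₀ (by positivity) hx]; nlinarith [sq_nonneg c₁]
  have h3 : 0 < (c₁ ^ 2)⁻¹ := by positivity
  rcases le_total 1 x with h | h
  · rw [min_eq_left h]; linarith
  · rw [min_eq_right h]; nlinarith

lemma sq_ridge_solution_le (hK : Kᵀ = K) (hd : ∀ i, 0 < d i) (hc₁ : 0 < c₁)
    (hlo : ∀ x, c₁ ^ 2 * sqnorm x ≤ sqnorm (K *ᵥ x))
    (hup : ∀ x, sqnorm (K *ᵥ x) ≤ c₂ ^ 2 * sqnorm x) {Y b : Fin n → ℝ}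
    (hb : ridge K d *ᵥ b = K *ᵥ Y) :
    sqnorm b ≤ c₂ ^ 2 * (1 + (c₁ ^ 2)⁻¹ ^ 2) * (sqnorm Y * ∑ i, min 1 (d i) ^ 2) := by
  rw [sqnorm_eq_sum, Finset.mul_sum, Finset.mul_sum]
  refine Finset.sum_le_sum fun i _ => ?_
  have hY := sqnorm_nonneg Y
  have h1 : b i ^ 2 ≤ c₂ ^ 2 * (c₁ ^ 2)⁻¹ ^ 2 * sqnorm Y := by
    have h2 := sqnorm_ridge_solution_le hK hd hc₁ hlo hb
    have h3 : ∑ i, (c₁ ^ 2 + (d i)⁻¹)⁻¹ * (K *ᵥ Y) i ^ 2 ≤ (c₁ ^ 2)⁻¹ * sqnorm (K *ᵥ Y) := by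
      rw [sqnorm_eq_sum, Finset.mul_sum]
      refine Finset.sum_le_sum fun i _ => mul_le_mul_of_nonneg_right ?_ (sq_nonneg _)
      have := hd i
      exact inv_anti₀ (by positivity) (by have : 0 < (d i)⁻¹ := by positivity
                                          linarith)
    have h4 : (c₁ ^ 2)⁻¹ * sqnorm (K *ᵥ Y) ≤ (c₁ ^ 2)⁻¹ * (c₂ ^ 2 * sqnorm Y) :=
      mul_le_mul_of_nonneg_left (hup Y) (by positivity)
    have h5 : sqnorm b ≤ (c₁ ^ 2)⁻¹ * ((c₁ ^ 2)⁻¹ * (c₂ ^ 2 * sqnorm Y)) := by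
      rw [le_inv_mul_iff₀ (by positivity)]; linarith
    calc _ ≤ sqnorm b := sq_le_sqnorm b i
      _ ≤ _ := h5
      _ = _ := by ring
  have h2 : b i ^ 2 ≤ c₂ ^ 2 * sqnorm Y * d i ^ 2 := by
    have h3 : b i = d i * (K *ᵥ (Y - K *ᵥ b)) i := by
      have := congrFun hb i
      rw [ridge_mulVec] at this
      rw [mulVec_sub, Pi.sub_apply, ← this]
      have := (hd i).ne'
      field_simp
      ring
    have h4 : (K *ᵥ (Y - K *ᵥ b)) i ^ 2 ≤ c₂ ^ 2 * sqnorm Y := by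
      refine (sq_le_sqnorm _ i).trans ((hup _).trans
        (mul_le_mul_of_nonneg_left ?_ (sq_nonneg _)))
      refine le_trans ?_ (ridgeMin_le hK hd hb)
      exact le_add_of_nonneg_right
        (Finset.sum_nonneg fun i _ => div_nonneg (sq_nonneg _) (hd i).le)
    rw [h3, mul_pow]
    nlinarith [sq_nonneg (d i)]
  have hcY : 0 ≤ c₂ ^ 2 * sqnorm Y := by positivity
  rcases le_total 1 (d i) with h | h
  · rw [min_eq_left h]
    nlinarith
  · rw [min_eq_right h]
    have : 0 ≤ c₂ ^ 2 * sqnorm Y * ((c₁ ^ 2)⁻¹ ^ 2 * d i ^ 2) := by positivity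
    nlinarith

end

section

/-! ### Conditional second moment of the coefficients -/

variable {M : RVM.Model} {n : ℕ} {c₁ c₂ : ℝ}

/-- The part of the density that does not involve the coefficients, once the square has been
completed. -/
def scaleDens (M : RVM.Model) (n : ℕ) (R s : ℝ) (l : Fin n → ℝ) : ℝ :=
  s ^ (-(n : ℝ) - M.a / 2 - 1) * (∏ i, l i) ^ (-(1 : ℝ) / 2) * Real.exp (-(M.b + R) / (2 * s))

lemma scaleDens_nonneg (R : ℝ) {s : ℝ} (hs : 0 < s) {l : Fin n → ℝ} (hl : ∀ i, 0 < l i) :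
    0 ≤ scaleDens M n R s l := by
  have h2 : 0 ≤ ∏ i, l i := Finset.prod_nonneg fun i _ => (hl i).le
  unfold scaleDens
  positivity

lemma rdens_eq (hK : (M.K n)ᵀ = M.K n) {Y b l : Fin n → ℝ}
    (hb : ridge (M.K n) (fun i => M.τsq n * l i) *ᵥ b = M.K n *ᵥ Y) (β : Fin n → ℝ) (s : ℝ) :
    rdens M n Y β s l =
      scaleDens M n (ridgeMin (M.K n) (fun i => M.τsq n * l i) Y b) s l *
        Real.exp (-quad (ridge (M.K n) fun i => M.τsq n * l i) (β - b) / (2 * s)) := by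
  have h := ridgeMin_eq_add hK hb β
  rw [rdens, scaleDens, mul_assoc _ (Real.exp _), ← Real.exp_add]
  congr 2
  rw [← add_div]
  congr 1
  have h2 : ridgeMin (M.K n) (fun i => M.τsq n * l i) Y β =
      sqnorm (Y - M.K n *ᵥ β) + (M.τsq n)⁻¹ * ∑ i, β i ^ 2 / l i := by
    rw [ridgeMin, Finset.mul_sum]
    congr 1
    exact Finset.sum_congr rfl fun i _ => by rw [← div_div, div_eq_inv_mul _ (M.τsq n),
      mul_div_assoc]
  linarith

lemma lintegral_rdens (hK : (M.K n)ᵀ = M.K n) {Y b l : Fin n → ℝ} (hl : ∀ i, 0 < l i)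
    (hb : ridge (M.K n) (fun i => M.τsq n * l i) *ᵥ b = M.K n *ᵥ Y) {s : ℝ} (hs : 0 < s) :
    ∫⁻ β, ENNReal.ofReal (rdens M n Y β s l) =
      ENNReal.ofReal (scaleDens M n (ridgeMin (M.K n) (fun i => M.τsq n * l i) Y b) s l) *
        ∫⁻ x, ENNReal.ofReal
          (Real.exp (-quad (ridge (M.K n) fun i => M.τsq n * l i) x / (2 * s))) := by
  simp_rw [rdens_eq hK hb, ENNReal.ofReal_mul (scaleDens_nonneg _ hs hl)]
  rw [lintegral_const_mul' _ _ ENNReal.ofReal_ne_top,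
    lintegral_sub_right_eq_self (fun x => ENNReal.ofReal
      (Real.exp (-quad (ridge (M.K n) fun i => M.τsq n * l i) x / (2 * s)))) b]

lemma lintegral_sqnorm_gaussian_le {K : Matrix (Fin n) (Fin n) ℝ} {d : Fin n → ℝ}
    (hK : Kᵀ = K) (hc₁ : 0 < c₁) (hd : ∀ i, 0 < d i)
    (hlo : ∀ x, c₁ ^ 2 * sqnorm x ≤ sqnorm (K *ᵥ x)) {s : ℝ} (hs : 0 < s) :
    ∫⁻ x, ENNReal.ofReal (sqnorm x * Real.exp (-quad (ridge K d) x / (2 * s))) ≤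
      ENNReal.ofReal (4 * s * ∑ i, (c₁ ^ 2 + (d i)⁻¹)⁻¹) *
        ∫⁻ x, ENNReal.ofReal (Real.exp (-quad (ridge K d) x / (2 * s))) := by
  have hq := continuous_quad (ridge K d)
  have hp : ∀ i, 0 < (c₁ ^ 2 + (d i)⁻¹)⁻¹ := fun i => by have := hd i; positivity
  have h1 : ∀ x : Fin n → ℝ, ENNReal.ofReal
      (sqnorm x * Real.exp (-quad (ridge K d) x / (2 * s))) =
      ∑ i, ENNReal.ofReal (x i ^ 2 * Real.exp (-quad (ridge K d) x / (2 * s))) := fun x => by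
    rw [sqnorm_eq_sum, Finset.sum_mul, ENNReal.ofReal_sum_of_nonneg fun i _ => by positivity]
  simp_rw [h1]
  rw [lintegral_finsetSum _ fun i _ => by fun_prop, Finset.mul_sum,
    ENNReal.ofReal_sum_of_nonneg fun i _ => by have := hp i; positivity, Finset.sum_mul]
  refine Finset.sum_le_sum fun i _ => ?_
  obtain ⟨y, hy⟩ := ridge_surjective hK hc₁ hd hlo (Pi.single i 1)
  have h2 := lintegral_gaussian_sq (ridge_transpose (d := d) hK) hs y (hp i) (by
    rw [hy, single_dotProduct, one_mul]
    exact ridge_solve_single_le hK hc₁ hd hlo hy)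
  simp_rw [hy, single_dotProduct, one_mul] at h2
  rwa [← mul_assoc] at h2

lemma lintegral_rdens_mul_sqnorm_le (hK : (M.K n)ᵀ = M.K n) (hc₁ : 0 < c₁)
    (hlo : ∀ x, c₁ ^ 2 * sqnorm x ≤ sqnorm (M.K n *ᵥ x)) (hτ : 0 < M.τsq n)
    {Y b l : Fin n → ℝ} (hl : ∀ i, 0 < l i)
    (hb : ridge (M.K n) (fun i => M.τsq n * l i) *ᵥ b = M.K n *ᵥ Y) {s : ℝ} (hs : 0 < s) :
    ∫⁻ β, ENNReal.ofReal (rdens M n Y β s l * sqnorm β) ≤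
      ENNReal.ofReal (8 * s * ∑ i, (c₁ ^ 2 + (M.τsq n * l i)⁻¹)⁻¹ + 2 * sqnorm b) *
        ∫⁻ β, ENNReal.ofReal (rdens M n Y β s l) := by
  have hd : ∀ i, 0 < M.τsq n * l i := fun i => mul_pos hτ (hl i)
  rw [lintegral_rdens hK hl hb hs]
  set A := ridge (M.K n) fun i => M.τsq n * l i with hA
  set G := scaleDens M n (ridgeMin (M.K n) (fun i => M.τsq n * l i) Y b) s l
  have hG : 0 ≤ G := scaleDens_nonneg _ hs hl
  have hq := continuous_quad A
  set J := ∫⁻ x, ENNReal.ofReal (Real.exp (-quad A x / (2 * s)))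
  have hP : 0 ≤ ∑ i, (c₁ ^ 2 + (M.τsq n * l i)⁻¹)⁻¹ :=
    Finset.sum_nonneg fun i _ => by have := hd i; positivity
  have hsb := sqnorm_nonneg b
  calc _ ≤ ∫⁻ β, ENNReal.ofReal G * (ENNReal.ofReal 2 *
        ENNReal.ofReal (sqnorm (β - b) * Real.exp (-quad A (β - b) / (2 * s))) +
        ENNReal.ofReal (2 * sqnorm b) * ENNReal.ofReal (Real.exp (-quad A (β - b) / (2 * s)))) := by
        refine lintegral_mono fun β => ?_
        have hsx := sqnorm_nonneg (β - b)
        rw [← ENNReal.ofReal_mul (by positivity), ← ENNReal.ofReal_mul (by positivity),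
          ← ENNReal.ofReal_add (by positivity) (by positivity), ← ENNReal.ofReal_mul hG,
          rdens_eq hK hb]
        refine ENNReal.ofReal_le_ofReal ?_
        have h1 := sqnorm_add_le (β - b) b
        rw [sub_add_cancel] at h1
        have h2 : 0 ≤ G * Real.exp (-quad A (β - b) / (2 * s)) := by positivity
        have := mul_le_mul_of_nonneg_left h1 h2
        calc _ ≤ _ := this
          _ = _ := by ring
    _ = ENNReal.ofReal G * (ENNReal.ofReal 2 *
        (∫⁻ x, ENNReal.ofReal (sqnorm x * Real.exp (-quad A x / (2 * s)))) +
        ENNReal.ofReal (2 * sqnorm b) * J) := by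
        rw [lintegral_sub_right_eq_self (fun x => ENNReal.ofReal G * (ENNReal.ofReal 2 *
          ENNReal.ofReal (sqnorm x * Real.exp (-quad A x / (2 * s))) +
          ENNReal.ofReal (2 * sqnorm b) * ENNReal.ofReal (Real.exp (-quad A x / (2 * s))))) b,
          lintegral_const_mul' _ _ ENNReal.ofReal_ne_top,
          lintegral_add_right _ (by fun_prop), lintegral_const_mul' _ _ ENNReal.ofReal_ne_top,
          lintegral_const_mul' _ _ ENNReal.ofReal_ne_top]
    _ ≤ ENNReal.ofReal G * (ENNReal.ofReal 2 *
        (ENNReal.ofReal (4 * s * ∑ i, (c₁ ^ 2 + (M.τsq n * l i)⁻¹)⁻¹) * J) +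
        ENNReal.ofReal (2 * sqnorm b) * J) := by
        gcongr
        exact lintegral_sqnorm_gaussian_le hK hc₁ hd hlo hs
    _ = _ := by
        rw [← mul_assoc (ENNReal.ofReal 2), ← ENNReal.ofReal_mul zero_le_two, ← add_mul,
          ← ENNReal.ofReal_add (by positivity) (by positivity), mul_left_comm]
        congr 3
        ring

lemma scaleDens_mul_sqrt_pow (R : ℝ) {s : ℝ} (hs : 0 < s) (l : Fin n → ℝ) :
    scaleDens M n R s l * √s ^ n = (∏ i, l i) ^ (-(1 : ℝ) / 2) *
      (s ^ (-(((n : ℝ) + M.a) / 2) - 1) * Real.exp (-((M.b + R) / 2) / s)) := by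
  have h1 : √s ^ n = s ^ ((n : ℝ) / 2) := by
    rw [Real.sqrt_eq_rpow, ← Real.rpow_natCast, ← Real.rpow_mul hs.le]; congr 1; ring
  have h2 : s ^ (-(n : ℝ) - M.a / 2 - 1) * s ^ ((n : ℝ) / 2) =
      s ^ (-(((n : ℝ) + M.a) / 2) - 1) := by
    rw [← Real.rpow_add hs]; congr 1; ring
  have h3 : -(M.b + R) / (2 * s) = -((M.b + R) / 2) / s := by field_simp
  rw [scaleDens, h1, ← h2, h3]
  ring

lemma margSq_le (hK : (M.K n)ᵀ = M.K n) (hc₁ : 0 < c₁)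
    (hlo : ∀ x, c₁ ^ 2 * sqnorm x ≤ sqnorm (M.K n *ᵥ x)) (hτ : 0 < M.τsq n) (hn : 2 ≤ n)
    {Y b l : Fin n → ℝ} (hl : ∀ i, 0 < l i)
    (hb : ridge (M.K n) (fun i => M.τsq n * l i) *ᵥ b = M.K n *ᵥ Y) :
    margSq M n Y l ≤ ENNReal.ofReal (8 * ((M.b + sqnorm Y) / (n + M.a - 2)) *
      ∑ i, (c₁ ^ 2 + (M.τsq n * l i)⁻¹)⁻¹ + 2 * sqnorm b) * marg M n Y l := by
  have hd : ∀ i, 0 < M.τsq n * l i := fun i => mul_pos hτ (hl i)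
  have hMa := M.ha
  have hMb := M.hb
  have hn2 : (2 : ℝ) ≤ n := by exact_mod_cast hn
  set R := ridgeMin (M.K n) (fun i => M.τsq n * l i) Y b with hR
  have hR0 : 0 ≤ R := ridgeMin_nonneg hd Y b
  have hRY : R ≤ sqnorm Y := ridgeMin_le hK hd hb
  set P := ∑ i, (c₁ ^ 2 + (M.τsq n * l i)⁻¹)⁻¹
  have hP : 0 ≤ P := Finset.sum_nonneg fun i _ => by have := hd i; positivity
  have hsb := sqnorm_nonneg b
  set J := ∫⁻ x, ENNReal.ofReal (Real.exp (-quad (ridge (M.K n) fun i => M.τsq n * l i) x / 2))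
  set k := ((n : ℝ) + M.a) / 2 with hk
  set φ : ℝ → ℝ := fun s => s ^ (-k - 1) * Real.exp (-((M.b + R) / 2) / s)
  have hinner : ∀ s ∈ Set.Ioi (0 : ℝ), ∫⁻ β, ENNReal.ofReal (rdens M n Y β s l) =
      ENNReal.ofReal ((∏ i, l i) ^ (-(1 : ℝ) / 2)) * J * ENNReal.ofReal (φ s) := by
    intro s hs
    have hs : 0 < s := hs
    have h2 : 0 ≤ ∏ i, l i := Finset.prod_nonneg fun i _ => (hl i).le
    rw [lintegral_rdens hK hl hb hs, lintegral_gaussian_scale _ hs, ← mul_assoc,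
      ← ENNReal.ofReal_mul (scaleDens_nonneg _ hs hl), scaleDens_mul_sqrt_pow _ hs,
      ENNReal.ofReal_mul (by positivity), mul_right_comm]
  set W := ENNReal.ofReal ((∏ i, l i) ^ (-(1 : ℝ) / 2)) * J
  have hφ : Measurable φ := by fun_prop
  have hφ0 : ∀ s ∈ Set.Ioi (0 : ℝ), 0 ≤ φ s := fun s hs => by
    have : 0 < s := hs
    positivity
  have hmarg : marg M n Y l = W * ∫⁻ s in Set.Ioi (0 : ℝ), ENNReal.ofReal (φ s) := by
    rw [marg, setLIntegral_congr_fun measurableSet_Ioi hinner,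
      lintegral_const_mul _ hφ.ennreal_ofReal]
  calc margSq M n Y l ≤ ∫⁻ s in Set.Ioi (0 : ℝ),
        W * (ENNReal.ofReal (8 * P) * ENNReal.ofReal (s * φ s) +
          ENNReal.ofReal (2 * sqnorm b) * ENNReal.ofReal (φ s)) := by
        refine setLIntegral_mono' measurableSet_Ioi fun s hs => ?_
        have hs' : 0 < s := hs
        have hφs := hφ0 s hs
        refine (lintegral_rdens_mul_sqnorm_le hK hc₁ hlo hτ hl hb hs').trans (le_of_eq ?_)
        rw [hinner s hs, ← ENNReal.ofReal_mul (by positivity),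
          ← ENNReal.ofReal_mul (by positivity), ← ENNReal.ofReal_add (by positivity)
          (by positivity), mul_left_comm, ← ENNReal.ofReal_mul (by positivity)]
        congr 2
        ring
    _ = ENNReal.ofReal (8 * ((M.b + R) / 2 / (k - 1)) * P + 2 * sqnorm b) * marg M n Y l := by
        have hk1 : 1 < k := by rw [hk]; linarith
        have hk2 : 0 < k - 1 := by linarith
        rw [lintegral_const_mul _ (by fun_prop), lintegral_add_right _ (by fun_prop),
          lintegral_const_mul _ (by fun_prop), lintegral_const_mul _ (by fun_prop),
          lintegral_inverseGamma_mean hk1 (by positivity), hmarg, ← mul_assoc (ENNReal.ofReal _),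
          ← ENNReal.ofReal_mul (by positivity), ← add_mul,
          ← ENNReal.ofReal_add (by positivity) (by positivity), mul_left_comm]
        congr 3
        ring
    _ ≤ _ := by
        refine mul_le_mul_left (ENNReal.ofReal_le_ofReal ?_) _
        have h1 : (M.b + R) / 2 / (k - 1) = (M.b + R) / (n + M.a - 2) := by
          rw [hk]
          have : (n : ℝ) + M.a - 2 ≠ 0 := by linarith
          have : ((n : ℝ) + M.a) / 2 - 1 ≠ 0 := by intro h; apply this; linarith
          field_simp
        rw [h1]
        have h2 : (M.b + R) / (n + M.a - 2) ≤ (M.b + sqnorm Y) / (n + M.a - 2) :=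
          div_le_div_of_nonneg_right (by linarith) (by linarith)
        have := mul_le_mul_of_nonneg_right h2 hP
        linarith

/-- Total shrinkage weight of the local parameters. -/
def wt (M : RVM.Model) (n : ℕ) (l : Fin n → ℝ) (i : Fin n) : ℝ := min 1 (M.τsq n * l i)

lemma exists_margSq_le (M : RVM.Model) (hc₁ : 0 < c₁) : ∃ D > 0, ∀ n ≥ 4, 0 < M.τsq n →
    (M.K n)ᵀ = M.K n → (∀ x, c₁ ^ 2 * sqnorm x ≤ sqnorm (M.K n *ᵥ x)) →
    (∀ x, sqnorm (M.K n *ᵥ x) ≤ c₂ ^ 2 * sqnorm x) → ∀ Y l : Fin n → ℝ, (∀ i, 0 < l i) →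
    margSq M n Y l ≤ ENNReal.ofReal (D * ((1 + sqnorm Y / n) * ∑ i, wt M n l i +
      ∑ i, wt M n l i * (M.K n *ᵥ Y) i ^ 2)) * marg M n Y l ∧
    margSq M n Y l ≤ ENNReal.ofReal (D * ((1 + sqnorm Y / n) * ∑ i, wt M n l i +
      sqnorm Y * ∑ i, wt M n l i ^ 2)) * marg M n Y l := by
  have hMa := M.ha
  have hMb := M.hb
  set e := 1 + (c₁ ^ 2)⁻¹ with he
  have he1 : 1 ≤ e := by have : 0 < (c₁ ^ 2)⁻¹ := by positivity
                         linarith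
  set D := 16 * (M.b + 1) * e + 2 * (c₁ ^ 2)⁻¹ * e + 2 * (c₂ ^ 2 * (1 + (c₁ ^ 2)⁻¹ ^ 2)) with hD
  have hD1 : 0 < 16 * (M.b + 1) * e := by positivity
  have hD2 : 0 ≤ 2 * (c₁ ^ 2)⁻¹ * e := by positivity
  have hD3 : 0 ≤ 2 * (c₂ ^ 2 * (1 + (c₁ ^ 2)⁻¹ ^ 2)) := by positivity
  refine ⟨D, by linarith, fun n hn hτ hK hlo hup Y l hl => ?_⟩
  have hn4 : (4 : ℝ) ≤ n := by exact_mod_cast hn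
  have hd : ∀ i, 0 < M.τsq n * l i := fun i => mul_pos hτ (hl i)
  obtain ⟨b, hb⟩ := ridge_surjective hK hc₁ hd hlo (M.K n *ᵥ Y)
  have hmain := margSq_le hK hc₁ hlo hτ (by omega) hl hb
  have hwt : ∀ i, 0 ≤ wt M n l i := fun i => le_min zero_le_one (hd i).le
  have hY := sqnorm_nonneg Y
  have hP : ∑ i, (c₁ ^ 2 + (M.τsq n * l i)⁻¹)⁻¹ ≤ e * ∑ i, wt M n l i := by
    rw [Finset.mul_sum]
    exact Finset.sum_le_sum fun i _ => inv_precision_le hc₁ (hd i)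
  have hm : 0 ≤ ∑ i, wt M n l i := Finset.sum_nonneg fun i _ => hwt i
  have hs : (M.b + sqnorm Y) / (n + M.a - 2) ≤ 2 * (M.b + 1) * (1 + sqnorm Y / n) := by
    rw [div_le_iff₀ (by linarith)]
    have h1 : (n : ℝ) / 2 ≤ n + M.a - 2 := by linarith
    have h2 : 0 ≤ 2 * (M.b + 1) * (1 + sqnorm Y / n) := by positivity
    have h3 : 2 * (M.b + 1) * (1 + sqnorm Y / n) * (n / 2) = (M.b + 1) * (n + sqnorm Y) := by
      field_simp
    nlinarith [mul_le_mul_of_nonneg_left h1 h2]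
  have hfirst : 8 * ((M.b + sqnorm Y) / (n + M.a - 2)) *
      ∑ i, (c₁ ^ 2 + (M.τsq n * l i)⁻¹)⁻¹ ≤
      16 * (M.b + 1) * e * ((1 + sqnorm Y / n) * ∑ i, wt M n l i) := by
    have h0 : 0 ≤ ∑ i, (c₁ ^ 2 + (M.τsq n * l i)⁻¹)⁻¹ :=
      Finset.sum_nonneg fun i _ => by have := hd i; positivity
    calc _ ≤ 8 * (2 * (M.b + 1) * (1 + sqnorm Y / n)) * (e * ∑ i, wt M n l i) := by gcongr
      _ = _ := by ring
  have hA0 : 0 ≤ (1 + sqnorm Y / n) * ∑ i, wt M n l i := by positivity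
  have hQ1 : 0 ≤ ∑ i, wt M n l i * (M.K n *ᵥ Y) i ^ 2 :=
    Finset.sum_nonneg fun i _ => mul_nonneg (hwt i) (sq_nonneg _)
  have hQ2 : 0 ≤ sqnorm Y * ∑ i, wt M n l i ^ 2 :=
    mul_nonneg hY (Finset.sum_nonneg fun i _ => sq_nonneg _)
  constructor
  · refine hmain.trans (mul_le_mul_left (ENNReal.ofReal_le_ofReal ?_) _)
    have h1 := sqnorm_ridge_solution_le hK hd hc₁ hlo hb
    have h2 : ∑ i, (c₁ ^ 2 + (M.τsq n * l i)⁻¹)⁻¹ * (M.K n *ᵥ Y) i ^ 2 ≤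
        e * ∑ i, wt M n l i * (M.K n *ᵥ Y) i ^ 2 := by
      rw [Finset.mul_sum]
      refine Finset.sum_le_sum fun i _ => ?_
      rw [← mul_assoc]
      exact mul_le_mul_of_nonneg_right (inv_precision_le hc₁ (hd i)) (sq_nonneg _)
    have h3 : sqnorm b ≤ (c₁ ^ 2)⁻¹ * (e * ∑ i, wt M n l i * (M.K n *ᵥ Y) i ^ 2) := by
      rw [le_inv_mul_iff₀ (by positivity)]; linarith
    rw [hD]
    nlinarith [mul_nonneg hD2 hA0, mul_nonneg hD3 hA0, mul_nonneg hD3 hQ1,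
      mul_nonneg hD1.le hQ1]
  · refine hmain.trans (mul_le_mul_left (ENNReal.ofReal_le_ofReal ?_) _)
    have h1 : sqnorm b ≤ c₂ ^ 2 * (1 + (c₁ ^ 2)⁻¹ ^ 2) * (sqnorm Y * ∑ i, wt M n l i ^ 2) :=
      sq_ridge_solution_le hK hd hc₁ hlo hup hb
    rw [hD]
    nlinarith [mul_nonneg hD2 hA0, mul_nonneg hD3 hA0, mul_nonneg hD2 hQ2,
      mul_nonneg hD1.le hQ2]

end

section

/-! ### Moments of the prior -/

variable {M : RVM.Model} {n : ℕ} {c₁ c₂ : ℝ}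

lemma integrable_sq_lawL (hmom : M.Moment4) : Integrable (fun x => x ^ 2) (lawL M) := by
  rw [lawL, integrable_withDensity_iff_integrable_smul₀' (aemeasurable_pr M)
    (ae_of_all _ fun _ => ENNReal.ofReal_lt_top)]
  refine Integrable.congr hmom (ae_of_all _ fun x => ?_)
  simp only [ENNReal.toReal_ofReal (M.hpr_nonneg x), smul_eq_mul, mul_comm]

lemma integrable_id_lawL (hmom : M.Moment4) : Integrable (fun x => x) (lawL M) := by
  refine ((integrable_const (1 : ℝ)).add (integrable_sq_lawL hmom)).mono'
    measurable_id.aestronglyMeasurable (ae_of_all _ fun x => ?_)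
  rw [Real.norm_eq_abs, Pi.add_apply]
  nlinarith [sq_abs x, sq_nonneg (|x| - 1), abs_nonneg x]

/-- Mean of the prior of a local parameter. -/
def mean1 (M : RVM.Model) : ℝ := ∫ x, x ∂lawL M

/-- Second moment of the prior of a local parameter. -/
def mean2 (M : RVM.Model) : ℝ := ∫ x, x ^ 2 ∂lawL M

lemma mean1_nonneg : 0 ≤ mean1 M :=
  integral_nonneg_of_ae ((lawL_ae_pos M).mono fun _ hx => hx.le)

lemma mean2_nonneg : 0 ≤ mean2 M := integral_nonneg fun _ => sq_nonneg _

lemma integrable_sum_prior (hmom : M.Moment4) :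
    Integrable (fun l : Fin n → ℝ => ∑ i, l i) (prior M n) :=
  integrable_finsetSum _ fun i _ =>
    ((measurePreserving_eval (fun _ : Fin n => lawL M) i).integrable_comp
      measurable_id.aestronglyMeasurable).2 (integrable_id_lawL hmom)

lemma integral_sum_prior (hmom : M.Moment4) :
    ∫ l : Fin n → ℝ, ∑ i, l i ∂prior M n = n * mean1 M := by
  rw [integral_finsetSum]
  · have h : ∀ i : Fin n, ∫ l : Fin n → ℝ, l i ∂prior M n = mean1 M := fun i =>
      integral_comp_eval (μ := fun _ : Fin n => lawL M) (i := i) (f := fun x => x)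
        measurable_id.aestronglyMeasurable
    simp [h]
  · exact fun i _ => ((measurePreserving_eval (fun _ : Fin n => lawL M) i).integrable_comp
      measurable_id.aestronglyMeasurable).2 (integrable_id_lawL hmom)

lemma ofReal_integral_le_lintegral {Ω : Type*} [MeasurableSpace Ω] {μ : Measure Ω}
    {X : Ω → ℝ} (hX : Integrable X μ) :
    ENNReal.ofReal (∫ p, X p ∂μ) ≤ ∫⁻ p, ENNReal.ofReal (X p) ∂μ := by
  refine ENNReal.ofReal_le_of_le_toReal ?_
  rw [integral_eq_lintegral_pos_part_sub_lintegral_neg_part hX]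
  exact sub_le_self _ ENNReal.toReal_nonneg

/-- Jensen's inequality for the exponential. -/
lemma exp_neg_integral_le {Ω : Type*} [MeasurableSpace Ω] {μ : Measure Ω}
    [IsProbabilityMeasure μ] {X : Ω → ℝ} (hX : Integrable X μ) :
    ENNReal.ofReal (Real.exp (-∫ p, X p ∂μ)) ≤ ∫⁻ p, ENNReal.ofReal (Real.exp (-X p)) ∂μ := by
  set m := ∫ p, X p ∂μ with hm
  have hi : Integrable (fun p => Real.exp (-m) * (1 + m - X p)) μ :=
    ((integrable_const _).sub hX).const_mul _
  have hval : ∫ p, Real.exp (-m) * (1 + m - X p) ∂μ = Real.exp (-m) := by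
    rw [integral_const_mul, integral_sub (integrable_const _) hX]
    simp [← hm]
  rw [← hval]
  refine (ofReal_integral_le_lintegral hi).trans ?_
  refine lintegral_mono fun p => ENNReal.ofReal_le_ofReal ?_
  have h1 := Real.add_one_le_exp (m - X p)
  have h2 : Real.exp (-X p) = Real.exp (-m) * Real.exp (m - X p) := by
    rw [← Real.exp_add]; congr 1; ring
  rw [h2]
  exact mul_le_mul_of_nonneg_left (by linarith) (Real.exp_pos _).le

/-! ### The evidence -/

/-- Prior predictive mass, up to the constants of the unnormalized density. -/
def kap (M : RVM.Model) (n : ℕ) : ℝ :=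
  (2 * Real.pi) ^ n * √(M.τsq n) ^ n * ((1 / (M.b / 2)) ^ (M.a / 2) * Real.Gamma (M.a / 2))

lemma kap_pos (hτ : 0 < M.τsq n) : 0 < kap M n := by
  have := M.ha
  have := M.hb
  have : 0 < Real.Gamma (M.a / 2) := Real.Gamma_pos_of_pos (by linarith)
  unfold kap
  positivity

lemma rpow_neg_half_mul_prod_sqrt {l : Fin n → ℝ} (hl : ∀ i, 0 < l i) :
    (∏ i, l i) ^ (-(1 : ℝ) / 2) * ∏ i, √(l i) = 1 := by
  have h : 0 < ∏ i, l i := Finset.prod_pos fun i _ => hl i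
  have h2 : ∏ i, √(l i) = (∏ i, l i) ^ ((1 : ℝ) / 2) := by
    simp_rw [Real.sqrt_eq_rpow]
    rw [Real.finsetProd_rpow _ _ fun i _ => (hl i).le]
  rw [h2, ← Real.rpow_add h]
  norm_num

lemma lintegral_exp_neg_sqnorm {s : ℝ} (hs : 0 < s) (z : Fin n → ℝ) :
    ∫⁻ Y : Fin n → ℝ, ENNReal.ofReal (Real.exp (-sqnorm (Y - z) / (2 * s))) =
      ENNReal.ofReal (√(2 * Real.pi * s) ^ n) := by
  rw [lintegral_sub_right_eq_self (fun x => ENNReal.ofReal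
    (Real.exp (-sqnorm x / (2 * s)))) z]
  have h := lintegral_exp_neg_diag (n := n) (p := fun _ => 1 / (2 * s)) fun _ => by positivity
  have h2 : ∀ x : Fin n → ℝ, -sqnorm x / (2 * s) = -∑ i, 1 / (2 * s) * x i ^ 2 := fun x => by
    rw [sqnorm_eq_sum, ← Finset.mul_sum]; field_simp
  simp_rw [h2, h, Finset.prod_const, Finset.card_univ, Fintype.card_fin]
  congr 3
  field_simp

lemma lintegral_marg (hτ : 0 < M.τsq n) {l : Fin n → ℝ} (hl : ∀ i, 0 < l i) :
    ∫⁻ Y, marg M n Y l = ENNReal.ofReal (kap M n) := by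
  have hMa := M.ha
  have hMb := M.hb
  have hprod : 0 ≤ ∏ i, l i := Finset.prod_nonneg fun i _ => (hl i).le
  have hm0 : Measurable fun p : ((Fin n → ℝ) × ℝ) × (Fin n → ℝ) =>
      ENNReal.ofReal (rdens M n p.1.1 p.2 p.1.2 l) :=
    (measurable_rdens_comp M n (by fun_prop) (by fun_prop) (by fun_prop)
      (by fun_prop)).ennreal_ofReal
  have hm1 : Measurable fun p : (Fin n → ℝ) × ℝ =>
      ∫⁻ β, ENNReal.ofReal (rdens M n p.1 β p.2 l) :=
    Measurable.lintegral_prod_right' (ν := volume) hm0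
  have hinner : ∀ s ∈ Set.Ioi (0 : ℝ), ∫⁻ Y, ∫⁻ β, ENNReal.ofReal (rdens M n Y β s l) =
      ENNReal.ofReal ((2 * Real.pi) ^ n * √(M.τsq n) ^ n) *
        ENNReal.ofReal (s ^ (-(M.a / 2) - 1) * Real.exp (-(M.b / 2) / s)) := by
    intro s hs
    have hs : 0 < s := hs
    have hm2 : Measurable fun p : (Fin n → ℝ) × (Fin n → ℝ) =>
        ENNReal.ofReal (rdens M n p.1 p.2 s l) :=
      (measurable_rdens_comp M n (by fun_prop) (by fun_prop) (by fun_prop)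
        (by fun_prop)).ennreal_ofReal
    rw [lintegral_lintegral_swap hm2.aemeasurable]
    set g := s ^ (-(n : ℝ) - M.a / 2 - 1) * (∏ i, l i) ^ (-(1 : ℝ) / 2) *
      Real.exp (-M.b / (2 * s)) with hg
    have hg0 : 0 ≤ g := by positivity
    have hsplit : ∀ Y β, rdens M n Y β s l =
        g * Real.exp (-∑ i, 1 / (2 * s * M.τsq n * l i) * β i ^ 2) *
          Real.exp (-sqnorm (Y - M.K n *ᵥ β) / (2 * s)) := fun Y β => by
      rw [rdens, hg, mul_assoc _ (Real.exp _), mul_assoc _ (Real.exp _), ← Real.exp_add,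
        ← Real.exp_add]
      have h1 : ∑ i, 1 / (2 * s * M.τsq n * l i) * β i ^ 2 =
          (M.τsq n)⁻¹ * (∑ i, β i ^ 2 / l i) / (2 * s) := by
        rw [Finset.mul_sum, Finset.sum_div]
        refine Finset.sum_congr rfl fun i _ => ?_
        have := (hl i).ne'
        field_simp
      rw [h1]
      congr 2
      ring
    have hβ : ∀ β, ∫⁻ Y, ENNReal.ofReal (rdens M n Y β s l) =
        ENNReal.ofReal (g * √(2 * Real.pi * s) ^ n) *
          ENNReal.ofReal (Real.exp (-∑ i, 1 / (2 * s * M.τsq n * l i) * β i ^ 2)) := fun β => by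
      have h1 : ∀ Y, ENNReal.ofReal (rdens M n Y β s l) = ENNReal.ofReal
          (g * Real.exp (-∑ i, 1 / (2 * s * M.τsq n * l i) * β i ^ 2)) * ENNReal.ofReal
          (Real.exp (-sqnorm (Y - M.K n *ᵥ β) / (2 * s))) := fun Y => by
        rw [hsplit, ENNReal.ofReal_mul (by positivity)]
      simp_rw [h1]
      rw [lintegral_const_mul' _ _ ENNReal.ofReal_ne_top, lintegral_exp_neg_sqnorm hs,
        ← ENNReal.ofReal_mul (by positivity), ← ENNReal.ofReal_mul (by positivity)]
      congr 1; ring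
    simp_rw [hβ]
    rw [lintegral_const_mul' _ _ ENNReal.ofReal_ne_top, lintegral_exp_neg_diag fun i => by
      have := hl i; positivity, ← ENNReal.ofReal_mul (by positivity),
      ← ENNReal.ofReal_mul (by positivity)]
    congr 1
    have h3 : ∀ i, √(Real.pi / (1 / (2 * s * M.τsq n * l i))) =
        √(2 * Real.pi * s) * √(M.τsq n) * √(l i) := fun i => by
      rw [← Real.sqrt_mul (by positivity), ← Real.sqrt_mul (by positivity)]
      congr 1; field_simp
    simp_rw [h3]
    rw [Finset.prod_mul_distrib, Finset.prod_const, Finset.card_univ, Fintype.card_fin, mul_pow]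
    have h4 : √(2 * Real.pi * s) ^ n * √(2 * Real.pi * s) ^ n = (2 * Real.pi) ^ n * s ^ (n : ℝ) := by
      rw [← mul_pow, Real.mul_self_sqrt (by positivity), mul_pow, Real.rpow_natCast]
    have h5 : s ^ (-(n : ℝ) - M.a / 2 - 1) * s ^ (n : ℝ) = s ^ (-(M.a / 2) - 1) := by
      rw [← Real.rpow_add hs]; congr 1; ring
    have h6 : -M.b / (2 * s) = -(M.b / 2) / s := by field_simp
    calc _ = (s ^ (-(n : ℝ) - M.a / 2 - 1) * Real.exp (-M.b / (2 * s))) *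
          (√(2 * Real.pi * s) ^ n * √(2 * Real.pi * s) ^ n) * √(M.τsq n) ^ n *
          ((∏ i, l i) ^ (-(1 : ℝ) / 2) * ∏ i, √(l i)) := by rw [hg]; ring
      _ = (2 * Real.pi) ^ n * √(M.τsq n) ^ n *
          ((s ^ (-(n : ℝ) - M.a / 2 - 1) * s ^ (n : ℝ)) * Real.exp (-M.b / (2 * s))) := by
          rw [h4, rpow_neg_half_mul_prod_sqrt hl]; ring
      _ = _ := by rw [h5, h6]
  unfold marg
  rw [lintegral_lintegral_swap hm1.aemeasurable, setLIntegral_congr_fun measurableSet_Ioi hinner,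
    lintegral_const_mul' _ _ ENNReal.ofReal_ne_top,
    lintegral_inverseGamma (by linarith) (by linarith), ← ENNReal.ofReal_mul (by positivity)]
  rfl

lemma exp_neg_half_le_sqrt {x : ℝ} (hx : 0 ≤ x) : Real.exp (-x / 2) ≤ √(1 / (1 + x)) := by
  apply Real.le_sqrt_of_sq_le
  rw [← Real.exp_nat_mul]
  have h : ((2 : ℕ) : ℝ) * (-x / 2) = -x := by push_cast; ring
  rw [h, Real.exp_neg, ← one_div]
  exact one_div_le_one_div_of_le (by linarith) (by linarith [Real.add_one_le_exp x])

lemma le_lintegral_rdens (hK : (M.K n)ᵀ = M.K n) (hc₁ : 0 < c₁)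
    (hlo : ∀ x, c₁ ^ 2 * sqnorm x ≤ sqnorm (M.K n *ᵥ x))
    (hup : ∀ x, sqnorm (M.K n *ᵥ x) ≤ c₂ ^ 2 * sqnorm x) (hτ : 0 < M.τsq n)
    {Y l : Fin n → ℝ} (hl : ∀ i, 0 < l i) {s : ℝ} (hs : 0 < s) :
    ENNReal.ofReal (√(2 * Real.pi * M.τsq n) ^ n *
        Real.exp (-∑ i, c₂ ^ 2 * M.τsq n / 2 * l i)) * ENNReal.ofReal
        (s ^ (-(n : ℝ) / 2 - M.a / 2 - 1) * Real.exp (-(M.b + sqnorm Y) / (2 * s))) ≤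
      ∫⁻ β, ENNReal.ofReal (rdens M n Y β s l) := by
  have hd : ∀ i, 0 < M.τsq n * l i := fun i => mul_pos hτ (hl i)
  obtain ⟨b, hb⟩ := ridge_surjective hK hc₁ hd hlo (M.K n *ᵥ Y)
  rw [lintegral_rdens hK hl hb hs]
  set R := ridgeMin (M.K n) (fun i => M.τsq n * l i) Y b with hR
  have hRY : R ≤ sqnorm Y := ridgeMin_le hK hd hb
  have hJ : ENNReal.ofReal (√s ^ n * (√(2 * Real.pi * M.τsq n) ^ n *
      Real.exp (-∑ i, c₂ ^ 2 * M.τsq n / 2 * l i)) * ∏ i, √(l i)) ≤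
      ∫⁻ x, ENNReal.ofReal
        (Real.exp (-quad (ridge (M.K n) fun i => M.τsq n * l i) x / (2 * s))) := by
    calc _ ≤ ENNReal.ofReal
          (∏ i, √(Real.pi / ((c₂ ^ 2 + (M.τsq n * l i)⁻¹) / (2 * s)))) := by
          refine ENNReal.ofReal_le_ofReal ?_
          rw [← Finset.sum_neg_distrib, Real.exp_sum]
          have h1 : ∀ c : ℝ, c ^ n = ∏ _i : Fin n, c := fun c => by simp
          rw [h1, h1, ← Finset.prod_mul_distrib, ← Finset.prod_mul_distrib,
            ← Finset.prod_mul_distrib]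
          refine Finset.prod_le_prod (fun i _ => by positivity) fun i _ => ?_
          have hli := hl i
          have h2 := exp_neg_half_le_sqrt (x := c₂ ^ 2 * M.τsq n * l i) (by positivity)
          have h3 : √(Real.pi / ((c₂ ^ 2 + (M.τsq n * l i)⁻¹) / (2 * s))) =
              √s * (√(2 * Real.pi * M.τsq n) * √(1 / (1 + c₂ ^ 2 * M.τsq n * l i))) * √(l i) := by
            rw [← Real.sqrt_mul (by positivity), ← Real.sqrt_mul (by positivity),
              ← Real.sqrt_mul (by positivity)]
            congr 1
            field_simp
            ring
          rw [h3]
          have h4 : -(c₂ ^ 2 * M.τsq n / 2 * l i) = -(c₂ ^ 2 * M.τsq n * l i) / 2 := by ring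
          rw [h4]
          gcongr
      _ = ∫⁻ x : Fin n → ℝ, ENNReal.ofReal (Real.exp
          (-∑ i, (c₂ ^ 2 + (M.τsq n * l i)⁻¹) / (2 * s) * x i ^ 2)) :=
          (lintegral_exp_neg_diag fun i => by have := hd i; positivity).symm
      _ ≤ _ := by
          refine lintegral_mono fun x => ENNReal.ofReal_le_ofReal (Real.exp_le_exp.2 ?_)
          have h1 := quad_ridge_le (d := fun i => M.τsq n * l i) hK hup x
          have h2 : ∑ i, (c₂ ^ 2 + (M.τsq n * l i)⁻¹) / (2 * s) * x i ^ 2 =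
              (∑ i, (c₂ ^ 2 + (M.τsq n * l i)⁻¹) * x i ^ 2) / (2 * s) := by
            rw [Finset.sum_div]; exact Finset.sum_congr rfl fun i _ => by ring
          rw [h2, neg_div, neg_le_neg_iff]
          exact div_le_div_of_nonneg_right h1 (by positivity)
  refine le_trans ?_ (mul_le_mul_right hJ _)
  have hp : 0 ≤ ∏ i, l i := Finset.prod_nonneg fun i _ => (hl i).le
  rw [← ENNReal.ofReal_mul (scaleDens_nonneg _ hs hl), ← ENNReal.ofReal_mul (by positivity)]
  refine ENNReal.ofReal_le_ofReal ?_
  have h5 := scaleDens_mul_sqrt_pow (M := M) R hs l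
  have h6 : scaleDens M n R s l * (√s ^ n * (√(2 * Real.pi * M.τsq n) ^ n *
      Real.exp (-∑ i, c₂ ^ 2 * M.τsq n / 2 * l i)) * ∏ i, √(l i)) =
      (√(2 * Real.pi * M.τsq n) ^ n * Real.exp (-∑ i, c₂ ^ 2 * M.τsq n / 2 * l i)) *
      (s ^ (-(((n : ℝ) + M.a) / 2) - 1) * Real.exp (-((M.b + R) / 2) / s)) := by
    calc _ = (scaleDens M n R s l * √s ^ n) * (√(2 * Real.pi * M.τsq n) ^ n *
          Real.exp (-∑ i, c₂ ^ 2 * M.τsq n / 2 * l i)) * ∏ i, √(l i) := by ring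
      _ = ((∏ i, l i) ^ (-(1 : ℝ) / 2) * ∏ i, √(l i)) * ((√(2 * Real.pi * M.τsq n) ^ n *
          Real.exp (-∑ i, c₂ ^ 2 * M.τsq n / 2 * l i)) *
          (s ^ (-(((n : ℝ) + M.a) / 2) - 1) * Real.exp (-((M.b + R) / 2) / s))) := by
          rw [h5]; ring
      _ = _ := by rw [rpow_neg_half_mul_prod_sqrt hl, one_mul]
  rw [h6]
  refine mul_le_mul_of_nonneg_left ?_ (by positivity)
  have h7 : -(n : ℝ) / 2 - M.a / 2 - 1 = -(((n : ℝ) + M.a) / 2) - 1 := by ring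
  rw [h7]
  refine mul_le_mul_of_nonneg_left (Real.exp_le_exp.2 ?_) (by positivity)
  have h8 : -((M.b + R) / 2) / s = -(M.b + R) / (2 * s) := by field_simp
  rw [h8]
  exact div_le_div_of_nonneg_right (by linarith) (by positivity)

/-- Lower bound on the evidence. -/
lemma exists_evidence_ge (M : RVM.Model) (hmom : M.Moment4) (hc₁ : 0 < c₁) : ∃ c > 0, ∀ n ≥ 4,
    0 < M.τsq n → (M.K n)ᵀ = M.K n → (∀ x, c₁ ^ 2 * sqnorm x ≤ sqnorm (M.K n *ᵥ x)) →
    (∀ x, sqnorm (M.K n *ᵥ x) ≤ c₂ ^ 2 * sqnorm x) → ∀ Y : Fin n → ℝ,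
    ENNReal.ofReal (√(2 * Real.pi * M.τsq n) ^ n *
        (c / √n * (M.σ0sq ^ (-(n : ℝ) / 2) * Real.exp (-sqnorm Y / (2 * M.σ0sq)))) *
        Real.exp (-(c₂ ^ 2 * M.τsq n / 2 * (n * mean1 M)))) ≤
      ∫⁻ l, marg M n Y l ∂prior M n := by
  obtain ⟨c, hc, hlow⟩ := lintegral_variance_lower M.hσ0 M.ha M.hb
  refine ⟨c, hc, fun n hn hτ hK hlo hup Y => ?_⟩
  have hσ := M.hσ0
  have hpt : ∀ᵐ l ∂prior M n, ENNReal.ofReal (√(2 * Real.pi * M.τsq n) ^ n *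
      (c / √n * (M.σ0sq ^ (-(n : ℝ) / 2) * Real.exp (-sqnorm Y / (2 * M.σ0sq))))) *
      ENNReal.ofReal (Real.exp (-(c₂ ^ 2 * M.τsq n / 2 * ∑ i, l i))) ≤ marg M n Y l := by
    filter_upwards [prior_ae_pos M n] with l hl
    calc _ = ENNReal.ofReal (√(2 * Real.pi * M.τsq n) ^ n *
        Real.exp (-∑ i, c₂ ^ 2 * M.τsq n / 2 * l i)) * ENNReal.ofReal (c / √n *
          (M.σ0sq ^ (-(n : ℝ) / 2) * Real.exp (-sqnorm Y / (2 * M.σ0sq)))) := by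
          rw [← ENNReal.ofReal_mul (by positivity), ← ENNReal.ofReal_mul (by positivity),
            Finset.mul_sum]
          congr 1; ring
      _ ≤ _ := by
          refine (mul_le_mul_right (hlow n hn (sqnorm Y)) _).trans ?_
          rw [← lintegral_const_mul' _ _ ENNReal.ofReal_ne_top]
          exact setLIntegral_mono' measurableSet_Ioi fun s hs =>
            le_lintegral_rdens hK hc₁ hlo hup hτ hl hs
  refine le_trans ?_ (lintegral_mono_ae hpt)
  rw [lintegral_const_mul' _ _ ENNReal.ofReal_ne_top, ENNReal.ofReal_mul (by positivity)]
  refine mul_le_mul_right ?_ _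
  have h := exp_neg_integral_le
    (((integrable_sum_prior (n := n) hmom).const_mul (c₂ ^ 2 * M.τsq n / 2)))
  rwa [integral_const_mul, integral_sum_prior hmom] at h

end

section

/-! ### The sampling distribution -/

variable {M : RVM.Model} {n : ℕ}

/-- The true mean of the data. -/
def mu (M : RVM.Model) (n : ℕ) : Fin n → ℝ := M.K n *ᵥ M.β0 n

/-- The true sampling distribution. -/
def P0 (M : RVM.Model) (n : ℕ) : Measure (Fin n → ℝ) :=
  volume.withDensity fun Y => ENNReal.ofReal (M.trueDens n Y)

lemma trueDens_nonneg (Y : Fin n → ℝ) : 0 ≤ M.trueDens n Y := by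
  have := M.hσ0
  unfold RVM.Model.trueDens
  positivity

lemma measurable_trueDens : Measurable (M.trueDens n) := by
  unfold RVM.Model.trueDens
  have h : Measurable fun Y : Fin n → ℝ => sqnorm (Y - M.K n *ᵥ M.β0 n) :=
    continuous_sqnorm.measurable.comp (measurable_id.sub_const _)
  fun_prop

lemma lintegral_P0 (g : (Fin n → ℝ) → ℝ≥0∞) :
    ∫⁻ Y, g Y ∂P0 M n = ∫⁻ Y, ENNReal.ofReal (M.trueDens n Y) * g Y := by
  rw [P0, lintegral_withDensity_eq_lintegral_mul_non_measurable _
    measurable_trueDens.ennreal_ofReal (ae_of_all _ fun _ => ENNReal.ofReal_lt_top)]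
  rfl

lemma normalizer_mul (M : RVM.Model) (n : ℕ) :
    (2 * Real.pi * M.σ0sq) ^ (-(n : ℝ) / 2) * √(2 * Real.pi * M.σ0sq) ^ n = 1 := by
  have h := M.hσ0
  have h0 : 0 < 2 * Real.pi * M.σ0sq := by positivity
  rw [Real.sqrt_eq_rpow, ← Real.rpow_natCast, ← Real.rpow_mul h0.le, ← Real.rpow_add h0]
  ring_nf
  exact Real.rpow_zero _

lemma lintegral_P0_sub {g : (Fin n → ℝ) → ℝ≥0∞} :
    ∫⁻ Y, g (Y - mu M n) ∂P0 M n =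
      ENNReal.ofReal ((2 * Real.pi * M.σ0sq) ^ (-(n : ℝ) / 2)) *
        ∫⁻ x, ENNReal.ofReal (Real.exp (-sqnorm x / (2 * M.σ0sq))) * g x := by
  have h := M.hσ0
  rw [lintegral_P0, ← lintegral_const_mul' _ _ ENNReal.ofReal_ne_top,
    ← lintegral_sub_right_eq_self (fun x => ENNReal.ofReal
      ((2 * Real.pi * M.σ0sq) ^ (-(n : ℝ) / 2)) *
        (ENNReal.ofReal (Real.exp (-sqnorm x / (2 * M.σ0sq))) * g x)) (mu M n)]
  refine lintegral_congr fun Y => ?_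
  rw [← mul_assoc, ← ENNReal.ofReal_mul (by positivity)]
  rfl

instance : IsProbabilityMeasure (P0 M n) := ⟨by
  have h := lintegral_P0_sub (M := M) (n := n) (g := fun _ => 1)
  have h2 := lintegral_exp_neg_sqnorm M.hσ0 (0 : Fin n → ℝ)
  have := M.hσ0
  simp only [mul_one, lintegral_one, sub_zero] at h h2
  rw [h, h2, ← ENNReal.ofReal_mul (by positivity), normalizer_mul, ENNReal.ofReal_one]⟩

lemma lintegral_P0_exp_abs (u : Fin n → ℝ) :
    ∫⁻ Y, ENNReal.ofReal (Real.exp |u ⬝ᵥ (Y - mu M n)|) ∂P0 M n ≤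
      ENNReal.ofReal (2 * Real.exp (M.σ0sq * sqnorm u / 2)) := by
  have hv := M.hσ0
  have h := lintegral_gaussian_exp_abs (A := (1 : Matrix (Fin n) (Fin n) ℝ)) (by simp) hv
    (M.σ0sq • u)
  rw [lintegral_P0_sub (g := fun x => ENNReal.ofReal (Real.exp |u ⬝ᵥ x|))]
  have h2 := lintegral_exp_neg_sqnorm hv (0 : Fin n → ℝ)
  have hq : ∀ x : Fin n → ℝ, quad (1 : Matrix (Fin n) (Fin n) ℝ) x = sqnorm x := fun x => by
    simp [quad, sqnorm]
  have h3 : ∀ x : Fin n → ℝ, (1 : Matrix (Fin n) (Fin n) ℝ) *ᵥ (M.σ0sq • u) ⬝ᵥ x / M.σ0sq =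
      u ⬝ᵥ x := fun x => by
    rw [one_mulVec, smul_dotProduct, smul_eq_mul]; field_simp
  have h4 : (1 : Matrix (Fin n) (Fin n) ℝ) *ᵥ (M.σ0sq • u) ⬝ᵥ (M.σ0sq • u) / (2 * M.σ0sq) =
      M.σ0sq * sqnorm u / 2 := by
    rw [one_mulVec, smul_dotProduct, dotProduct_smul, sqnorm, smul_eq_mul, smul_eq_mul]
    field_simp
  simp only [hq, h3, h4] at h
  simp only [sub_zero] at h2
  rw [h2] at h
  have h5 : ∀ x : Fin n → ℝ, ENNReal.ofReal (Real.exp (-sqnorm x / (2 * M.σ0sq))) *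
      ENNReal.ofReal (Real.exp |u ⬝ᵥ x|) =
      ENNReal.ofReal (Real.exp |u ⬝ᵥ x| * Real.exp (-sqnorm x / (2 * M.σ0sq))) := fun x => by
    rw [← ENNReal.ofReal_mul (by positivity), mul_comm]
  simp_rw [h5]
  refine (mul_le_mul_right h _).trans (le_of_eq ?_)
  rw [← ENNReal.ofReal_mul (by positivity), ← ENNReal.ofReal_mul (by positivity)]
  congr 1
  rw [mul_left_comm, normalizer_mul, mul_one]

lemma lintegral_P0_exp_sqnorm :
    ∫⁻ Y, ENNReal.ofReal (Real.exp (sqnorm (Y - mu M n) / (4 * M.σ0sq))) ∂P0 M n =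
      ENNReal.ofReal (√2 ^ n) := by
  have hv := M.hσ0
  rw [lintegral_P0_sub (g := fun x => ENNReal.ofReal (Real.exp (sqnorm x / (4 * M.σ0sq))))]
  have h2 := lintegral_exp_neg_sqnorm (s := 2 * M.σ0sq) (by positivity) (0 : Fin n → ℝ)
  have h5 : ∀ x : Fin n → ℝ, ENNReal.ofReal (Real.exp (-sqnorm x / (2 * M.σ0sq))) *
      ENNReal.ofReal (Real.exp (sqnorm x / (4 * M.σ0sq))) =
      ENNReal.ofReal (Real.exp (-sqnorm x / (2 * (2 * M.σ0sq)))) := fun x => by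
    rw [← ENNReal.ofReal_mul (by positivity), ← Real.exp_add]
    congr 2; field_simp; ring
  simp only [sub_zero] at h2
  simp_rw [h5, h2]
  rw [← ENNReal.ofReal_mul (by positivity)]
  congr 1
  have h6 : √(2 * Real.pi * (2 * M.σ0sq)) = √(2 * Real.pi * M.σ0sq) * √2 := by
    rw [← Real.sqrt_mul (by positivity)]; congr 1; ring
  rw [h6, mul_pow, ← mul_assoc, normalizer_mul, one_mul]

lemma E0_le {f : (Fin n → ℝ) → ℝ} {c : ℝ} (hc : 0 ≤ c)
    (h : ∫⁻ Y, ENNReal.ofReal (f Y) ∂P0 M n ≤ ENNReal.ofReal c) : M.E0 n f ≤ c := by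
  unfold RVM.Model.E0
  by_cases hi : Integrable (fun Y => f Y * M.trueDens n Y)
  · refine (ENNReal.ofReal_le_ofReal_iff hc).1 ((ofReal_integral_le_lintegral hi).trans
      (le_trans (le_of_eq ?_) h))
    rw [lintegral_P0]
    refine lintegral_congr fun Y => ?_
    rw [mul_comm, ENNReal.ofReal_mul (trueDens_nonneg Y)]
  · rw [integral_undef hi]; exact hc

/-! ### Posterior expectations of functions of the local parameters -/

/-- Unnormalized posterior expectation of a function of the local parameters. -/
def num (M : RVM.Model) (n : ℕ) (φ : (Fin n → ℝ) → ℝ≥0∞) (Y : Fin n → ℝ) : ℝ≥0∞ :=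
  ∫⁻ l, marg M n Y l * φ l ∂prior M n

/-- The evidence. -/
def evid (M : RVM.Model) (n : ℕ) (Y : Fin n → ℝ) : ℝ≥0∞ := ∫⁻ l, marg M n Y l ∂prior M n

lemma measurable_evid : Measurable (evid M n) :=
  Measurable.lintegral_prod_right' (measurable_marg M n)

lemma measurable_num {φ : (Fin n → ℝ) → ℝ≥0∞} (hφ : Measurable φ) : Measurable (num M n φ) :=
  Measurable.lintegral_prod_right' (ν := prior M n)
    (f := fun p : (Fin n → ℝ) × (Fin n → ℝ) => marg M n p.1 p.2 * φ p.2)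
    ((measurable_marg M n).mul (hφ.comp measurable_snd))

lemma lintegral_num (hτ : 0 < M.τsq n) {φ : (Fin n → ℝ) → ℝ≥0∞} (hφ : Measurable φ) :
    ∫⁻ Y, num M n φ Y = ENNReal.ofReal (kap M n) * ∫⁻ l, φ l ∂prior M n := by
  unfold num
  have hm : Measurable fun p : (Fin n → ℝ) × (Fin n → ℝ) => marg M n p.1 p.2 * φ p.2 :=
    (measurable_marg M n).mul (hφ.comp measurable_snd)
  rw [lintegral_lintegral_swap hm.aemeasurable, ← lintegral_const_mul _ hφ]
  refine lintegral_congr_ae ?_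
  filter_upwards [prior_ae_pos M n] with l hl
  have h : Measurable fun Y => marg M n Y l := by
    have h := (measurable_marg M n).comp (measurable_id.prodMk (measurable_const (a := l)))
    simpa only [Function.comp_def, id_eq] using h
  rw [lintegral_mul_const _ h, lintegral_marg hτ hl]

lemma evid_ae_lt_top (hτ : 0 < M.τsq n) :
    ∀ᵐ Y ∂(volume : Measure (Fin n → ℝ)), evid M n Y < ∞ := by
  have h := lintegral_num hτ (φ := fun _ => 1) measurable_const
  have h1 : ∀ Y, num M n (fun _ => 1) Y = evid M n Y := fun Y => by simp [num, evid]
  simp only [h1, lintegral_one, measure_univ, mul_one] at h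
  exact ae_lt_top measurable_evid (by rw [h]; exact ENNReal.ofReal_ne_top)

end

section

variable {M : RVM.Model} {n : ℕ} {c₁ c₂ C₀ B₀ : ℝ}

/-- The conditions at a fixed sample size `n`. -/
structure Regular (M : RVM.Model) (c₁ c₂ C₀ B₀ : ℝ) (n : ℕ) : Prop where
  four_le : 4 ≤ n
  tau_pos : 0 < M.τsq n
  symm : (M.K n)ᵀ = M.K n
  lower : ∀ x, c₁ ^ 2 * sqnorm x ≤ sqnorm (M.K n *ᵥ x)
  upper : ∀ x, sqnorm (M.K n *ᵥ x) ≤ c₂ ^ 2 * sqnorm x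
  one_le : (1 : ℝ) ≤ M.q n
  le_card : (M.q n : ℝ) ≤ n
  tau_le : M.τsq n * (n * √n) ≤ C₀ * M.q n
  sqnorm_beta_le : sqnorm (M.β0 n) ≤ B₀ * M.q n

namespace Regular

lemma four_le' (h : Regular M c₁ c₂ C₀ B₀ n) : (4 : ℝ) ≤ n := by exact_mod_cast h.four_le

lemma sqrt_ge (h : Regular M c₁ c₂ C₀ B₀ n) : 1 ≤ √(n : ℝ) :=
  Real.one_le_sqrt.2 (by linarith [h.four_le'])

lemma tau_mul_le (h : Regular M c₁ c₂ C₀ B₀ n) : M.τsq n * n ≤ C₀ * M.q n := by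
  refine le_trans ?_ h.tau_le
  have := h.tau_pos.le
  have h1 := h.sqrt_ge
  have : (n : ℝ) * 1 ≤ n * √n := mul_le_mul_of_nonneg_left h1 (by positivity)
  nlinarith

lemma B_nonneg (h : Regular M c₁ c₂ C₀ B₀ n) : 0 ≤ B₀ := by
  have h1 := sqnorm_nonneg (M.β0 n)
  have h2 := h.sqnorm_beta_le
  have h3 := h.one_le
  nlinarith

lemma C_nonneg (h : Regular M c₁ c₂ C₀ B₀ n) : 0 ≤ C₀ := by
  have h1 : 0 ≤ M.τsq n * n := mul_nonneg h.tau_pos.le (by positivity)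
  have h2 := h.tau_mul_le
  have h3 := h.one_le
  nlinarith

lemma sqnorm_mu_le (h : Regular M c₁ c₂ C₀ B₀ n) : sqnorm (mu M n) ≤ c₂ ^ 2 * B₀ * M.q n := by
  refine (h.upper _).trans ?_
  rw [mul_assoc]
  exact mul_le_mul_of_nonneg_left h.sqnorm_beta_le (sq_nonneg _)

lemma one_le_log (h : Regular M c₁ c₂ C₀ B₀ n) : 1 ≤ Real.log n := by
  rw [Real.le_log_iff_exp_le (by linarith [h.four_le'])]
  linarith [h.four_le', Real.exp_one_lt_d9]

end Regular

lemma trueDens_mul_kap (Y : Fin n → ℝ) :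
    M.trueDens n Y * kap M n = √(2 * Real.pi * M.τsq n) ^ n * M.σ0sq ^ (-(n : ℝ) / 2) *
      Real.exp (-sqnorm (Y - mu M n) / (2 * M.σ0sq)) *
      ((1 / (M.b / 2)) ^ (M.a / 2) * Real.Gamma (M.a / 2)) := by
  have hv := M.hσ0
  have h1 : (2 * Real.pi * M.σ0sq) ^ (-(n : ℝ) / 2) =
      (2 * Real.pi) ^ (-(n : ℝ) / 2) * M.σ0sq ^ (-(n : ℝ) / 2) :=
    Real.mul_rpow (by positivity) hv.le
  have h2 : (2 * Real.pi) ^ (-(n : ℝ) / 2) * (2 * Real.pi) ^ n = √(2 * Real.pi) ^ n := by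
    have h0 : 0 < 2 * Real.pi := by positivity
    rw [Real.sqrt_eq_rpow, ← Real.rpow_natCast, ← Real.rpow_natCast, ← Real.rpow_mul h0.le,
      ← Real.rpow_add h0]
    congr 1; ring
  rw [RVM.Model.trueDens, kap, h1, Real.sqrt_mul (by positivity),
    mul_pow √(2 * Real.pi), ← h2]
  change _ * Real.exp (-sqnorm (Y - mu M n) / (2 * M.σ0sq)) * _ = _
  ring

/-- The direction of the tilt relating the centred and uncentred Gaussian densities. -/
def tilt (M : RVM.Model) (n : ℕ) : Fin n → ℝ := (1 / M.σ0sq) • mu M n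

lemma sqnorm_le_add_tilt (h : Regular M c₁ c₂ C₀ B₀ n) (Y : Fin n → ℝ) :
    sqnorm Y / (2 * M.σ0sq) ≤ sqnorm (Y - mu M n) / (2 * M.σ0sq) +
      |tilt M n ⬝ᵥ (Y - mu M n)| + c₂ ^ 2 * B₀ / (2 * M.σ0sq) * M.q n := by
  have hv := M.hσ0
  have h1 : sqnorm Y = sqnorm (Y - mu M n) + 2 * (mu M n ⬝ᵥ (Y - mu M n)) + sqnorm (mu M n) := by
    have h2 : Y = (Y - mu M n) + mu M n := by simp
    conv_lhs => rw [h2]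
    unfold sqnorm
    rw [add_dotProduct, dotProduct_add, dotProduct_add, dotProduct_comm (Y - mu M n) (mu M n)]
    ring
  have h3 : tilt M n ⬝ᵥ (Y - mu M n) = mu M n ⬝ᵥ (Y - mu M n) / M.σ0sq := by
    rw [tilt, smul_dotProduct, smul_eq_mul]; ring
  have h4 : sqnorm Y / (2 * M.σ0sq) = sqnorm (Y - mu M n) / (2 * M.σ0sq) +
      tilt M n ⬝ᵥ (Y - mu M n) + sqnorm (mu M n) / (2 * M.σ0sq) := by
    rw [h1, h3]; field_simp
  rw [h4]
  have h5 : sqnorm (mu M n) / (2 * M.σ0sq) ≤ c₂ ^ 2 * B₀ / (2 * M.σ0sq) * M.q n := by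
    rw [div_mul_eq_mul_div]
    exact div_le_div_of_nonneg_right h.sqnorm_mu_le (by positivity)
  linarith [le_abs_self (tilt M n ⬝ᵥ (Y - mu M n))]

lemma exists_trueDens_mul_le (M : RVM.Model) (hmom : M.Moment4) (hc₁ : 0 < c₁) (c₂ C₀ B₀ : ℝ) :
    ∃ C : ℝ, 0 < C ∧ ∀ n, Regular M c₁ c₂ C₀ B₀ n → ∀ Y : Fin n → ℝ,
      ENNReal.ofReal (M.trueDens n Y) * ENNReal.ofReal (kap M n) ≤
        ENNReal.ofReal (√n * Real.exp (C * M.q n + |tilt M n ⬝ᵥ (Y - mu M n)|)) *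
          evid M n Y := by
  obtain ⟨c, hc, hev⟩ := exists_evidence_ge (c₂ := c₂) M hmom hc₁
  have hv := M.hσ0
  set G := (1 / (M.b / 2)) ^ (M.a / 2) * Real.Gamma (M.a / 2) with hG
  have hG0 : 0 < G := by
    have := M.ha
    have := M.hb
    have : 0 < Real.Gamma (M.a / 2) := Real.Gamma_pos_of_pos (by linarith)
    rw [hG]; positivity
  have hm := mean1_nonneg (M := M)
  refine ⟨|Real.log (G / c)| + c₂ ^ 2 * |B₀| / (2 * M.σ0sq) + c₂ ^ 2 * |C₀| / 2 * mean1 M + 1,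
    by positivity, fun n h Y => ?_⟩
  have hn : 0 < √(n : ℝ) := by linarith [h.sqrt_ge]
  rw [abs_of_nonneg h.B_nonneg, abs_of_nonneg h.C_nonneg]
  refine le_trans ?_ (mul_le_mul_right
    (hev n h.four_le h.tau_pos h.symm h.lower h.upper Y) _)
  rw [← ENNReal.ofReal_mul (trueDens_nonneg Y), ← ENNReal.ofReal_mul (by positivity)]
  refine ENNReal.ofReal_le_ofReal ?_
  rw [trueDens_mul_kap, ← hG]
  have hGc : G ≤ c * Real.exp (|Real.log (G / c)| * M.q n) := by
    have h1 : G = c * Real.exp (Real.log (G / c)) := by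
      rw [Real.exp_log (by positivity)]; field_simp
    conv_lhs => rw [h1]
    refine mul_le_mul_of_nonneg_left (Real.exp_le_exp.2 ?_) hc.le
    nlinarith [le_abs_self (Real.log (G / c)), abs_nonneg (Real.log (G / c)), h.one_le]
  have he : Real.exp (-sqnorm (Y - mu M n) / (2 * M.σ0sq)) ≤
      Real.exp (|tilt M n ⬝ᵥ (Y - mu M n)| + (c₂ ^ 2 * B₀ / (2 * M.σ0sq) +
        c₂ ^ 2 * C₀ / 2 * mean1 M + 1) * M.q n) * (Real.exp (-sqnorm Y / (2 * M.σ0sq)) *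
        Real.exp (-(c₂ ^ 2 * M.τsq n / 2 * (n * mean1 M)))) := by
    rw [← Real.exp_add, ← Real.exp_add, Real.exp_le_exp, neg_div, neg_div]
    have h1 := sqnorm_le_add_tilt h Y
    have h2 : c₂ ^ 2 * M.τsq n / 2 * (n * mean1 M) ≤ c₂ ^ 2 * C₀ / 2 * mean1 M * M.q n := by
      calc _ = c₂ ^ 2 / 2 * mean1 M * (M.τsq n * n) := by ring
        _ ≤ c₂ ^ 2 / 2 * mean1 M * (C₀ * M.q n) :=
          mul_le_mul_of_nonneg_left h.tau_mul_le (by positivity)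
        _ = _ := by ring
    linarith [h.one_le]
  calc _ ≤ √(2 * Real.pi * M.τsq n) ^ n * M.σ0sq ^ (-(n : ℝ) / 2) *
        (Real.exp (|tilt M n ⬝ᵥ (Y - mu M n)| + (c₂ ^ 2 * B₀ / (2 * M.σ0sq) +
        c₂ ^ 2 * C₀ / 2 * mean1 M + 1) * M.q n) * (Real.exp (-sqnorm Y / (2 * M.σ0sq)) *
        Real.exp (-(c₂ ^ 2 * M.τsq n / 2 * (n * mean1 M))))) *
        (c * Real.exp (|Real.log (G / c)| * M.q n)) := by
        gcongr
    _ = _ := by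
        have h1 : (|Real.log (G / c)| + c₂ ^ 2 * B₀ / (2 * M.σ0sq) + c₂ ^ 2 * C₀ / 2 * mean1 M + 1)
            * M.q n + |tilt M n ⬝ᵥ (Y - mu M n)| = |Real.log (G / c)| * M.q n +
            (|tilt M n ⬝ᵥ (Y - mu M n)| + (c₂ ^ 2 * B₀ / (2 * M.σ0sq) +
            c₂ ^ 2 * C₀ / 2 * mean1 M + 1) * M.q n) := by ring
        rw [h1, Real.exp_add (|Real.log (G / c)| * M.q n)]
        field_simp

/-! ### Tail bounds under the sampling distribution -/

lemma exists_tail_sqnorm (M : RVM.Model) (c₁ c₂ C₀ B₀ : ℝ) : ∃ B C : ℝ, 0 < B ∧ 0 < C ∧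
    ∀ n, Regular M c₁ c₂ C₀ B₀ n →
      (n : ℝ≥0∞) * ∫⁻ Y, ENNReal.ofReal (sqnorm Y - B * n) ∂P0 M n ≤ ENNReal.ofReal C := by
  have hv := M.hσ0
  refine ⟨16 * M.σ0sq + 2 * (c₂ ^ 2 * |B₀|), 8 * M.σ0sq, by positivity, by positivity,
    fun n h => ?_⟩
  rw [abs_of_nonneg h.B_nonneg]
  have hn := h.four_le'
  have hpt : ∀ Y : Fin n → ℝ,
      ENNReal.ofReal (sqnorm Y - (16 * M.σ0sq + 2 * (c₂ ^ 2 * B₀)) * n) ≤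
      ENNReal.ofReal (8 * M.σ0sq * Real.exp (-(2 * n))) *
        ENNReal.ofReal (Real.exp (sqnorm (Y - mu M n) / (4 * M.σ0sq))) := fun Y => by
    rw [← ENNReal.ofReal_mul (by positivity), mul_assoc, ← Real.exp_add]
    refine ENNReal.ofReal_le_ofReal ?_
    have h1 : sqnorm Y ≤ 2 * sqnorm (Y - mu M n) + 2 * sqnorm (mu M n) := by
      have h2 := sqnorm_add_le (Y - mu M n) (mu M n)
      rwa [sub_add_cancel] at h2
    have h3 : sqnorm (mu M n) ≤ c₂ ^ 2 * B₀ * n := h.sqnorm_mu_le.trans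
      (mul_le_mul_of_nonneg_left h.le_card (mul_nonneg (sq_nonneg _) h.B_nonneg))
    have h4 := Real.add_one_le_exp (-(2 * n) + sqnorm (Y - mu M n) / (4 * M.σ0sq))
    have h5 : 2 * sqnorm (Y - mu M n) - 16 * M.σ0sq * n =
        8 * M.σ0sq * (-(2 * n) + sqnorm (Y - mu M n) / (4 * M.σ0sq)) := by field_simp; ring
    have h6 := mul_le_mul_of_nonneg_left h4 (by positivity : 0 ≤ 8 * M.σ0sq)
    linarith
  refine (mul_le_mul_right (lintegral_mono hpt) _).trans ?_
  rw [lintegral_const_mul' _ _ ENNReal.ofReal_ne_top, lintegral_P0_exp_sqnorm,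
    ← ENNReal.ofReal_natCast, ← ENNReal.ofReal_mul (by positivity),
    ← ENNReal.ofReal_mul (by positivity)]
  refine ENNReal.ofReal_le_ofReal ?_
  have h1 : (n : ℝ) ≤ Real.exp n := by linarith [Real.add_one_le_exp (n : ℝ)]
  have h2 : √2 ^ n ≤ Real.exp n := by
    rw [← Real.exp_one_pow]
    refine pow_le_pow_left₀ (by positivity) ?_ n
    have := Real.add_one_le_exp (1 : ℝ)
    have : √2 ≤ 2 := by rw [Real.sqrt_le_left (by norm_num)]; norm_num
    linarith
  calc _ = 8 * M.σ0sq * (Real.exp (-(2 * n)) * (n * √2 ^ n)) := by ring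
    _ ≤ 8 * M.σ0sq * (Real.exp (-(2 * n)) * (Real.exp n * Real.exp n)) := by gcongr
    _ = _ := by rw [← Real.exp_add, ← Real.exp_add]; ring_nf; simp

lemma sq_sub_sq_le_exp {x r : ℝ} (hr : 1 ≤ r) : x ^ 2 - r ^ 2 ≤ 2 * Real.exp (|r * x| - r ^ 2) := by
  rw [abs_mul, abs_of_pos (by linarith : 0 < r), ← sq_abs x]
  have hx := abs_nonneg x
  rcases le_or_gt |x| r with h | h
  · have := Real.exp_pos (r * |x| - r ^ 2)
    nlinarith
  · have h1 := Real.quadratic_le_exp_of_nonneg (x := r * |x| - r ^ 2) (by nlinarith)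
    have h2 : (|x| - r) ^ 2 * 1 ≤ (|x| - r) ^ 2 * r ^ 2 :=
      mul_le_mul_of_nonneg_left (by nlinarith) (sq_nonneg _)
    nlinarith

lemma lintegral_P0_tail_coord (h : Regular M c₁ c₂ C₀ B₀ n) (hc₂ : 0 < c₂) (i : Fin n) :
    ∫⁻ Y, ENNReal.ofReal ((M.K n *ᵥ Y) i ^ 2 - 4 * (c₂ ^ 2 * M.σ0sq) * Real.log n) ∂P0 M n ≤
      ENNReal.ofReal (2 * (M.K n *ᵥ mu M n) i ^ 2 + 8 * (c₂ ^ 2 * M.σ0sq) / n) := by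
  have hv := M.hσ0
  have hn := h.four_le'
  have hlog := h.one_le_log
  set V := c₂ ^ 2 * M.σ0sq with hV
  have hV0 : 0 < V := by positivity
  set r := √(2 * Real.log n) with hr
  have hr2 : r ^ 2 = 2 * Real.log n := Real.sq_sqrt (by linarith)
  have hr1 : 1 ≤ r := Real.one_le_sqrt.2 (by linarith)
  set e : Fin n → ℝ := Pi.single i 1 with he
  set u : Fin n → ℝ := (r / √V) • (M.K n *ᵥ e) with hu
  have hus : sqnorm u ≤ r ^ 2 / M.σ0sq := by
    rw [hu, sqnorm_smul, div_pow, Real.sq_sqrt hV0.le]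
    have h1 : sqnorm (M.K n *ᵥ e) ≤ c₂ ^ 2 := by
      have h2 := h.upper e
      have h3 : sqnorm e = 1 := by simp [he, sqnorm]
      rwa [h3, mul_one] at h2
    calc _ ≤ r ^ 2 / V * c₂ ^ 2 := by gcongr
      _ = _ := by rw [hV]; field_simp
  have hue : ∀ z : Fin n → ℝ, u ⬝ᵥ z = r * ((M.K n *ᵥ z) i / √V) := fun z => by
    rw [hu, smul_dotProduct, ← dotProduct_mulVec_symm h.symm, he, single_one_dotProduct,
      smul_eq_mul]
    ring
  have hpt : ∀ Y : Fin n → ℝ, ENNReal.ofReal ((M.K n *ᵥ Y) i ^ 2 - 4 * V * Real.log n) ≤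
      ENNReal.ofReal (2 * (M.K n *ᵥ mu M n) i ^ 2) +
      ENNReal.ofReal (4 * V * Real.exp (-r ^ 2)) *
        ENNReal.ofReal (Real.exp |u ⬝ᵥ (Y - mu M n)|) := fun Y => by
    rw [← ENNReal.ofReal_mul (by positivity), ← ENNReal.ofReal_add (by positivity) (by positivity)]
    refine ENNReal.ofReal_le_ofReal ?_
    set x := (M.K n *ᵥ (Y - mu M n)) i / √V with hx
    have h1 : (M.K n *ᵥ Y) i = (M.K n *ᵥ mu M n) i + (M.K n *ᵥ (Y - mu M n)) i := by
      rw [mulVec_sub, Pi.sub_apply]; ring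
    have h2 : (M.K n *ᵥ (Y - mu M n)) i ^ 2 = V * x ^ 2 := by
      rw [hx, div_pow, Real.sq_sqrt hV0.le]; field_simp
    have h3 := sq_sub_sq_le_exp (x := x) hr1
    rw [hue, mul_assoc _ (Real.exp _), ← Real.exp_add, h1]
    have h4 : -r ^ 2 + |r * x| = |r * x| - r ^ 2 := by ring
    rw [h4]
    have h5 := mul_le_mul_of_nonneg_left h3 hV0.le
    rw [hr2] at h5 ⊢
    nlinarith [sq_nonneg ((M.K n *ᵥ mu M n) i - (M.K n *ᵥ (Y - mu M n)) i)]
  refine (lintegral_mono hpt).trans ?_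
  rw [lintegral_add_left measurable_const, lintegral_const, measure_univ, mul_one,
    lintegral_const_mul' _ _ ENNReal.ofReal_ne_top]
  refine (add_le_add_right (mul_le_mul_right (lintegral_P0_exp_abs u) _) _).trans ?_
  rw [← ENNReal.ofReal_mul (by positivity), ← ENNReal.ofReal_add (by positivity) (by positivity)]
  refine ENNReal.ofReal_le_ofReal (add_le_add_right ?_ _)
  have h6 : M.σ0sq * sqnorm u / 2 ≤ Real.log n := by
    have := mul_le_mul_of_nonneg_left hus hv.le
    rw [hr2] at this
    have h7 : M.σ0sq * (2 * Real.log n / M.σ0sq) = 2 * Real.log n := by field_simp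
    linarith
  have hn0 : (0 : ℝ) < n := by linarith
  calc _ ≤ 4 * V * Real.exp (-r ^ 2) * (2 * Real.exp (Real.log n)) := by gcongr
    _ = 8 * V * (Real.exp (-r ^ 2) * Real.exp (Real.log n)) := by ring
    _ = 8 * V * Real.exp (-Real.log n) := by rw [← Real.exp_add, hr2]; ring_nf
    _ = _ := by rw [Real.exp_neg, Real.exp_log hn0]; field_simp

lemma exists_tail_coord (M : RVM.Model) (c₁ : ℝ) (hc₂ : 0 < c₂) (C₀ B₀ : ℝ) :
    ∃ A C : ℝ, 0 < A ∧ 0 < C ∧ ∀ n, Regular M c₁ c₂ C₀ B₀ n →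
      ∫⁻ Y, ∑ i, ENNReal.ofReal ((M.K n *ᵥ Y) i ^ 2 - A * Real.log n) ∂P0 M n ≤
        ENNReal.ofReal (C * M.q n) := by
  have hv := M.hσ0
  refine ⟨4 * (c₂ ^ 2 * M.σ0sq), 2 * (c₂ ^ 2 * (c₂ ^ 2 * |B₀|)) + 8 * (c₂ ^ 2 * M.σ0sq),
    by positivity, by positivity, fun n h => ?_⟩
  rw [abs_of_nonneg h.B_nonneg]
  have hn := h.four_le'
  have hcont : ∀ i, Measurable fun Y : Fin n → ℝ =>
      ENNReal.ofReal ((M.K n *ᵥ Y) i ^ 2 - 4 * (c₂ ^ 2 * M.σ0sq) * Real.log n) := fun i => by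
    have : Continuous fun Y : Fin n → ℝ => (M.K n *ᵥ Y) i :=
      (continuous_apply i).comp (continuous_const.matrix_mulVec continuous_id)
    exact ((this.measurable.pow_const 2).sub_const _).ennreal_ofReal
  rw [lintegral_finsetSum _ fun i _ => hcont i]
  refine (Finset.sum_le_sum fun i _ => lintegral_P0_tail_coord h hc₂ i).trans ?_
  rw [← ENNReal.ofReal_sum_of_nonneg fun i _ => by positivity]
  refine ENNReal.ofReal_le_ofReal ?_
  rw [Finset.sum_add_distrib, ← Finset.mul_sum, ← sqnorm_eq_sum, Finset.sum_const,
    Finset.card_univ, Fintype.card_fin, nsmul_eq_mul]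
  have h1 := h.upper (mu M n)
  have h2 := mul_le_mul_of_nonneg_left h.sqnorm_mu_le (sq_nonneg c₂)
  have h3 : (n : ℝ) * (8 * (c₂ ^ 2 * M.σ0sq) / n) = 8 * (c₂ ^ 2 * M.σ0sq) := by field_simp
  have h4 := mul_le_mul_of_nonneg_left h.one_le (by positivity : 0 ≤ 8 * (c₂ ^ 2 * M.σ0sq))
  rw [h3]
  nlinarith

end

section

variable {M : RVM.Model} {n : ℕ} {c₁ c₂ C₀ B₀ : ℝ}

/-- Sum of the capped local weights. -/
def wtSum (M : RVM.Model) (n : ℕ) (l : Fin n → ℝ) : ℝ := ∑ i, wt M n l i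

/-- Sum of the squares of the capped local weights. -/
def wtSqSum (M : RVM.Model) (n : ℕ) (l : Fin n → ℝ) : ℝ := ∑ i, wt M n l i ^ 2

lemma measurable_wtSum : Measurable (wtSum M n) := by
  unfold wtSum wt; fun_prop

lemma measurable_wtSqSum : Measurable (wtSqSum M n) := by
  unfold wtSqSum wt; fun_prop

lemma wt_nonneg (hτ : 0 < M.τsq n) {l : Fin n → ℝ} (hl : ∀ i, 0 < l i) (i : Fin n) :
    0 ≤ wt M n l i := le_min zero_le_one (mul_pos hτ (hl i)).le

lemma wt_le_one (l : Fin n → ℝ) (i : Fin n) : wt M n l i ≤ 1 := min_le_left _ _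

lemma wt_le (l : Fin n → ℝ) (i : Fin n) : wt M n l i ≤ M.τsq n * l i := min_le_right _ _

lemma wtSum_le (l : Fin n → ℝ) : wtSum M n l ≤ n :=
  (Finset.sum_le_sum fun i _ => wt_le_one l i).trans (by simp)

lemma wtSqSum_le (hτ : 0 < M.τsq n) {l : Fin n → ℝ} (hl : ∀ i, 0 < l i) : wtSqSum M n l ≤ n :=
  (Finset.sum_le_sum fun i _ => pow_le_one₀ (wt_nonneg hτ hl i) (wt_le_one l i)).trans (by simp)

lemma exp_mul_le_affine {t h : ℝ} (h0 : 0 ≤ h) (h1 : h ≤ 1) :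
    Real.exp (t * h) ≤ 1 + (Real.exp t - 1) * h := by
  have h2 := convexOn_exp.2 (Set.mem_univ (0 : ℝ)) (Set.mem_univ t)
    (by linarith : 0 ≤ 1 - h) h0 (by ring)
  simp only [smul_eq_mul, mul_zero, zero_add, Real.exp_zero, mul_one] at h2
  rw [mul_comm t h]
  linarith

lemma lintegral_exp_wtSum_le (hmom : M.Moment4) (hτ : 0 < M.τsq n) {t : ℝ} (ht : 0 ≤ t) :
    ∫⁻ l, ENNReal.ofReal (Real.exp (t * wtSum M n l)) ∂prior M n ≤
      ENNReal.ofReal (Real.exp (M.τsq n * (n * Real.exp t) * mean1 M)) := by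
  have hm := mean1_nonneg (M := M)
  have he : 0 ≤ Real.exp t - 1 := by linarith [Real.add_one_le_exp t]
  have h1 : ∀ᵐ l ∂prior M n, ENNReal.ofReal (Real.exp (t * wtSum M n l)) ≤
      ∏ i, ENNReal.ofReal (1 + M.τsq n * Real.exp t * l i) := by
    filter_upwards [prior_ae_pos M n] with l hl
    rw [← ENNReal.ofReal_prod_of_nonneg fun i _ => by have := hl i; positivity]
    refine ENNReal.ofReal_le_ofReal ?_
    rw [wtSum, Finset.mul_sum, Real.exp_sum]
    refine Finset.prod_le_prod (fun i _ => (Real.exp_pos _).le) fun i _ => ?_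
    refine (exp_mul_le_affine (wt_nonneg hτ hl i) (wt_le_one l i)).trans ?_
    have h2 := wt_le (M := M) l i
    have h3 := wt_nonneg hτ hl i
    have h4 : (Real.exp t - 1) * wt M n l i ≤ Real.exp t * (M.τsq n * l i) :=
      mul_le_mul (by linarith) h2 h3 (Real.exp_pos _).le
    linarith
  refine (lintegral_mono_ae h1).trans ?_
  have hintg : Integrable (fun x : ℝ => 1 + M.τsq n * Real.exp t * x) (lawL M) :=
    (integrable_const _).add ((integrable_id_lawL hmom).const_mul _)
  rw [prior, lintegral_pi_prod (f := fun _ x => ENNReal.ofReal (1 + M.τsq n * Real.exp t * x))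
    fun i => by fun_prop]
  have h5 : ∫⁻ x, ENNReal.ofReal (1 + M.τsq n * Real.exp t * x) ∂lawL M =
      ENNReal.ofReal (1 + M.τsq n * Real.exp t * mean1 M) := by
    rw [← ofReal_integral_eq_lintegral_ofReal hintg, integral_add (integrable_const _)
      ((integrable_id_lawL hmom).const_mul _), integral_const_mul]
    · simp [mean1]
    · filter_upwards [lawL_ae_pos M] with x hx
      have : (0 : ℝ) < x := hx
      change 0 ≤ 1 + M.τsq n * Real.exp t * x
      positivity
  rw [h5, Finset.prod_const, Finset.card_univ, Fintype.card_fin,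
    ← ENNReal.ofReal_pow (by positivity)]
  refine ENNReal.ofReal_le_ofReal ?_
  have h6 : M.τsq n * (n * Real.exp t) * mean1 M = n * (M.τsq n * Real.exp t * mean1 M) := by ring
  rw [h6, Real.exp_nat_mul]
  refine pow_le_pow_left₀ (by positivity) ?_ n
  linarith [Real.add_one_le_exp (M.τsq n * Real.exp t * mean1 M)]

lemma lintegral_wtSqSum_le (hmom : M.Moment4) (hτ : 0 < M.τsq n) :
    ∫⁻ l, ENNReal.ofReal (wtSqSum M n l) ∂prior M n ≤
      ENNReal.ofReal (n * (M.τsq n ^ 2 * mean2 M)) := by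
  have h1 : ∀ᵐ l ∂prior M n, ENNReal.ofReal (wtSqSum M n l) ≤
      ∑ i, ENNReal.ofReal (M.τsq n ^ 2 * l i ^ 2) := by
    filter_upwards [prior_ae_pos M n] with l hl
    rw [← ENNReal.ofReal_sum_of_nonneg fun i _ => by positivity]
    refine ENNReal.ofReal_le_ofReal (Finset.sum_le_sum fun i _ => ?_)
    rw [← mul_pow]
    exact pow_le_pow_left₀ (wt_nonneg hτ hl i) (wt_le l i) 2
  refine (lintegral_mono_ae h1).trans (le_of_eq ?_)
  rw [lintegral_finsetSum _ fun i _ => by fun_prop]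
  have h2 : ∀ i : Fin n, ∫⁻ l, ENNReal.ofReal (M.τsq n ^ 2 * l i ^ 2) ∂prior M n =
      ENNReal.ofReal (M.τsq n ^ 2 * mean2 M) := fun i => by
    rw [prior, lintegral_pi_eval i (f := fun x => ENNReal.ofReal (M.τsq n ^ 2 * x ^ 2))
      (by fun_prop), ← ofReal_integral_eq_lintegral_ofReal
      ((integrable_sq_lawL hmom).const_mul _) (ae_of_all _ fun x => by
        change 0 ≤ M.τsq n ^ 2 * x ^ 2
        positivity), integral_const_mul, mean2]
  simp_rw [h2]
  rw [Finset.sum_const, Finset.card_univ, Fintype.card_fin, nsmul_eq_mul,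
    ENNReal.ofReal_mul (p := (n : ℝ)) (by positivity), ENNReal.ofReal_natCast]

lemma sqnorm_tilt_le (h : Regular M c₁ c₂ C₀ B₀ n) :
    sqnorm (tilt M n) ≤ c₂ ^ 2 * B₀ / M.σ0sq ^ 2 * M.q n := by
  have hv := M.hσ0
  rw [tilt, sqnorm_smul]
  have h1 := mul_le_mul_of_nonneg_left h.sqnorm_mu_le (by positivity : 0 ≤ (1 / M.σ0sq) ^ 2)
  refine h1.trans (le_of_eq ?_)
  field_simp

lemma lintegral_abs_tilt_le (h : Regular M c₁ c₂ C₀ B₀ n) :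
    ∫⁻ Y, ENNReal.ofReal |tilt M n ⬝ᵥ (Y - mu M n)| ∂P0 M n ≤
      ENNReal.ofReal (2 * Real.exp (c₂ ^ 2 * B₀ / (2 * M.σ0sq)) * M.q n) := by
  have hv := M.hσ0
  have hq := h.one_le
  have hB := h.B_nonneg
  have hpt : ∀ Y : Fin n → ℝ, ENNReal.ofReal |tilt M n ⬝ᵥ (Y - mu M n)| ≤
      ENNReal.ofReal (M.q n) *
        ENNReal.ofReal (Real.exp |((1 / (M.q n : ℝ)) • tilt M n) ⬝ᵥ (Y - mu M n)|) := fun Y => by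
    rw [← ENNReal.ofReal_mul (by positivity), smul_dotProduct, smul_eq_mul, abs_mul,
      abs_of_nonneg (by positivity : 0 ≤ 1 / (M.q n : ℝ))]
    refine ENNReal.ofReal_le_ofReal ?_
    set x := |tilt M n ⬝ᵥ (Y - mu M n)|
    have h1 := Real.add_one_le_exp (1 / (M.q n : ℝ) * x)
    calc x = M.q n * (1 / (M.q n : ℝ) * x) := by field_simp
      _ ≤ _ := mul_le_mul_of_nonneg_left (by linarith) (by positivity)
  refine (lintegral_mono hpt).trans ?_
  rw [lintegral_const_mul' _ _ ENNReal.ofReal_ne_top]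
  refine (mul_le_mul_right (lintegral_P0_exp_abs _) _).trans ?_
  rw [← ENNReal.ofReal_mul (by positivity)]
  refine ENNReal.ofReal_le_ofReal ?_
  rw [mul_comm]
  have h2 : M.σ0sq * sqnorm ((1 / (M.q n : ℝ)) • tilt M n) / 2 ≤ c₂ ^ 2 * B₀ / (2 * M.σ0sq) := by
    rw [sqnorm_smul]
    calc _ ≤ M.σ0sq * ((1 / (M.q n : ℝ)) ^ 2 * (c₂ ^ 2 * B₀ / M.σ0sq ^ 2 * M.q n)) / 2 := by
          have := sqnorm_tilt_le h
          gcongr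
      _ = c₂ ^ 2 * B₀ / (2 * M.σ0sq) / M.q n := by field_simp
      _ ≤ _ := div_le_self (by positivity) hq
  gcongr

lemma lintegral_exp_abs_tilt_le (h : Regular M c₁ c₂ C₀ B₀ n) :
    ∫⁻ Y, ENNReal.ofReal (Real.exp (12 * |tilt M n ⬝ᵥ (Y - mu M n)|)) ∂P0 M n ≤
      ENNReal.ofReal (2 * Real.exp (72 * c₂ ^ 2 * B₀ / M.σ0sq * M.q n)) := by
  have hv := M.hσ0
  have h1 := lintegral_P0_exp_abs (M := M) ((12 : ℝ) • tilt M n)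
  simp only [smul_dotProduct, smul_eq_mul, abs_mul, Nat.abs_ofNat] at h1
  refine h1.trans (ENNReal.ofReal_le_ofReal ?_)
  have h2 : M.σ0sq * sqnorm ((12 : ℝ) • tilt M n) / 2 ≤ 72 * c₂ ^ 2 * B₀ / M.σ0sq * M.q n := by
    rw [sqnorm_smul]
    calc _ ≤ M.σ0sq * (12 ^ 2 * (c₂ ^ 2 * B₀ / M.σ0sq ^ 2 * M.q n)) / 2 := by
          have := sqnorm_tilt_le h
          gcongr
      _ = _ := by field_simp; ring
  gcongr

/-- Posterior expectation of a function of the local parameters. -/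
def post (M : RVM.Model) (n : ℕ) (φ : (Fin n → ℝ) → ℝ≥0∞) (Y : Fin n → ℝ) : ℝ≥0∞ :=
  num M n φ Y / evid M n Y

lemma measurable_post {φ : (Fin n → ℝ) → ℝ≥0∞} (hφ : Measurable φ) : Measurable (post M n φ) :=
  (measurable_num hφ).div measurable_evid

lemma trueDens_pos (Y : Fin n → ℝ) : 0 < M.trueDens n Y := by
  have := M.hσ0
  unfold RVM.Model.trueDens
  positivity

lemma evid_ne_zero (hτ : 0 < M.τsq n) {Y : Fin n → ℝ} {F : ℝ}
    (h : ENNReal.ofReal (M.trueDens n Y) * ENNReal.ofReal (kap M n) ≤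
      ENNReal.ofReal F * evid M n Y) : evid M n Y ≠ 0 := fun h0 => by
  rw [h0, mul_zero, nonpos_iff_eq_zero, mul_eq_zero, ENNReal.ofReal_eq_zero,
    ENNReal.ofReal_eq_zero] at h
  rcases h with h | h
  · exact absurd (trueDens_pos Y) h.not_gt
  · exact absurd (kap_pos hτ) h.not_gt

lemma mul_div_le_of_mul_le {f κ F Z N : ℝ≥0∞} (h : f * κ ≤ F * Z) (hκ : κ ≠ 0) (hκ' : κ ≠ ∞)
    (hZ : Z ≠ 0) (hZ' : Z ≠ ∞) : f * (N / Z) ≤ F * (N / κ) := by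
  have h1 : f ≤ F * Z / κ := (ENNReal.le_div_iff_mul_le (Or.inl hκ) (Or.inl hκ')).2 h
  calc f * (N / Z) ≤ (F * Z / κ) * (N / Z) := mul_le_mul_left h1 _
    _ = F * (N / κ) * (Z * Z⁻¹) := by simp only [div_eq_mul_inv]; ring
    _ = _ := by rw [ENNReal.mul_inv_cancel hZ hZ', mul_one]

lemma lintegral_num_div (hτ : 0 < M.τsq n) {φ : (Fin n → ℝ) → ℝ≥0∞} (hφ : Measurable φ) :
    ∫⁻ Y, num M n φ Y / ENNReal.ofReal (kap M n) = ∫⁻ l, φ l ∂prior M n := by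
  simp only [div_eq_mul_inv]
  have h0 : ENNReal.ofReal (kap M n) ≠ 0 := by
    simpa [ENNReal.ofReal_eq_zero] using kap_pos hτ
  rw [lintegral_mul_const _ (measurable_num hφ), lintegral_num hτ hφ, mul_comm, ← mul_assoc,
    ENNReal.inv_mul_cancel h0 ENNReal.ofReal_ne_top, one_mul]

lemma ofReal_mul_num_le {t α : ℝ} (ht : 0 ≤ t) (hα : 0 ≤ α) (Y : Fin n → ℝ) :
    ENNReal.ofReal t * num M n (fun l => ENNReal.ofReal (wtSum M n l)) Y ≤
      ENNReal.ofReal (Real.exp (-α)) *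
        num M n (fun l => ENNReal.ofReal (Real.exp (t * wtSum M n l))) Y +
      ENNReal.ofReal α * evid M n Y := by
  unfold num evid
  have hm := measurable_marg_right M n Y
  rw [← lintegral_const_mul' _ _ ENNReal.ofReal_ne_top,
    ← lintegral_const_mul' _ _ ENNReal.ofReal_ne_top,
    ← lintegral_const_mul' _ _ ENNReal.ofReal_ne_top,
    ← lintegral_add_right _ (hm.const_mul _)]
  refine lintegral_mono fun l => ?_
  have h1 : ENNReal.ofReal t * ENNReal.ofReal (wtSum M n l) ≤
      ENNReal.ofReal (Real.exp (-α)) * ENNReal.ofReal (Real.exp (t * wtSum M n l)) +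
      ENNReal.ofReal α := by
    rw [← ENNReal.ofReal_mul ht, ← ENNReal.ofReal_mul (by positivity),
      ← ENNReal.ofReal_add (by positivity) hα, ← Real.exp_add]
    refine ENNReal.ofReal_le_ofReal ?_
    linarith [Real.add_one_le_exp (-α + t * wtSum M n l)]
  calc _ = marg M n Y l * (ENNReal.ofReal t * ENNReal.ofReal (wtSum M n l)) := by ring
    _ ≤ marg M n Y l * _ := mul_le_mul_right h1 _
    _ = _ := by ring

/-- Entropic bound on the posterior expected total weight. -/
lemma exists_lintegral_post_wtSum_le (M : RVM.Model) (hmom : M.Moment4) (hc₁ : 0 < c₁)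
    (c₂ C₀ B₀ : ℝ) : ∃ C : ℝ, 0 < C ∧ ∀ n, Regular M c₁ c₂ C₀ B₀ n →
      ENNReal.ofReal (Real.log n) *
        ∫⁻ Y, post M n (fun l => ENNReal.ofReal (wtSum M n l)) Y ∂P0 M n ≤
      ENNReal.ofReal (C * (M.q n + Real.log n)) := by
  obtain ⟨C₃, hC₃, hF⟩ := exists_trueDens_mul_le M hmom hc₁ c₂ C₀ B₀
  have hv := M.hσ0
  have hm1 := mean1_nonneg (M := M)
  refine ⟨2 * (1 + 1 + C₃ + |C₀| * mean1 M + 2 * Real.exp (c₂ ^ 2 * |B₀| / (2 * M.σ0sq))),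
    by positivity, fun n h => ?_⟩
  rw [abs_of_nonneg h.B_nonneg, abs_of_nonneg h.C_nonneg]
  have hq := h.one_le
  have hlog := h.one_le_log
  have hC0 := h.C_nonneg
  have hn : (0 : ℝ) < n := by linarith [h.four_le']
  set t := Real.log n / 2 with ht
  have ht0 : 0 ≤ t := by linarith
  have het : Real.exp t = √n := by
    rw [ht, Real.exp_half, Real.exp_log hn]
  set C₄ := C₀ * mean1 M with hC₄
  have hC₄0 : 0 ≤ C₄ := by positivity
  set φ : (Fin n → ℝ) → ℝ≥0∞ := fun l => ENNReal.ofReal (Real.exp (t * wtSum M n l)) with hφ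
  have hφm : Measurable φ := ((measurable_wtSum.const_mul t).exp).ennreal_ofReal
  have hκ0 : ENNReal.ofReal (kap M n) ≠ 0 := by
    simpa [ENNReal.ofReal_eq_zero] using kap_pos h.tau_pos
  set α : (Fin n → ℝ) → ℝ := fun Y => t + (C₃ + C₄) * M.q n + |tilt M n ⬝ᵥ (Y - mu M n)| with hα
  have hpt : ∀ᵐ Y ∂(volume : Measure (Fin n → ℝ)), ENNReal.ofReal (M.trueDens n Y) *
      (ENNReal.ofReal t * post M n (fun l => ENNReal.ofReal (wtSum M n l)) Y) ≤
      ENNReal.ofReal (Real.exp (-(C₄ * M.q n))) *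
        (num M n φ Y / ENNReal.ofReal (kap M n)) +
      ENNReal.ofReal (M.trueDens n Y) * ENNReal.ofReal (α Y) := by
    filter_upwards [evid_ae_lt_top h.tau_pos] with Y hY
    have hFY := hF n h Y
    have hZ := evid_ne_zero h.tau_pos hFY
    have hα0 : 0 ≤ α Y := by simp only [hα]; positivity
    have h1 := ofReal_mul_num_le (M := M) ht0 hα0 Y
    have h2 : ENNReal.ofReal t * post M n (fun l => ENNReal.ofReal (wtSum M n l)) Y ≤
        ENNReal.ofReal (Real.exp (-α Y)) * (num M n φ Y / evid M n Y) +
          ENNReal.ofReal (α Y) := by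
      rw [post, ← mul_div_assoc]
      refine (ENNReal.div_le_div_right h1 _).trans (le_of_eq ?_)
      rw [ENNReal.add_div, mul_div_assoc, mul_div_assoc, ENNReal.div_self hZ hY.ne, mul_one]
    refine (mul_le_mul_right h2 _).trans ?_
    rw [mul_add]
    refine add_le_add_left ?_ _
    have h3 := mul_div_le_of_mul_le (N := num M n φ Y) hFY hκ0 ENNReal.ofReal_ne_top hZ hY.ne
    rw [mul_left_comm]
    refine (mul_le_mul_right h3 _).trans (le_of_eq ?_)
    rw [← mul_assoc, ← ENNReal.ofReal_mul (Real.exp_pos _).le]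
    congr 2
    rw [← het, ← Real.exp_add, ← Real.exp_add]
    congr 1
    simp only [hα]
    ring
  have hmain : ENNReal.ofReal t *
      ∫⁻ Y, post M n (fun l => ENNReal.ofReal (wtSum M n l)) Y ∂P0 M n ≤
      ENNReal.ofReal (1 + (t + (C₃ + C₄) * M.q n +
        2 * Real.exp (c₂ ^ 2 * B₀ / (2 * M.σ0sq)) * M.q n)) := by
    rw [← lintegral_const_mul' _ _ ENNReal.ofReal_ne_top, lintegral_P0]
    refine (lintegral_mono_ae hpt).trans ?_
    rw [lintegral_add_left (((measurable_num hφm).div_const _).const_mul _),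
      lintegral_const_mul' _ _ ENNReal.ofReal_ne_top, lintegral_num_div h.tau_pos hφm,
      ← lintegral_P0]
    rw [ENNReal.ofReal_add zero_le_one (by positivity), ENNReal.ofReal_one,
      ENNReal.ofReal_add (p := t + (C₃ + C₄) * M.q n) (by positivity) (by positivity)]
    refine add_le_add ?_ ?_
    · refine (mul_le_mul_right (lintegral_exp_wtSum_le hmom h.tau_pos ht0) _).trans ?_
      rw [← ENNReal.ofReal_mul (Real.exp_pos _).le, ← Real.exp_add, het]
      refine ENNReal.ofReal_le_one.2 (Real.exp_le_one_iff.2 ?_)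
      have := mul_le_mul_of_nonneg_right h.tau_le hm1
      rw [hC₄]
      linarith
    · have h4 : ∀ Y, ENNReal.ofReal (α Y) = ENNReal.ofReal (t + (C₃ + C₄) * M.q n) +
          ENNReal.ofReal |tilt M n ⬝ᵥ (Y - mu M n)| := fun Y => by
        rw [← ENNReal.ofReal_add (by positivity) (abs_nonneg _)]
      simp_rw [h4]
      rw [lintegral_add_left measurable_const, lintegral_const, measure_univ, mul_one]
      exact add_le_add_right (lintegral_abs_tilt_le h) _
  have h5 : Real.log n = 2 * t := by rw [ht]; ring
  rw [h5, ENNReal.ofReal_mul (p := 2) zero_le_two, mul_assoc]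
  refine (mul_le_mul_right hmain _).trans ?_
  rw [← ENNReal.ofReal_mul zero_le_two]
  refine ENNReal.ofReal_le_ofReal ?_
  have h6 := Real.exp_pos (c₂ ^ 2 * B₀ / (2 * M.σ0sq))
  set E := Real.exp (c₂ ^ 2 * B₀ / (2 * M.σ0sq))
  have h7 : 0 ≤ (1 + C₃ + C₄ + 2 * E) * t := by positivity
  nlinarith

/-- Bound on the posterior expected sum of squared weights for slowly growing `q`. -/
lemma exists_lintegral_post_wtSqSum_le (M : RVM.Model) (hmom : M.Moment4) (hc₁ : 0 < c₁)
    (c₂ C₀ B₀ : ℝ) : ∃ δ C : ℝ, 0 < δ ∧ 0 < C ∧ ∀ n, Regular M c₁ c₂ C₀ B₀ n →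
      (M.q n : ℝ) ≤ δ * Real.log n →
      ENNReal.ofReal n *
        ∫⁻ Y, post M n (fun l => ENNReal.ofReal (wtSqSum M n l)) Y ∂P0 M n ≤
      ENNReal.ofReal (C * M.q n) := by
  obtain ⟨C₃, hC₃, hF⟩ := exists_trueDens_mul_le M hmom hc₁ c₂ C₀ B₀
  have hv := M.hσ0
  have hm2 := mean2_nonneg (M := M)
  set C₅ := 12 * C₃ + 72 * c₂ ^ 2 * |B₀| / M.σ0sq with hC₅
  have hC₅0 : 0 < C₅ := by positivity
  refine ⟨1 / C₅, 4 / C₅ * C₀ ^ 2 * mean2 M + 2, by positivity, by positivity, fun n h hqn => ?_⟩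
  rw [abs_of_nonneg h.B_nonneg] at hC₅
  have hq := h.one_le
  have hC0 := h.C_nonneg
  have hn : (0 : ℝ) < n := by linarith [h.four_le']
  set ρ := √√(n : ℝ) with hρ
  have hρ0 : 0 < ρ := by positivity
  have hρ2 : ρ ^ 2 = √n := Real.sq_sqrt (by positivity)
  have hρ4 : ρ ^ 4 = n := by
    rw [show ρ ^ 4 = (ρ ^ 2) ^ 2 by ring, hρ2, Real.sq_sqrt hn.le]
  set φ : (Fin n → ℝ) → ℝ≥0∞ := fun l => ENNReal.ofReal (wtSqSum M n l) with hφ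
  have hφm : Measurable φ := measurable_wtSqSum.ennreal_ofReal
  have hκ0 : ENNReal.ofReal (kap M n) ≠ 0 := by
    simpa [ENNReal.ofReal_eq_zero] using kap_pos h.tau_pos
  set G := (1 / (n : ℝ) ^ 2) * Real.exp (12 * C₃ * M.q n) with hG
  have hG0 : 0 ≤ G := by positivity
  have hpt : ∀ᵐ Y ∂(volume : Measure (Fin n → ℝ)), ENNReal.ofReal (M.trueDens n Y) *
      post M n φ Y ≤ ENNReal.ofReal (ρ ^ 3) * (num M n φ Y / ENNReal.ofReal (kap M n)) +
      ENNReal.ofReal (M.trueDens n Y) * (ENNReal.ofReal G *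
        ENNReal.ofReal (Real.exp (12 * |tilt M n ⬝ᵥ (Y - mu M n)|))) := by
    filter_upwards [evid_ae_lt_top h.tau_pos] with Y hY
    have hFY := hF n h Y
    have hZ := evid_ne_zero h.tau_pos hFY
    set x := |tilt M n ⬝ᵥ (Y - mu M n)| with hx
    rcases le_or_gt (√n * Real.exp (C₃ * M.q n + x)) (ρ ^ 3) with hle | hgt
    · have h3 := mul_div_le_of_mul_le (N := num M n φ Y) hFY hκ0 ENNReal.ofReal_ne_top hZ hY.ne
      refine (h3.trans ?_).trans le_self_add
      exact mul_le_mul_left (ENNReal.ofReal_le_ofReal hle) _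
    · refine le_trans ?_ le_add_self
      refine mul_le_mul_right ?_ _
      have h4 : post M n φ Y ≤ ENNReal.ofReal n := by
        refine ENNReal.div_le_of_le_mul ?_
        unfold num evid
        rw [← lintegral_const_mul' _ _ ENNReal.ofReal_ne_top]
        refine lintegral_mono_ae ?_
        filter_upwards [prior_ae_pos M n] with l hl
        rw [mul_comm]
        exact mul_le_mul_left (ENNReal.ofReal_le_ofReal (wtSqSum_le h.tau_pos hl)) _
      refine h4.trans ?_
      rw [← ENNReal.ofReal_mul hG0]
      refine ENNReal.ofReal_le_ofReal ?_
      rw [← hρ2] at hgt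
      have h5 : ρ ≤ Real.exp (C₃ * M.q n + x) := by
        by_contra! hcon
        have := mul_le_mul_of_nonneg_left hcon.le (by positivity : 0 ≤ ρ ^ 2)
        nlinarith
      have h6 := pow_le_pow_left₀ hρ0.le h5 12
      rw [← Real.exp_nat_mul] at h6
      have h7 : ρ ^ 12 = (n : ℝ) ^ 3 := by rw [← hρ4]; ring
      rw [h7] at h6
      rw [hG, mul_assoc, ← Real.exp_add]
      have h8 : ((12 : ℕ) : ℝ) * (C₃ * M.q n + x) = 12 * C₃ * M.q n + 12 * x := by
        push_cast; ring
      rw [h8] at h6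
      calc (n : ℝ) = 1 / (n : ℝ) ^ 2 * (n : ℝ) ^ 3 := by field_simp
        _ ≤ _ := mul_le_mul_of_nonneg_left h6 (by positivity)
  rw [lintegral_P0]
  refine (mul_le_mul_right (lintegral_mono_ae hpt) _).trans ?_
  rw [lintegral_add_left (((measurable_num hφm).div_const _).const_mul _),
    lintegral_const_mul' _ _ ENNReal.ofReal_ne_top, lintegral_num_div h.tau_pos hφm,
    ← lintegral_P0, lintegral_const_mul' _ _ ENNReal.ofReal_ne_top]
  refine (mul_le_mul_right (add_le_add
    (mul_le_mul_right (lintegral_wtSqSum_le hmom h.tau_pos) _)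
    (mul_le_mul_right (lintegral_exp_abs_tilt_le h) _)) _).trans ?_
  rw [← ENNReal.ofReal_mul (by positivity), ← ENNReal.ofReal_mul hG0,
    ← ENNReal.ofReal_add (by positivity) (by positivity), ← ENNReal.ofReal_mul hn.le]
  refine ENNReal.ofReal_le_ofReal ?_
  have hlogρ : Real.log n ≤ 4 * ρ := by
    rw [← hρ4, Real.log_pow]
    have := Real.log_le_sub_one_of_pos hρ0
    push_cast
    linarith
  have hqρ : (M.q n : ℝ) ≤ 4 / C₅ * ρ := by
    refine hqn.trans ?_
    have := mul_le_mul_of_nonneg_left hlogρ (by positivity : 0 ≤ 1 / C₅)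
    refine this.trans (le_of_eq ?_)
    ring
  have hexp : Real.exp (12 * C₃ * M.q n) *
      Real.exp (72 * c₂ ^ 2 * B₀ / M.σ0sq * M.q n) ≤ n := by
    rw [← Real.exp_add, ← add_mul, ← hC₅]
    rw [← Real.le_log_iff_exp_le hn]
    have := mul_le_mul_of_nonneg_left hqn hC₅0.le
    refine this.trans (le_of_eq ?_)
    field_simp
  have ht := h.tau_le
  rw [← hρ2, ← hρ4] at ht
  have hτ0 := h.tau_pos.le
  have hsq : (M.τsq n * (ρ ^ 4 * ρ ^ 2)) ^ 2 ≤ (C₀ * M.q n) ^ 2 :=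
    pow_le_pow_left₀ (by positivity) ht 2
  have hA : (n : ℝ) * (ρ ^ 3 * (n * (M.τsq n ^ 2 * mean2 M))) ≤
      4 / C₅ * C₀ ^ 2 * mean2 M * M.q n := by
    rw [← hρ4]
    calc _ = (M.τsq n * (ρ ^ 4 * ρ ^ 2)) ^ 2 * mean2 M / ρ := by field_simp
      _ ≤ (C₀ * M.q n) ^ 2 * mean2 M / ρ := by gcongr
      _ = C₀ ^ 2 * mean2 M * M.q n * (M.q n) / ρ := by ring
      _ ≤ C₀ ^ 2 * mean2 M * M.q n * (4 / C₅ * ρ) / ρ := by gcongr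
      _ = _ := by field_simp
  have hB : (n : ℝ) * (G * (2 * Real.exp (72 * c₂ ^ 2 * B₀ / M.σ0sq * M.q n))) ≤ 2 := by
    calc _ = 2 / n * (Real.exp (12 * C₃ * M.q n) *
          Real.exp (72 * c₂ ^ 2 * B₀ / M.σ0sq * M.q n)) := by rw [hG]; field_simp
      _ ≤ 2 / n * n := by gcongr
      _ = 2 := by field_simp
  rw [mul_add, add_mul]
  linarith

end

section

variable {M : RVM.Model} {n : ℕ} {c₁ c₂ C₀ B₀ : ℝ}

lemma ofReal_trPostVarK_le (hc₂ : 0 < c₂) (h : Regular M c₁ c₂ C₀ B₀ n) {Y : Fin n → ℝ}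
    (hZ : evid M n Y ≠ 0) (hZ' : evid M n Y ≠ ∞) {a b R : ℝ≥0∞} (ha : a ≠ ∞) (hb : b ≠ ∞)
    (hR : R ≠ ∞) {φ ψ : (Fin n → ℝ) → ℝ≥0∞} (hψ : Measurable ψ)
    (hle : ∀ l : Fin n → ℝ, (∀ i, 0 < l i) →
      margSq M n Y l ≤ (a * φ l + b * ψ l + R) * marg M n Y l) :
    ENNReal.ofReal (M.trPostVarK n Y) ≤
      ENNReal.ofReal (c₂ ^ 2) * (a * post M n φ Y + b * post M n ψ Y + R) := by
  have h1 := trPostVarK_mul_le M n Y (c := c₂ ^ 2) (by positivity) h.upper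
  have hm := measurable_marg_right M n Y
  have h2 : ∫⁻ l, margSq M n Y l ∂prior M n ≤
      a * num M n φ Y + b * num M n ψ Y + R * evid M n Y := by
    refine (lintegral_mono_ae ((prior_ae_pos M n).mono hle)).trans (le_of_eq ?_)
    have hm1 : Measurable fun l => b * (marg M n Y l * ψ l) := (hm.mul hψ).const_mul b
    have hm2 : Measurable fun l => R * marg M n Y l := hm.const_mul R
    unfold num evid
    rw [← lintegral_const_mul' _ _ ha, ← lintegral_const_mul' _ _ hb,
      ← lintegral_const_mul' _ _ hR, ← lintegral_add_right _ hm1,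
      ← lintegral_add_right _ hm2]
    exact lintegral_congr fun l => by ring
  have h3 := (ENNReal.le_div_iff_mul_le (Or.inl hZ) (Or.inl hZ')).2
    (h1.trans (mul_le_mul_right h2 _))
  refine h3.trans (le_of_eq ?_)
  have h4 : R = R * evid M n Y / evid M n Y := by
    rw [mul_div_assoc, ENNReal.div_self hZ hZ', mul_one]
  conv_rhs => rw [h4]
  unfold post
  simp only [div_eq_mul_inv]
  ring

lemma one_add_sqnorm_mul_wtSum_le (hn : (0 : ℝ) < n) (hτ : 0 < M.τsq n) {l : Fin n → ℝ}
    (hl : ∀ i, 0 < l i) (B : ℝ) (Y : Fin n → ℝ) :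
    (1 + sqnorm Y / n) * wtSum M n l ≤
      (1 + B) * wtSum M n l + max (sqnorm Y - B * n) 0 := by
  have hm0 : 0 ≤ wtSum M n l := Finset.sum_nonneg fun i _ => wt_nonneg hτ hl i
  have h1 : wtSum M n l / n ≤ 1 := (div_le_one hn).2 (wtSum_le l)
  have h2 : 0 ≤ wtSum M n l / n := by positivity
  have h3 : (sqnorm Y - B * n) * (wtSum M n l / n) ≤ max (sqnorm Y - B * n) 0 :=
    (mul_le_mul_of_nonneg_right (le_max_left _ _) h2).trans
      (mul_le_of_le_one_right (le_max_right _ _) h1)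
  have h4 : (sqnorm Y - B * n) * (wtSum M n l / n) =
      sqnorm Y / n * wtSum M n l - B * wtSum M n l := by field_simp
  linarith

lemma sum_wt_mul_sq_le (hτ : 0 < M.τsq n) {l : Fin n → ℝ} (hl : ∀ i, 0 < l i) (A : ℝ)
    (w : Fin n → ℝ) :
    ∑ i, wt M n l i * w i ^ 2 ≤ A * wtSum M n l + ∑ i, max (w i ^ 2 - A) 0 := by
  rw [wtSum, Finset.mul_sum, ← Finset.sum_add_distrib]
  refine Finset.sum_le_sum fun i _ => ?_
  have h0 := wt_nonneg hτ hl i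
  have h3 : (w i ^ 2 - A) * wt M n l i ≤ max (w i ^ 2 - A) 0 :=
    (mul_le_mul_of_nonneg_right (le_max_left _ _) h0).trans
      (mul_le_of_le_one_right (le_max_right _ _) (wt_le_one l i))
  linarith

lemma sqnorm_mul_wtSqSum_le (hτ : 0 < M.τsq n) {l : Fin n → ℝ} (hl : ∀ i, 0 < l i) (B : ℝ)
    (Y : Fin n → ℝ) :
    sqnorm Y * wtSqSum M n l ≤
      B * (n * wtSqSum M n l) + n * max (sqnorm Y - B * n) 0 := by
  have h0 : 0 ≤ wtSqSum M n l := Finset.sum_nonneg fun i _ => sq_nonneg _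
  have h3 : (sqnorm Y - B * n) * wtSqSum M n l ≤ max (sqnorm Y - B * n) 0 * n :=
    mul_le_mul (le_max_left _ _) (wtSqSum_le hτ hl) h0 (le_max_right _ _)
  linarith

lemma ofReal_max_zero (x : ℝ) : ENNReal.ofReal (max x 0) = ENNReal.ofReal x := by
  rw [ENNReal.ofReal_max, ENNReal.ofReal_zero, max_eq_left zero_le]

/-- Uniform bound on the expected trace of the posterior covariance. -/
lemma exists_E0_trPostVarK_le (M : RVM.Model) (hmom : M.Moment4) (hc₁ : 0 < c₁) (hc₂ : 0 < c₂)
    (C₀ B₀ : ℝ) : ∃ C : ℝ, 0 < C ∧ ∀ n, Regular M c₁ c₂ C₀ B₀ n →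
      M.E0 n (fun Y => M.trPostVarK n Y) ≤ C * M.q n := by
  obtain ⟨D, hD, hmarg⟩ := exists_margSq_le (c₂ := c₂) M hc₁
  obtain ⟨C₃, hC₃, hF⟩ := exists_trueDens_mul_le M hmom hc₁ c₂ C₀ B₀
  obtain ⟨B, C₁, hB, hC₁, htail⟩ := exists_tail_sqnorm M c₁ c₂ C₀ B₀
  obtain ⟨A, C₂, hA, hC₂, hcoord⟩ := exists_tail_coord M c₁ hc₂ C₀ B₀
  obtain ⟨C₄, hC₄, hX⟩ := exists_lintegral_post_wtSum_le M hmom hc₁ c₂ C₀ B₀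
  obtain ⟨δ, C₅, hδ, hC₅, hX2⟩ := exists_lintegral_post_wtSqSum_le M hmom hc₁ c₂ C₀ B₀
  refine ⟨c₂ ^ 2 * (D * ((1 + B + A) * (C₄ * (1 + 1 / δ)) + (C₁ + C₂)) +
    D * ((1 + B) * (2 * C₄) + B * C₅ + 2 * C₁)), by positivity, fun n h => ?_⟩
  have hq := h.one_le
  have hlog := h.one_le_log
  have hn4 := h.four_le'
  have hn : (0 : ℝ) < n := by linarith
  set φ : (Fin n → ℝ) → ℝ≥0∞ := fun l => ENNReal.ofReal (wtSum M n l) with hφ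
  set ψ : (Fin n → ℝ) → ℝ≥0∞ := fun l => ENNReal.ofReal (wtSqSum M n l) with hψ
  have hφm : Measurable φ := measurable_wtSum.ennreal_ofReal
  have hψm : Measurable ψ := measurable_wtSqSum.ennreal_ofReal
  have hsm : Measurable fun Y : Fin n → ℝ => ENNReal.ofReal (sqnorm Y - B * n) :=
    (continuous_sqnorm.measurable.sub_const _).ennreal_ofReal
  have htail1 : ∫⁻ Y, ENNReal.ofReal (sqnorm Y - B * n) ∂P0 M n ≤ ENNReal.ofReal C₁ := by
    refine le_trans ?_ (htail n h)
    refine le_mul_of_one_le_left zero_le ?_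
    exact_mod_cast (by have := h.four_le; omega : 1 ≤ n)
  have hac : ∀ᵐ Y ∂P0 M n, evid M n Y < ∞ :=
    (withDensity_absolutelyContinuous _ _).ae_le (evid_ae_lt_top h.tau_pos)
  have hmargn := hmarg n h.four_le h.tau_pos h.symm h.lower h.upper
  refine E0_le (by positivity) ?_
  rw [mul_assoc, ENNReal.ofReal_mul (by positivity)]
  rcases le_or_gt (M.q n : ℝ) (δ * Real.log n) with hcase | hcase
  · have hpt : ∀ᵐ Y ∂P0 M n, ENNReal.ofReal (M.trPostVarK n Y) ≤ ENNReal.ofReal (c₂ ^ 2) *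
        (ENNReal.ofReal (D * (1 + B)) * post M n φ Y +
          ENNReal.ofReal (D * B * n) * post M n ψ Y +
          ENNReal.ofReal (D * (1 + n)) * ENNReal.ofReal (sqnorm Y - B * n)) := by
      filter_upwards [hac] with Y hY
      refine ofReal_trPostVarK_le hc₂ h (evid_ne_zero h.tau_pos (hF n h Y)) hY.ne
        ENNReal.ofReal_ne_top ENNReal.ofReal_ne_top
        (ENNReal.mul_ne_top ENNReal.ofReal_ne_top ENNReal.ofReal_ne_top) hψm fun l hl => ?_
      refine (hmargn Y l hl).2.trans (mul_le_mul_left ?_ _)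
      have hm0 : 0 ≤ wtSum M n l := Finset.sum_nonneg fun i _ => wt_nonneg h.tau_pos hl i
      have hm20 : 0 ≤ wtSqSum M n l := Finset.sum_nonneg fun i _ => sq_nonneg _
      have hmax : 0 ≤ max (sqnorm Y - B * n) 0 := le_max_right _ _
      rw [← ofReal_max_zero (sqnorm Y - B * n), ← ENNReal.ofReal_mul (by positivity),
        ← ENNReal.ofReal_mul (by positivity), ← ENNReal.ofReal_mul (by positivity),
        ← ENNReal.ofReal_add (by positivity) (by positivity),
        ← ENNReal.ofReal_add (by positivity) (by positivity)]
      refine ENNReal.ofReal_le_ofReal ?_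
      have h1 := one_add_sqnorm_mul_wtSum_le hn h.tau_pos hl B Y
      have h2 := sqnorm_mul_wtSqSum_le h.tau_pos hl B Y
      have h3 := mul_le_mul_of_nonneg_left (add_le_add h1 h2) hD.le
      refine h3.trans (le_of_eq ?_)
      ring
    refine (lintegral_mono_ae hpt).trans ?_
    rw [lintegral_const_mul' _ _ ENNReal.ofReal_ne_top]
    refine mul_le_mul_right ?_ _
    rw [lintegral_add_right _ (hsm.const_mul _),
      lintegral_add_right _ ((measurable_post hψm).const_mul _),
      lintegral_const_mul' _ _ ENNReal.ofReal_ne_top,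
      lintegral_const_mul' _ _ ENNReal.ofReal_ne_top,
      lintegral_const_mul' _ _ ENNReal.ofReal_ne_top]
    have hX1 : ∫⁻ Y, post M n φ Y ∂P0 M n ≤ ENNReal.ofReal (2 * C₄ * M.q n) := by
      have h1 : ENNReal.ofReal (Real.log n) * ∫⁻ Y, post M n φ Y ∂P0 M n ≤
          ENNReal.ofReal (Real.log n) * ENNReal.ofReal (2 * C₄ * M.q n) := by
        refine (hX n h).trans ?_
        rw [← ENNReal.ofReal_mul (by linarith)]
        refine ENNReal.ofReal_le_ofReal ?_
        have h2 : (M.q n : ℝ) + Real.log n ≤ 2 * (M.q n * Real.log n) := by nlinarith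
        have := mul_le_mul_of_nonneg_left h2 hC₄.le
        linarith
      refine (ENNReal.mul_le_mul_iff_right ?_ ENNReal.ofReal_ne_top).1 h1
      simpa [ENNReal.ofReal_eq_zero] using (by linarith : 0 < Real.log n)
    have hT : ENNReal.ofReal (D * (1 + n)) * ∫⁻ Y, ENNReal.ofReal (sqnorm Y - B * n) ∂P0 M n ≤
        ENNReal.ofReal (D * (2 * C₁)) := by
      rw [ENNReal.ofReal_mul hD.le, ENNReal.ofReal_mul hD.le, mul_assoc]
      refine mul_le_mul_right ?_ _
      rw [ENNReal.ofReal_add zero_le_one hn.le, add_mul, ENNReal.ofReal_one, one_mul, two_mul,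
        ENNReal.ofReal_add hC₁.le hC₁.le, ENNReal.ofReal_natCast]
      exact add_le_add htail1 (htail n h)
    have hX2' : ENNReal.ofReal (D * B * n) * ∫⁻ Y, post M n ψ Y ∂P0 M n ≤
        ENNReal.ofReal (D * B * (C₅ * M.q n)) := by
      rw [ENNReal.ofReal_mul (by positivity), ENNReal.ofReal_mul (p := D * B) (by positivity),
        mul_assoc]
      exact mul_le_mul_right (hX2 n h hcase) _
    refine (add_le_add (add_le_add (mul_le_mul_right hX1 _) hX2') hT).trans ?_
    rw [← ENNReal.ofReal_mul (by positivity), ← ENNReal.ofReal_add (by positivity) (by positivity),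
      ← ENNReal.ofReal_add (by positivity) (by positivity)]
    refine ENNReal.ofReal_le_ofReal ?_
    have h5 : 0 ≤ D * ((1 + B + A) * (C₄ * (1 + 1 / δ)) + (C₁ + C₂)) * M.q n := by positivity
    have h6 := mul_le_mul_of_nonneg_left hq (by positivity : 0 ≤ D * (2 * C₁))
    linarith
  · have hpt : ∀ᵐ Y ∂P0 M n, ENNReal.ofReal (M.trPostVarK n Y) ≤ ENNReal.ofReal (c₂ ^ 2) *
        (ENNReal.ofReal (D * ((1 + B + A) * Real.log n)) * post M n φ Y + 0 * post M n ψ Y +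
          ENNReal.ofReal D * (ENNReal.ofReal (sqnorm Y - B * n) +
            ∑ i, ENNReal.ofReal ((M.K n *ᵥ Y) i ^ 2 - A * Real.log n))) := by
      filter_upwards [hac] with Y hY
      refine ofReal_trPostVarK_le hc₂ h (evid_ne_zero h.tau_pos (hF n h Y)) hY.ne
        ENNReal.ofReal_ne_top ENNReal.zero_ne_top
        (ENNReal.mul_ne_top ENNReal.ofReal_ne_top (ENNReal.add_ne_top.2
          ⟨ENNReal.ofReal_ne_top, ENNReal.sum_ne_top.2 fun i _ => ENNReal.ofReal_ne_top⟩))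
        hψm fun l hl => ?_
      refine (hmargn Y l hl).1.trans (mul_le_mul_left ?_ _)
      have hm0 : 0 ≤ wtSum M n l := Finset.sum_nonneg fun i _ => wt_nonneg h.tau_pos hl i
      have hmax : 0 ≤ max (sqnorm Y - B * n) 0 := le_max_right _ _
      have hmax2 : ∀ i, 0 ≤ max ((M.K n *ᵥ Y) i ^ 2 - A * Real.log n) 0 := fun i =>
        le_max_right _ _
      have hmax3 : 0 ≤ ∑ i, max ((M.K n *ᵥ Y) i ^ 2 - A * Real.log n) 0 :=
        Finset.sum_nonneg fun i _ => hmax2 i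
      have hc : 0 ≤ D * ((1 + B + A) * Real.log n) := by
        have : 0 ≤ Real.log n := by linarith
        positivity
      simp only [← ofReal_max_zero (sqnorm Y - B * n),
        fun i => (ofReal_max_zero ((M.K n *ᵥ Y) i ^ 2 - A * Real.log n)).symm]
      rw [← ENNReal.ofReal_sum_of_nonneg fun i _ => hmax2 i, zero_mul, add_zero,
        ← ENNReal.ofReal_add hmax hmax3, ← ENNReal.ofReal_mul hD.le, ← ENNReal.ofReal_mul hc,
        ← ENNReal.ofReal_add (by positivity) (by positivity)]
      refine ENNReal.ofReal_le_ofReal ?_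
      have h1 := one_add_sqnorm_mul_wtSum_le hn h.tau_pos hl B Y
      have h2 := sum_wt_mul_sq_le h.tau_pos hl (A * Real.log n) (M.K n *ᵥ Y)
      have h3 := mul_le_mul_of_nonneg_left (add_le_add h1 h2) hD.le
      have h4 : (1 + B) * wtSum M n l ≤ (1 + B) * wtSum M n l * Real.log n :=
        le_mul_of_one_le_right (by positivity) hlog
      have h5 := mul_le_mul_of_nonneg_left h4 hD.le
      refine h3.trans ?_
      linarith
    refine (lintegral_mono_ae hpt).trans ?_
    rw [lintegral_const_mul' _ _ ENNReal.ofReal_ne_top]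
    refine mul_le_mul_right ?_ _
    simp only [zero_mul, add_zero]
    rw [lintegral_add_left ((measurable_post hφm).const_mul _),
      lintegral_const_mul' _ _ ENNReal.ofReal_ne_top,
      lintegral_const_mul' _ _ ENNReal.ofReal_ne_top, lintegral_add_left hsm]
    have hX1 : ENNReal.ofReal (D * ((1 + B + A) * Real.log n)) *
        ∫⁻ Y, post M n φ Y ∂P0 M n ≤
        ENNReal.ofReal (D * (1 + B + A) * (C₄ * (1 + 1 / δ) * M.q n)) := by
      rw [← mul_assoc, ENNReal.ofReal_mul (by positivity),
        ENNReal.ofReal_mul (p := D * (1 + B + A)) (by positivity), mul_assoc]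
      refine mul_le_mul_right ((hX n h).trans (ENNReal.ofReal_le_ofReal ?_)) _
      have h1 : Real.log n ≤ 1 / δ * M.q n := by
        rw [one_div, ← div_eq_inv_mul, le_div_iff₀ hδ]; linarith
      have h2 := mul_le_mul_of_nonneg_left h1 hC₄.le
      linarith
    refine (add_le_add hX1 (mul_le_mul_right (add_le_add htail1 (hcoord n h)) _)).trans ?_
    rw [← ENNReal.ofReal_add (by positivity) (by positivity), ← ENNReal.ofReal_mul hD.le,
      ← ENNReal.ofReal_add (by positivity) (by positivity)]
    refine ENNReal.ofReal_le_ofReal ?_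
    have h5 : 0 ≤ D * ((1 + B) * (2 * C₄) + B * C₅ + 2 * C₁) * M.q n := by positivity
    have h6 := mul_le_mul_of_nonneg_left hq (by positivity : 0 ≤ D * C₁)
    linarith

lemma sqnorm_beta_le {M₀ : ℝ} (hM₀ : ∀ i, |M.β0 n i| < M₀) :
    sqnorm (M.β0 n) ≤ M₀ ^ 2 * M.q n := by
  classical
  have hq : M.q n = (Finset.univ.filter fun i : Fin n => M.β0 n i ≠ 0).card := by
    rw [RVM.Model.q, Set.ncard_eq_toFinset_card']
    congr 1; ext i; simp
  rw [sqnorm_eq_sum, hq, mul_comm, ← nsmul_eq_mul, ← Finset.sum_const, Finset.sum_filter]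
  refine Finset.sum_le_sum fun i _ => ?_
  split_ifs with hi
  · rw [← sq_abs]
    exact pow_le_pow_left₀ (abs_nonneg _) (hM₀ i).le 2
  · rw [not_not.1 hi]; norm_num

lemma eventually_regular (hτpos : ∀ n, 0 < M.τsq n) (hA1 : M.CondA1) (hA2 : M.CondA2)
    (hτ : ∃ C > (0 : ℝ), ∃ N : ℕ, ∀ n ≥ N,
      M.τsq n ≤ C * ((n : ℝ) ^ (-(3 : ℝ) / 2) * M.q n)) :
    ∃ c₁ c₂ C₀ B₀ : ℝ, 0 < c₁ ∧ 0 < c₂ ∧ ∃ N : ℕ, ∀ n ≥ N, Regular M c₁ c₂ C₀ B₀ n := by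
  obtain ⟨c₁, c₂, hc₁, hc₁₂, N₁, hN₁⟩ := hA1
  obtain ⟨M₀, hM₀⟩ := hA2
  obtain ⟨C, hC, N₂, hN₂⟩ := hτ
  have hc₂ : 0 < c₂ := hc₁.trans_le hc₁₂
  refine ⟨c₁, c₂, C, M₀ ^ 2, hc₁, hc₂, max 4 (max N₁ N₂), fun n hn => ?_⟩
  have hn4 : 4 ≤ n := (le_max_left _ _).trans hn
  obtain ⟨hK1, hK2⟩ := hN₁ n ((le_max_left _ _).trans ((le_max_right _ _).trans hn))
  have ht := hN₂ n ((le_max_right _ _).trans ((le_max_right _ _).trans hn))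
  have hn0 : (0 : ℝ) < n := by exact_mod_cast (by omega : 0 < n)
  refine ⟨hn4, hτpos n, ?_, sqnorm_mulVec_ge hc₁ hK1, sqnorm_mulVec_le (M.hK n) hc₂ hK2, ?_, ?_,
    ?_, sqnorm_beta_le (hM₀ n)⟩
  · simpa [conjTranspose_eq_transpose_of_trivial] using (M.hK n).isHermitian.eq
  · have h0 : M.q n ≠ 0 := fun h0 => by
      have := hτpos n
      rw [h0] at ht
      simp only [Nat.cast_zero, mul_zero] at ht
      linarith
    exact_mod_cast Nat.one_le_iff_ne_zero.2 h0
  · have h1 : M.q n ≤ n := by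
      rw [RVM.Model.q]
      simpa using Set.ncard_le_ncard (Set.subset_univ {i : Fin n | M.β0 n i ≠ 0})
    exact_mod_cast h1
  · have h1 : (n : ℝ) ^ (-(3 : ℝ) / 2) * (n * √n) = 1 := by
      have h2 : (n : ℝ) * √n = (n : ℝ) ^ ((3 : ℝ) / 2) := by
        rw [Real.sqrt_eq_rpow]
        nth_rewrite 1 [← Real.rpow_one (n : ℝ)]
        rw [← Real.rpow_add hn0]
        norm_num
      rw [h2, ← Real.rpow_add hn0]
      norm_num
    have h3 := mul_le_mul_of_nonneg_right ht (by positivity : 0 ≤ (n : ℝ) * √n)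
    calc _ ≤ _ := h3
      _ = C * M.q n * ((n : ℝ) ^ (-(3 : ℝ) / 2) * (n * √n)) := by ring
      _ = _ := by rw [h1, mul_one]

end

end RVMProof

/-- **Theorem 2.** Under (A1)–(A3), if `τₙ² ⪯ n^{−3/2} qₙ` and `∫ λ⁴ π(λ²) dλ² < ∞`, then
`E₀ [tr V(Kₙβₙ | Yₙ)] ⪯ qₙ` as `n → ∞`. -/
theorem theorem2 (M : RVM.Model) (hτpos : ∀ n, 0 < M.τsq n)
    (hA1 : M.CondA1) (hA2 : M.CondA2) (hA3 : M.CondA3)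
    (hτ : ∃ C > (0 : ℝ), ∃ N : ℕ, ∀ n ≥ N,
      M.τsq n ≤ C * ((n : ℝ) ^ (-(3 : ℝ) / 2) * M.q n))
    (hmom : M.Moment4) :
    ∃ C > (0 : ℝ), ∃ N : ℕ, ∀ n ≥ N,
      M.E0 n (fun Y => M.trPostVarK n Y) ≤ C * M.q n := by
  obtain ⟨c₁, c₂, C₀, B₀, hc₁, hc₂, N, hN⟩ := RVMProof.eventually_regular hτpos hA1 hA2 hτ
  obtain ⟨C, hC, h⟩ := RVMProof.exists_E0_trPostVarK_le M hmom hc₁ hc₂ C₀ B₀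
  exact ⟨C, hC, N, fun n hn => h n (hN n hn)⟩
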